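/- arXiv:1108.5708 — 2 statements merged into one kernel-verified Lean document; each statement's English description precedes it below -/
import Mathlib

section
/- Let R be a chain ring such that every indecomposable injective R-module contains a pure uniserial submodule. Then every indecomposable injective R-module has finite Malcev rank if and only if every indecomposable injective R-module is polyserial. -/
open DirectSum


universe u v

/-- `gen M ≤ n`: `M` is generated by at most `n` elements. -/
def GenLE (R : Type u) [Semiring R] (M : Type v) [AddCommMonoid M] [Module R M] (n : ℕ) : Prop :=
  ∃ s : Finset M, s.card ≤ n ∧ Submodule.span R (s : Set M) = ⊤

/-- The Malcev rank of `M` is at most `n`: every finitely generated submodule of `M`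
is generated by at most `n` elements. -/
def MalcevRankLE (R : Type u) [Semiring R] (M : Type v) [AddCommMonoid M] [Module R M]
    (n : ℕ) : Prop :=
  ∀ X : Submodule R M, X.FG →
    ∃ s : Finset M, (s : Set M) ⊆ (X : Set M) ∧ s.card ≤ n ∧ Submodule.span R (s : Set M) = X

/-- An indecomposable (nonzero) module. -/
def IsIndecomposable (R : Type u) [Semiring R] (M : Type v) [AddCommMonoid M] [Module R M] :
    Prop :=
  (∃ x : M, x ≠ 0) ∧ ¬∃ A B : Submodule R M, A ≠ ⊥ ∧ B ≠ ⊥ ∧ IsCompl A B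

/-- A uniform module. -/
def IsUniformModule (R : Type u) [Semiring R] (M : Type v) [AddCommMonoid M] [Module R M] :
    Prop :=
  (∃ x : M, x ≠ 0) ∧ ∀ A B : Submodule R M, A ≠ ⊥ → B ≠ ⊥ → A ⊓ B ≠ ⊥

/-- A pure submodule: tensoring with any module preserves injectivity of the inclusion. -/
def IsPureSubmodule (R : Type u) [CommRing R] {M : Type v} [AddCommGroup M] [Module R M]
    (A : Submodule R M) : Prop :=
  ∀ (C : Type (max u v)) [AddCommGroup C] [Module R C],
    Function.Injective (LinearMap.rTensor C A.subtype)

/-- A uniserial module: submodules are totally ordered. -/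
def IsUniserialModule (R : Type u) [Semiring R] (M : Type v) [AddCommMonoid M] [Module R M] :
    Prop :=
  ∀ A B : Submodule R M, A ≤ B ∨ B ≤ A

/-- A polyserial module: it has a pure-composition series with uniserial factors. -/
def IsPolyserial (R : Type u) [CommRing R] (M : Type v) [AddCommGroup M] [Module R M] : Prop :=
  ∃ (n : ℕ) (F : Fin (n + 1) → Submodule R M),
    F 0 = ⊥ ∧ F (Fin.last n) = ⊤ ∧ StrictMono F ∧
    (∀ i, IsPureSubmodule R (F i)) ∧
    ∀ i : Fin n,
      IsUniserialModule R (↥(F i.succ) ⧸ Submodule.comap (F i.succ).subtype (F i.castSucc))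

/-- A pure-injective module. -/
def IsPureInjective (R : Type u) [CommRing R] (F : Type v) [AddCommGroup F] [Module R F] :
    Prop :=
  ∀ (B : Type (max u v)) [AddCommGroup B] [Module R B] (A : Submodule R B),
    IsPureSubmodule R A → ∀ f : A →ₗ[R] F, ∃ g : B →ₗ[R] F, ∀ a : A, g a = f a

/-- `B` is a pure-essential extension of its submodule `A`. -/
def IsPureEssentialExtension (R : Type u) [CommRing R] {B : Type v} [AddCommGroup B]
    [Module R B] (A : Submodule R B) : Prop :=
  IsPureSubmodule R A ∧
  ∀ K : Submodule R B, K ⊓ A = ⊥ → IsPureSubmodule R (A.map K.mkQ) → K = ⊥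

/-- A maximal ring: every finitely solvable family of congruences is solvable. -/
def IsMaximalCR (R : Type u) [CommRing R] : Prop :=
  ∀ (ι : Type u) (a : ι → R) (A : ι → Ideal R),
    (∀ s : Finset ι, ∃ x : R, ∀ i ∈ s, x - a i ∈ A i) → ∃ x : R, ∀ i, x - a i ∈ A i

/-- An almost maximal ring. -/
def IsAlmostMaximalCR (R : Type u) [CommRing R] : Prop :=
  ∀ (ι : Type u) (a : ι → R) (A : ι → Ideal R), (⨅ i, A i) ≠ ⊥ →
    (∀ s : Finset ι, ∃ x : R, ∀ i ∈ s, x - a i ∈ A i) → ∃ x : R, ∀ i, x - a i ∈ A i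

/-- `M_♯`, the bottom prime ideal associated with `M`, as a set. -/
def sharpSet (R : Type u) [CommRing R] (M : Type v) [AddCommGroup M] [Module R M] : Set R :=
  {s : R | ∃ x : M, x ≠ 0 ∧ s • x = 0}

/-- The set of zero-divisors of `R`. -/
def zeroDivisorsSet (R : Type u) [CommRing R] : Set R :=
  {r : R | ∃ s : R, s ≠ 0 ∧ r * s = 0}

/-- Finite Goldie dimension: every independent family of nonzero submodules is finite. -/
def HasFiniteGoldieDimension (R : Type u) [Semiring R] (M : Type v) [AddCommMonoid M]
    [Module R M] : Prop :=
  ∀ (ι : Type v) (f : ι → Submodule R M), (∀ i, f i ≠ ⊥) →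
    (∀ i, f i ⊓ (⨆ j : {j : ι // j ≠ i}, f j.1) = ⊥) → Finite ι

/-- A superfluous (small) submodule. -/
def IsSuperfluous {R : Type u} [Semiring R] {M : Type v} [AddCommMonoid M] [Module R M]
    (K : Submodule R M) : Prop :=
  ∀ G : Submodule R M, K ⊔ G = ⊤ → G = ⊤

/-- A co-uniform (hollow) module. -/
def IsCouniform (R : Type u) [Semiring R] (M : Type v) [AddCommMonoid M] [Module R M] : Prop :=
  (∃ x : M, x ≠ 0) ∧ ∀ K : Submodule R M, K ≠ ⊤ → IsSuperfluous K

/-- An essential submodule. -/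
def IsEssentialSubmodule {R : Type u} [Semiring R] {M : Type v} [AddCommMonoid M] [Module R M]
    (A : Submodule R M) : Prop :=
  ∀ K : Submodule R M, K ⊓ A = ⊥ → K = ⊥

/-- `M` has dual Goldie dimension `n`. -/
def HasDualGoldieDim (R : Type u) [Ring R] (M : Type v) [AddCommGroup M] [Module R M]
    (n : ℕ) : Prop :=
  ∃ (N : Fin n → Type v) (hab : ∀ i, AddCommGroup (N i)),
    letI := hab
    ∃ hmod : ∀ i, Module R (N i),
      letI := hmod
      ∃ φ : M →ₗ[R] ⨁ i, N i,
        Function.Surjective φ ∧ IsSuperfluous (LinearMap.ker φ) ∧ ∀ i, IsCouniform R (N i)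

set_option linter.unusedSectionVars false

namespace ChainRing

section Basic

variable {R : Type u} [CommRing R]

/-- The set of ring elements acting non-injectively on `R ⧸ I`. -/
def shp (I : Ideal R) : Set R := {r | ∃ y, y ∉ I ∧ r * y ∈ I}

/-- The ideal of scalars carrying `e` into `V`. -/
def col {M : Type v} [AddCommGroup M] [Module R M] (V : Submodule R M) (e : M) : Ideal R :=
  V.comap (LinearMap.toSpanSingleton R M e)

variable {M : Type v} [AddCommGroup M] [Module R M]

@[simp] theorem mem_col {V : Submodule R M} {e : M} {r : R} : r ∈ col V e ↔ r • e ∈ V := Iff.rfl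

theorem col_smul (V : Submodule R M) (e : M) (r : R) : col V (r • e) = col (col V e) r := by
  ext s; simp [mul_smul]

theorem notMem_shp {I : Ideal R} {r : R} : r ∉ shp I ↔ ∀ y, r * y ∈ I → y ∈ I := by
  constructor
  · intro h y hy
    by_contra hn
    exact h ⟨y, hn, hy⟩
  · rintro h ⟨y, hn, hy⟩
    exact hn (h y hy)

theorem shp_mul_right {I : Ideal R} {r : R} (h : r ∈ shp I) (s : R) : r * s ∈ shp I := by
  obtain ⟨y, hy, hr⟩ := h
  exact ⟨y, hy, by rw [mul_right_comm]; exact I.mul_mem_right s hr⟩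

theorem shp_mul_left {I : Ideal R} {r : R} (h : r ∈ shp I) (s : R) : s * r ∈ shp I := by
  rw [mul_comm]; exact shp_mul_right h s

theorem notMem_shp_mul {I : Ideal R} {r s : R} (h : r ∉ shp I) (h' : s ∉ shp I) :
    r * s ∉ shp I := by
  rw [notMem_shp] at *
  intro y hy
  exact h' y (h _ (by rwa [← mul_assoc]))

theorem notMem_shp_of_isUnit {I : Ideal R} {r : R} (h : IsUnit r) : r ∉ shp I := by
  rw [notMem_shp]
  intro y hy
  obtain ⟨u, rfl⟩ := h
  simpa [← mul_assoc] using I.mul_mem_left (↑u⁻¹ : R) hy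

theorem one_notMem_shp {I : Ideal R} : (1 : R) ∉ shp I := notMem_shp_of_isUnit isUnit_one

theorem mem_shp_of_mem {I : Ideal R} (hI : (1 : R) ∉ I) {r : R} (h : r ∈ I) : r ∈ shp I :=
  ⟨1, hI, by simpa using h⟩

theorem dvd_or [PreValuationRing R] (a b : R) : a ∣ b ∨ b ∣ a := ValuationRing.dvd_total a b

theorem notMem_shp_sub [PreValuationRing R] [IsLocalRing R] {I : Ideal R} {t r : R}
    (ht : t ∉ shp I) (hr : r ∈ shp I) (s : R) : t - s * r ∉ shp I := by
  rcases dvd_or t r with ⟨c, rfl⟩ | ⟨c, rfl⟩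
  · have hc : c ∈ shp I := by
      by_contra hc
      exact notMem_shp_mul ht hc hr
    have h1 : ¬ IsUnit (s * c) := fun h => notMem_shp_of_isUnit h (shp_mul_left hc s)
    have h2 : IsUnit (1 - s * c) :=
      (IsLocalRing.isUnit_or_isUnit_one_sub_self (s * c)).resolve_left h1
    have h3 := notMem_shp_mul ht (notMem_shp_of_isUnit (I := I) h2)
    rwa [show t - s * (t * c) = t * (1 - s * c) by ring]
  · exact absurd (shp_mul_right hr c) ht

theorem shp_col [PreValuationRing R] {I : Ideal R} {r : R} (hr : r ∉ I) :
    shp (col I r) = shp I := by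
  ext l
  constructor
  · rintro ⟨y, hy, hl⟩
    exact ⟨y * r, by simpa using hy, by simpa [mul_assoc] using hl⟩
  · rintro ⟨y, hy, hl⟩
    rcases dvd_or r y with ⟨w, rfl⟩ | ⟨w, rfl⟩
    · refine ⟨w, by simpa [mul_comm] using hy, ?_⟩
      simpa [mul_comm, mul_left_comm] using hl
    · refine ⟨1, by simpa using hr, ?_⟩
      simpa [mul_assoc] using I.mul_mem_right w hl

theorem shp_col_smul [PreValuationRing R] {V : Submodule R M} {e : M} {r : R} (h : r • e ∉ V) :
    shp (col V (r • e)) = shp (col V e) := by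
  rw [col_smul]; exact shp_col h

theorem smul_eq_zero_of_dvd {a b : R} (h : a ∣ b) {x : M} (hx : a • x = 0) : b • x = 0 := by
  obtain ⟨c, rfl⟩ := h
  rw [mul_comm, mul_smul, hx, smul_zero]

theorem smul_mem_of_dvd {V : Submodule R M} {a b : R} (h : a ∣ b) {x : M} (hx : a • x ∈ V) :
    b • x ∈ V := by
  obtain ⟨c, rfl⟩ := h
  rw [mul_comm, mul_smul]; exact V.smul_mem _ hx

/-- Relative divisibility (elementwise purity). -/
def RDPure (V : Submodule R M) : Prop := ∀ (r : R) (e : M), r • e ∈ V → ∃ v ∈ V, r • e = r • v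

theorem RDPure.approx {V : Submodule R M} (hV : RDPure V) {r : R} {e : M} (h : r • e ∈ V) :
    ∃ v ∈ V, r • (e - v) = 0 := by
  obtain ⟨v, hv, hr⟩ := hV r e h
  exact ⟨v, hv, by rw [smul_sub, hr, sub_self]⟩

/-- Elementwise uniseriality of a submodule. -/
def USer (V : Submodule R M) : Prop := ∀ x ∈ V, ∀ y ∈ V, (∃ c : R, x = c • y) ∨ ∃ c : R, y = c • x

/-- Among any `n + 1` elements there is a linear relation with a unit coefficient. -/
def RelRankLE (R : Type u) [CommRing R] (M : Type v) [AddCommGroup M] [Module R M] (n : ℕ) : Prop :=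
  ∀ y : ℕ → M, ∃ a : ℕ → R, ∑ i ∈ Finset.range (n + 1), a i • y i = 0 ∧ ∃ i, i ≤ n ∧ IsUnit (a i)

theorem RelRankLE.of_surjective {N : Type v} [AddCommGroup N] [Module R N] {n : ℕ}
    (h : RelRankLE R M n) (f : M →ₗ[R] N) (hf : Function.Surjective f) : RelRankLE R N n := by
  intro y
  choose g hg using hf
  obtain ⟨a, ha, hu⟩ := h (fun i => g (y i))
  refine ⟨a, ?_, hu⟩
  have := congrArg f ha
  simpa [map_sum, hg] using this

end Basic

/-- The standing situation: an injective module of finite relation rank, essential over a pure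
uniserial submodule. -/
structure Good {R : Type u} [CommRing R] {E : Type u} [AddCommGroup E] [Module R E]
    (U : Submodule R E) : Prop where
  inj : Module.Injective R E
  ne : ∃ u ∈ U, u ≠ 0
  ess : ∀ x : E, x ≠ 0 → ∃ c : R, c • x ∈ U ∧ c • x ≠ 0
  pure : RDPure U
  ser : USer U
  rank : ∃ n, RelRankLE R E n

section Inj

variable {R : Type u} [CommRing R] {E : Type u} [AddCommGroup E] [Module R E]

theorem exists_extend (hE : Module.Injective R E) {N : Type u} [AddCommGroup N] [Module R N]
    (A : Submodule R N) (f : A →ₗ[R] E) : ∃ g : N →ₗ[R] E, ∀ a : A, g a = f a :=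
  hE.out A.subtype A.injective_subtype f

theorem exists_map_eq (hE : Module.Injective R E) {N : Type u} [AddCommGroup N] [Module R N]
    (x : N) (e : E) (h : ∀ r : R, r • x = 0 → r • e = 0) : ∃ g : N →ₗ[R] E, g x = e := by
  obtain ⟨g, hg⟩ := exists_extend hE _ (LinearPMap.mkSpanSingleton' (σ := RingHom.id R) x e h).toFun
  refine ⟨g, ?_⟩
  have hx : x ∈ (LinearPMap.mkSpanSingleton' (σ := RingHom.id R) x e h).domain :=
    Submodule.mem_span_singleton_self x
  rw [hg ⟨x, hx⟩]
  have := LinearPMap.mkSpanSingleton'_apply (σ := RingHom.id R) x e h 1 (by simp)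
  simp only [one_smul, RingHom.id_apply] at this
  exact this

theorem exists_smul_eq (hE : Module.Injective R E) (a : R) (e : E)
    (h : ∀ r : R, r * a = 0 → r • e = 0) : ∃ e' : E, a • e' = e := by
  obtain ⟨g, hg⟩ := exists_map_eq hE a e h
  exact ⟨g 1, by rw [← map_smul, smul_eq_mul, mul_one, hg]⟩

/-- A map from an ideal into an injective module is multiplication by an element. -/
theorem exists_eq_smul (hE : Module.Injective R E) (I : Ideal R) (f : I →ₗ[R] E) :
    ∃ e : E, ∀ z : I, f z = (z : R) • e := by
  obtain ⟨g, hg⟩ := exists_extend hE I f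
  exact ⟨g 1, fun z => by rw [← hg, ← map_smul, smul_eq_mul, mul_one]⟩

end Inj

end ChainRing

namespace ChainRing

section Approx

variable {R : Type u} [CommRing R] [PreValuationRing R]

theorem smul_eq_zero_iff_of_approx {M : Type v} [AddCommGroup M] [Module R M] {a : R} {x y : M}
    (h : a • (x - y) = 0) (hx : a • x ≠ 0) (r : R) : r • x = 0 ↔ r • y = 0 := by
  have hy : a • y ≠ 0 := by
    rw [smul_sub, sub_eq_zero] at h
    rwa [← h]
  rcases dvd_or a r with hr | hr
  · have := smul_eq_zero_of_dvd hr h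
    rw [smul_sub, sub_eq_zero] at this
    rw [this]
  · exact ⟨fun h' => absurd (smul_eq_zero_of_dvd hr h') hx,
      fun h' => absurd (smul_eq_zero_of_dvd hr h') hy⟩

theorem USer.eq_smul {M : Type v} [AddCommGroup M] [Module R M] {U : Submodule R M}
    (hU : USer U) {x y : M} (hx : x ∈ U) (hy : y ∈ U) {a : R} (hax : a • x = 0) (hay : a • y ≠ 0) :
    ∃ c : R, x = c • y := by
  rcases hU x hx y hy with h | ⟨c, rfl⟩
  · exact h
  · rw [smul_comm, hax, smul_zero] at hay
    exact absurd rfl hay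

theorem exists_dvd_mul_of_mem_shp {B : Ideal R} (hB : ∃ b ∈ B, b ≠ 0) {r : R} (hr : r ∈ shp B) :
    ∃ z ∈ B, ∀ s ∈ B, z ∣ r * s := by
  by_contra! hcon
  have key : ∀ z ∈ B, ∃ s ∈ B, z = r * s := by
    intro z hz
    obtain ⟨s, hs, hzs⟩ := hcon z hz
    obtain ⟨c, rfl⟩ := (dvd_or z (r * s)).resolve_left hzs
    exact ⟨s * c, B.mul_mem_right c hs, by ring⟩
  obtain ⟨y, hy, hry⟩ := hr
  obtain ⟨b, hb, hyb⟩ := key _ hry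
  have hyb' : y - b ∉ B := fun h => hy (by simpa using B.add_mem h hb)
  have hz : ∀ s ∈ B, r * s = 0 := by
    intro s hs
    rcases dvd_or (y - b) s with ⟨k, rfl⟩ | ⟨k, hk⟩
    · rw [← mul_assoc, mul_sub, hyb, sub_self, zero_mul]
    · exact absurd (hk ▸ B.mul_mem_right k hs) hyb'
  obtain ⟨b0, hb0, hne⟩ := hB
  obtain ⟨s, hs, rfl⟩ := key b0 hb0
  exact hne (hz s hs)

theorem smul_eq_zero_of_sum_eq_zero {M : Type v} [AddCommGroup M] [Module R M] (m : ℕ → M)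
    (r : ℕ → R) (h1 : ∀ i, r i ∈ shp (col ⊥ (m i))) (h2 : ∀ i j, i < j → r j ∉ shp (col ⊥ (m i)))
    (k : ℕ) : ∀ a : ℕ → R, ∑ i ∈ Finset.range k, a i • m i = 0 → ∀ i < k, a i • m i = 0 := by
  induction k with
  | zero => intro a _ i hi; omega
  | succ k ih =>
    intro a ha
    have hk : a k • m k = 0 := by
      by_contra hne
      have h := h1 k
      rw [← shp_col_smul (r := a k) (by simpa using hne)] at h
      obtain ⟨y, hy, hry⟩ := h
      simp only [mem_col, Submodule.mem_bot] at hy hry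
      have h3 := ih (fun i => r k * y * a i) (by
        have := congrArg (fun x => (r k * y) • x) ha
        simp only [Finset.sum_range_succ, smul_add, smul_zero, Finset.smul_sum, hry, add_zero] at this
        simpa only [mul_smul] using this)
      have h4 : ∀ i ∈ Finset.range k, (y * a i) • m i = 0 := by
        intro i hi
        have := notMem_shp.1 (h2 i k (Finset.mem_range.1 hi)) (y * a i) (by
          have := h3 i (Finset.mem_range.1 hi)
          simpa [mul_assoc] using this)
        simpa using this
      apply hy
      have := congrArg (fun x => y • x) ha
      simp only [Finset.sum_range_succ, smul_add, smul_zero, Finset.smul_sum] at this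
      rw [Finset.sum_eq_zero (fun i hi => by rw [← mul_smul]; exact h4 i hi), zero_add] at this
      exact this
    intro i hi
    rcases Nat.lt_succ_iff_lt_or_eq.1 hi with hi | rfl
    · refine ih a ?_ i hi
      rwa [Finset.sum_range_succ, hk, add_zero] at ha
    · exact hk

theorem exists_mem_forall_notMem_shp {M : Type v} [AddCommGroup M] [Module R M] {n : ℕ}
    (hM : RelRankLE R M n) {L : Set R} (hL : L.Nonempty) :
    ∃ r ∈ L, ∀ m : M, m ≠ 0 → shp (col ⊥ m) ⊆ L → L ⊆ shp (col ⊥ m) ∨ r ∉ shp (col ⊥ m) := by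
  by_contra! hcon
  choose! m hm0 hmL hLm hrm using hcon
  have hnext : ∀ r ∈ L, ∃ r' ∈ L, r' ∉ shp (col (⊥ : Submodule R M) (m r)) := fun r hr =>
    Set.not_subset.1 (hLm r hr)
  choose! f hfL hf using hnext
  obtain ⟨r0, hr0⟩ := hL
  have hL' : ∀ i, f^[i] r0 ∈ L := by
    intro i
    induction i with
    | zero => exact hr0
    | succ i ih => rw [Function.iterate_succ_apply']; exact hfL _ ih
  have hmono : Monotone (fun i => shp (col (⊥ : Submodule R M) (m (f^[i] r0)))) := by
    refine monotone_nat_of_le_succ fun i l hl => ?_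
    have h1 := hf _ (hL' i)
    have h2 := hrm _ (hL' (i + 1))
    rw [Function.iterate_succ_apply'] at h2
    show l ∈ shp (col (⊥ : Submodule R M) (m (f^[i+1] r0)))
    rw [Function.iterate_succ_apply']
    rcases dvd_or l (f (f^[i] r0)) with ⟨c, hc⟩ | ⟨c, rfl⟩
    · exact absurd (hc ▸ shp_mul_right hl c) h1
    · exact shp_mul_right h2 c
  have h2 : ∀ i j, i < j → f^[j] r0 ∉ shp (col (⊥ : Submodule R M) (m (f^[i] r0))) := by
    intro i j hij h
    obtain ⟨j, rfl⟩ : ∃ j', j = j' + 1 := ⟨j - 1, by omega⟩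
    have := hmono (Nat.lt_succ_iff.1 hij) h
    rw [Function.iterate_succ_apply'] at this
    exact hf _ (hL' j) this
  obtain ⟨a, ha, i, hi, hu⟩ := hM (fun i => m (f^[i] r0))
  have := smul_eq_zero_of_sum_eq_zero (fun i => m (f^[i] r0)) (fun i => f^[i] r0)
    (fun i => hrm _ (hL' i)) h2 (n + 1) a ha i (by omega)
  rw [hu.smul_eq_zero] at this
  exact hm0 _ (hL' i) this

end Approx

section Good

variable {R : Type u} [CommRing R] [PreValuationRing R]
variable {E : Type u} [AddCommGroup E] [Module R E] {U : Submodule R E}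

theorem Good.uniform (h : Good U) {x y : E} (hx : x ≠ 0) (hy : y ≠ 0) :
    ∃ c d : R, c • x = d • y ∧ c • x ≠ 0 := by
  obtain ⟨c, hc, hcx⟩ := h.ess x hx
  obtain ⟨d, hd, hdy⟩ := h.ess y hy
  rcases h.ser _ hc _ hd with ⟨k, hk⟩ | ⟨k, hk⟩
  · exact ⟨c, k * d, by rw [hk, mul_smul], hcx⟩
  · exact ⟨k * c, d, by rw [hk, mul_smul], by rwa [mul_smul, ← hk]⟩

theorem Good.exists_approx (h : Good U) {x : E} (hx : x ≠ 0) :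
    ∃ u ∈ U, ∃ a : R, a • (x - u) = 0 ∧ a • x ≠ 0 := by
  obtain ⟨c, hc, hcx⟩ := h.ess x hx
  obtain ⟨v, hv, hv'⟩ := h.pure.approx hc
  exact ⟨v, hv, c, hv', hcx⟩

theorem Good.exists_ann_eq (h : Good U) {x : E} (hx : x ≠ 0) :
    ∃ u ∈ U, ∀ r : R, r • u = 0 ↔ r • x = 0 := by
  obtain ⟨u, hu, a, h1, h2⟩ := h.exists_approx hx
  exact ⟨u, hu, fun r => (smul_eq_zero_iff_of_approx h1 h2 r).symm⟩

/-- Solvability of `r • w = e` modulo a pure submodule of an injective module. -/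
theorem exists_sub_smul_mem (hE : Module.Injective R E) (hU : RDPure U) {e : E} {r : R}
    {c : R} (hc : c * r ≠ 0) (hce : c • e ∈ U) : ∃ w, e - r • w ∈ U := by
  obtain ⟨v, hv, hcv⟩ := hU.approx hce
  obtain ⟨w, hw⟩ := exists_smul_eq hE r (e - v) (by
    intro t ht
    rcases dvd_or c t with h | ⟨d, rfl⟩
    · exact smul_eq_zero_of_dvd h hcv
    · exact absurd (by rw [mul_right_comm, ht, zero_mul]) hc)
  exact ⟨w, by rw [hw]; simpa using hv⟩

/-- Simultaneous approximation of finitely many elements by elements of `U`. -/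
theorem Good.exists_common_approx (h : Good U) {b : R} {u : E} (hu : u ∈ U) (hu0 : u ≠ 0)
    (hbu : b • u = 0) (c : ℕ → E) (k : ℕ) (hc : ∀ i < k, b • c i = 0) :
    ∃ a : R, ∃ u0 ∈ U, a • u0 ≠ 0 ∧ b • u0 = 0 ∧ ∀ i < k, ∃ v ∈ U, a • (c i - v) = 0 := by
  induction k with
  | zero => exact ⟨1, u, hu, by simpa using hu0, hbu, fun i hi => by omega⟩
  | succ k ih =>
    obtain ⟨a, u0, hu0, hau0, hbu0, hv⟩ := ih (fun i hi => hc i (by omega))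
    have step : ∀ s : R, (∃ v ∈ U, (s * a) • (c k - v) = 0) →
        ∀ i < k + 1, ∃ v ∈ U, (s * a) • (c i - v) = 0 := by
      rintro s hs i hi
      rcases Nat.lt_succ_iff_lt_or_eq.1 hi with hi | rfl
      · obtain ⟨v, hvU, hv⟩ := hv i hi
        exact ⟨v, hvU, by rw [mul_smul, hv, smul_zero]⟩
      · exact hs
    by_cases hz : a • c k = 0
    · refine ⟨a, u0, hu0, hau0, hbu0, ?_⟩
      simpa using step 1 ⟨0, U.zero_mem, by simpa using hz⟩
    · obtain ⟨s, t, hst, hs0⟩ := h.uniform hz hau0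
      have hmem : (s * a) • c k ∈ U := by
        rw [mul_smul, hst]; exact U.smul_mem _ (U.smul_mem _ hu0)
      obtain ⟨v, hvU, hv'⟩ := h.pure.approx hmem
      by_cases hsu : (s * a) • u0 = 0
      · rw [← mul_smul] at hs0
        have hann := smul_eq_zero_iff_of_approx hv' hs0
        refine ⟨s * a, v, hvU, fun h0 => hs0 ((hann _).2 h0), ?_, step s ⟨v, hvU, hv'⟩⟩
        exact (hann _).1 (hc k (by omega))
      · exact ⟨s * a, u0, hu0, hsu, hbu0, step s ⟨v, hvU, hv'⟩⟩

end Good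

end ChainRing

namespace ChainRing

section Families

variable {R : Type u} [CommRing R]
variable {α : Type u} [LinearOrder α]

/-- `I` is generated by a family indexed by the initial segment below `i`. -/
def Fam (i : α) (I : Ideal R) : Prop :=
  ∃ z : α → R, (∀ j < i, z j ∈ I) ∧ ∀ x ∈ I, ∃ j < i, z j ∣ x

/-- `I` has no largest principal subideal, even after localizing at the complement of `L`. -/
def Lim (L : Set R) (I : Ideal R) : Prop := ∀ s ∈ I, ∃ s' ∈ I, ∀ t ∉ L, ¬ s ∣ t * s'

structure GoodI (L : Set R) (i : α) (I : Ideal R) : Prop where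
  shp_eq : shp I = L
  fam : Fam i I
  lim : Lim L I

/-- `e` has no special approximation in `U`. -/
def Nonsp {M : Type v} [AddCommGroup M] [Module R M] (U : Submodule R M) (e : M) : Prop :=
  ∀ u ∈ U, ∃ b ∈ col U e, ∀ t ∉ shp (col U e), (t * b) • (e - u) ≠ 0

/-- Existence of an element of type `(L, i)` without special approximation in `U`. -/
def NSE {M : Type v} [AddCommGroup M] [Module R M] (U : Submodule R M) (L : Set R) (i : α) : Prop :=
  ∃ e : M, shp (col U e) = L ∧ Nonsp U e ∧ Fam i (col U e)

/-- Some standing situation contains a nonspecial element of type `(L, i)`. -/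
def NS (L : Set R) (i : α) : Prop :=
  ∃ (E : Type u) (_ : AddCommGroup E) (_ : Module R E) (U : Submodule R E), Good U ∧ NSE U L i

/-- Every proper ideal is an annihilator of an element of the uniserial part of a standing
situation. -/
def HX (R : Type u) [CommRing R] : Prop :=
  ∀ I : Ideal R, I ≠ ⊤ → ∃ (E : Type u) (_ : AddCommGroup E) (_ : Module R E)
    (U : Submodule R E), Good U ∧ ∃ d ∈ U, ∀ x : R, x • d = 0 ↔ x ∈ I

theorem Nonsp.notMem {M : Type v} [AddCommGroup M] [Module R M] {U : Submodule R M} {e : M}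
    (h : Nonsp U e) : e ∉ U := by
  intro he
  obtain ⟨b, -, hb⟩ := h e he
  exact hb 1 one_notMem_shp (by simp)

theorem Nonsp.lim {M : Type v} [AddCommGroup M] [Module R M] {U : Submodule R M} {e : M}
    (h : Nonsp U e) (hU : RDPure U) : Lim (shp (col U e)) (col U e) := by
  intro s hs
  obtain ⟨u, hu, hsu⟩ := hU.approx (mem_col.1 hs)
  obtain ⟨b, hb, hbt⟩ := h u hu
  exact ⟨b, hb, fun t ht hd => hbt t ht (smul_eq_zero_of_dvd hd hsu)⟩

theorem Lim.exists_forall_ne_zero {L : Set R} {I : Ideal R} (h : Lim L I) :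
    ∃ b ∈ I, ∀ t ∉ L, t * b ≠ 0 := by
  obtain ⟨b, hb, hb'⟩ := h 0 I.zero_mem
  exact ⟨b, hb, fun t ht h0 => hb' t ht (by rw [h0])⟩

theorem GoodI.one_notMem {L : Set R} {i : α} {I : Ideal R} (h : GoodI L i I) : (1 : R) ∉ L := by
  rw [← h.shp_eq]; exact one_notMem_shp

theorem GoodI.exists_ne_zero {L : Set R} {i : α} {I : Ideal R} (h : GoodI L i I) :
    ∃ b ∈ I, b ≠ 0 := by
  obtain ⟨b, hb, hb'⟩ := h.lim.exists_forall_ne_zero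
  exact ⟨b, hb, by simpa using hb' 1 h.one_notMem⟩

variable [PreValuationRing R]

theorem dvd_of_mem_notMem {I : Ideal R} {r x : R} (hr : r ∉ I) (hx : x ∈ I) : r ∣ x := by
  rcases dvd_or r x with h | ⟨c, rfl⟩
  · exact h
  · exact absurd (I.mul_mem_right c hx) hr

theorem dvd_or_mul_eq_zero [IsLocalRing R] {r x y k : R} (h : r * x = r * (y * k)) :
    y ∣ x ∨ r * x = 0 := by
  rcases dvd_or y x with hd | ⟨c, rfl⟩
  · exact Or.inl hd
  · rcases IsLocalRing.isUnit_or_isUnit_one_sub_self (c * k) with hu | hu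
    · left
      have hc : IsUnit c := isUnit_of_mul_isUnit_left hu
      exact (hc.dvd_mul_right.1 dvd_rfl)
    · right
      have : r * x * (1 - c * k) = 0 := by linear_combination h
      exact (hu.mul_left_eq_zero).1 this

theorem GoodI.of_col [IsLocalRing R] {L : Set R} {i : α} {I : Ideal R} {r : R} (hr : r ∉ I)
    (h : GoodI L i (col I r)) (hI : ∃ b ∈ I, b ≠ 0) : GoodI L i I := by
  refine ⟨by rw [← h.shp_eq, shp_col hr], ?_, ?_⟩
  · obtain ⟨z, hz, hc⟩ := h.fam
    refine ⟨fun j => z j * r, fun j hj => hz j hj, fun x hx => ?_⟩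
    obtain ⟨w, rfl⟩ := dvd_of_mem_notMem hr hx
    obtain ⟨j, hj, hd⟩ := hc w (by simpa [mul_comm] using hx)
    exact ⟨j, hj, by rw [mul_comm r]; exact mul_dvd_mul_right hd r⟩
  · intro s hs
    obtain ⟨b, hb, hb0⟩ := hI
    obtain ⟨w, rfl⟩ := dvd_of_mem_notMem hr hs
    obtain ⟨b1, rfl⟩ := dvd_of_mem_notMem hr hb
    have hw : w ∈ col I r := by simpa [mul_comm] using hs
    have hb1 : b1 ∈ col I r := by simpa [mul_comm] using hb
    obtain ⟨s1, hs1, hs1w, hs1b⟩ : ∃ s1 ∈ col I r, s1 ∣ w ∧ s1 ∣ b1 := by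
      rcases dvd_or w b1 with hd | hd
      · exact ⟨w, hw, dvd_rfl, hd⟩
      · exact ⟨b1, hb1, hd, dvd_rfl⟩
    obtain ⟨s', hs', hs't⟩ := h.lim s1 hs1
    refine ⟨r * s', by simpa [mul_comm] using hs', fun t ht hd => ?_⟩
    obtain ⟨k, hk⟩ := (mul_dvd_mul_left r hs1w).trans hd
    rcases dvd_or_mul_eq_zero (r := r) (x := t * s') (y := s1) (k := k)
      (by rw [← mul_assoc r s1 k, ← hk]; ring) with h1 | h1
    · exact hs't t ht h1
    · apply hb0
      have h2 := (dvd_or s1 (t * s')).resolve_left (hs't t ht)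
      obtain ⟨c, hc⟩ := h2.trans hs1b
      rw [hc, ← mul_assoc, h1, zero_mul]

theorem GoodI.colon [IsLocalRing R] {L : Set R} {i : α} {I : Ideal R} {r : R} (hr : r ∉ I)
    (h : GoodI L i I) : GoodI L i (col I r) := by
  refine ⟨by rw [shp_col hr, h.shp_eq], ?_, ?_⟩
  · obtain ⟨z, hz, hc⟩ := h.fam
    have : ∀ j, ∃ y, j < i → z j = r * y := by
      intro j
      by_cases hj : j < i
      · obtain ⟨y, hy⟩ := dvd_of_mem_notMem hr (hz j hj)
        exact ⟨y, fun _ => hy⟩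
      · exact ⟨0, fun h => absurd h hj⟩
    choose y hy using this
    refine ⟨y, fun j hj => ?_, fun x hx => ?_⟩
    · rw [mem_col, smul_eq_mul, mul_comm, ← hy j hj]; exact hz j hj
    · have hx' : r * x ∈ I := by simpa [mul_comm] using hx
      obtain ⟨j, hj, k, hk⟩ := hc _ hx'
      rcases dvd_or_mul_eq_zero (r := r) (x := x) (y := y j) (k := k)
        (by rw [hk, hy j hj]; ring) with h1 | h1
      · exact ⟨j, hj, h1⟩
      · obtain ⟨b, hb, hb0⟩ := h.exists_ne_zero
        obtain ⟨j0, hj0, k0, rfl⟩ := hc b hb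
        refine ⟨j0, hj0, ?_⟩
        rcases dvd_or (y j0) x with hd | ⟨c, hc⟩
        · exact hd
        · apply absurd _ hb0
          rw [hy j0 hj0, hc, ← mul_assoc r x, h1, zero_mul, zero_mul]
  · intro s hs
    obtain ⟨s', hs', hst⟩ := h.lim (s * r) hs
    obtain ⟨w, rfl⟩ := dvd_of_mem_notMem hr hs'
    refine ⟨w, by simpa [mul_comm] using hs', fun t ht hd => hst t ht ?_⟩
    rw [show t * (r * w) = t * w * r by ring]
    exact mul_dvd_mul_right hd r

theorem exists_prep {N : Type v} [AddCommGroup N] [Module R N] {W : Submodule R N} (hW : USer W)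
    {e : N} {B : Ideal R} {L : Set R} (hL : (1 : R) ∉ L) (h1 : ∀ b ∈ B, ∃ w ∈ W, b • (e - w) = 0)
    (h2 : ∀ w ∈ W, ∃ b ∈ B, ∀ t ∉ L, (t * b) • (e - w) ≠ 0) {a : R} (ha : a ∈ B) :
    ∃ w ∈ W, ∃ u ∈ W, a • u = 0 ∧ (∀ b ∈ B, ∃ r : R, b • (e - w - r • u) = 0) ∧
      ∀ g : R, ∃ b ∈ B, ∀ t ∉ L, (t * b) • (e - w - g • u) ≠ 0 := by
  obtain ⟨w2, hw2, haw2⟩ := h1 a ha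
  obtain ⟨a2, ha2, ht⟩ := h2 w2 hw2
  have hne : a2 • (e - w2) ≠ 0 := by simpa using ht 1 hL
  have hd : a2 ∣ a := (dvd_or a a2).resolve_left fun h => hne (smul_eq_zero_of_dvd h haw2)
  obtain ⟨w3, hw3, haw3⟩ := h1 a2 ha2
  have hu : w3 - w2 = (e - w2) - (e - w3) := by abel
  refine ⟨w3, hw3, w3 - w2, W.sub_mem hw3 hw2, ?_, ?_, ?_⟩
  · rw [hu, smul_sub, haw2, smul_eq_zero_of_dvd hd haw3, sub_zero]
  · intro b hb
    rcases dvd_or a2 b with hab | hab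
    · exact ⟨0, by simpa using smul_eq_zero_of_dvd hab haw3⟩
    · obtain ⟨w, hw, hbw⟩ := h1 b hb
      obtain ⟨r, hr⟩ := hW.eq_smul (x := w - w3) (y := w3 - w2) (a := a2) (W.sub_mem hw hw3)
        (W.sub_mem hw3 hw2)
        (by rw [show w - w3 = (e - w3) - (e - w) by abel, smul_sub, haw3,
              smul_eq_zero_of_dvd hab hbw, sub_zero])
        (by rw [hu, smul_sub, haw3, sub_zero]; exact hne)
      exact ⟨r, by rw [← hr]; simpa using hbw⟩
  · intro g
    obtain ⟨b, hb, hbt⟩ := h2 (w3 + g • (w3 - w2))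
      (W.add_mem hw3 (W.smul_mem _ (W.sub_mem hw3 hw2)))
    exact ⟨b, hb, by simpa only [sub_sub] using hbt⟩

end Families

end ChainRing

namespace ChainRing

section Transfer

variable {R : Type u} [CommRing R] [PreValuationRing R] [IsLocalRing R]
variable {N : Type v} [AddCommGroup N] [Module R N]

/-- `z` carries every scalar killing `b • u` into `B0`. -/
def Wit (B0 : Ideal R) (u : N) (b z : R) : Prop := ∀ x : R, (x * b) • u = 0 → z * x ∈ B0

theorem Wit.of_dvd {B0 : Ideal R} {u : N} {b b' z : R} (h : Wit B0 u b' z) (hd : b ∣ b') :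
    Wit B0 u b z := fun x hx => h x (smul_eq_zero_of_dvd (mul_dvd_mul_left x hd) hx)

theorem exists_dvd_both (B : Ideal R) {b b' : R} (hb : b ∈ B) (hb' : b' ∈ B) :
    ∃ c ∈ B, c ∣ b ∧ c ∣ b' := by
  rcases dvd_or b b' with h | h
  · exact ⟨b, hb, dvd_rfl, h⟩
  · exact ⟨b', hb', h, dvd_rfl⟩

/-- The ideal of all witnessed scalars. -/
def witIdeal (B0 : Ideal R) (u : N) (B : Ideal R) : Ideal R where
  carrier := {z | ∃ b ∈ B, Wit B0 u b z}
  zero_mem' := ⟨0, B.zero_mem, fun x _ => by simp⟩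
  add_mem' := by
    rintro z z' ⟨b, hb, h⟩ ⟨b', hb', h'⟩
    obtain ⟨c, hc, hcb, hcb'⟩ := exists_dvd_both B hb hb'
    refine ⟨c, hc, fun x hx => ?_⟩
    rw [add_mul]
    exact B0.add_mem (h.of_dvd hcb x hx) (h'.of_dvd hcb' x hx)
  smul_mem' := by
    rintro c z ⟨b, hb, h⟩
    refine ⟨b, hb, fun x hx => ?_⟩
    rw [smul_eq_mul, mul_assoc]
    exact B0.mul_mem_left c (h x hx)

variable {e u : N} {B B0 : Ideal R}

theorem wit_indep {b b' r r' z : R} (hz : Wit B0 u b z) (hz' : Wit B0 u b' z)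
    (hr : b • (e - r • u) = 0) (hr' : b' • (e - r' • u) = 0) : z * (r - r') ∈ B0 := by
  have key : ∀ c : R, c • (e - r • u) = 0 → c • (e - r' • u) = 0 → ((r - r') * c) • u = 0 := by
    intro c h1 h2
    have : ((r - r') * c) • u = c • (e - r' • u) - c • (e - r • u) := by
      simp only [smul_sub, sub_mul, sub_smul, ← mul_smul, mul_comm c]; abel
    rw [this, h1, h2, sub_zero]
  rcases dvd_or b b' with hd | hd
  · exact hz' _ (key _ (smul_eq_zero_of_dvd hd hr) hr')
  · exact hz _ (key _ hr (smul_eq_zero_of_dvd hd hr'))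

theorem exists_wit_map {E : Type u} [AddCommGroup E] [Module R E] (hE : Module.Injective R E)
    (h1 : ∀ b ∈ B, ∃ r : R, b • (e - r • u) = 0) {d : E} (hd : ∀ x ∈ B0, x • d = 0) :
    ∃ e2 : E, ∀ z : R, ∀ b ∈ B, ∀ r : R, Wit B0 u b z → b • (e - r • u) = 0 →
      z • e2 = (z * r) • d := by
  have hval : ∀ z : R, ∃ w : E, ∀ b ∈ B, ∀ r : R, Wit B0 u b z → b • (e - r • u) = 0 →
      w = (z * r) • d := by
    intro z
    by_cases hz : z ∈ witIdeal B0 u B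
    · obtain ⟨b, hb, hw⟩ := hz
      obtain ⟨r, hr⟩ := h1 b hb
      refine ⟨(z * r) • d, fun b' _ r' hw' hr' => ?_⟩
      rw [← sub_eq_zero, ← sub_smul, ← mul_sub]
      exact hd _ (wit_indep hw hw' hr hr')
    · exact ⟨0, fun b hb r hw _ => absurd ⟨b, hb, hw⟩ hz⟩
  choose f hf using hval
  obtain ⟨e2, he2⟩ := exists_eq_smul hE (witIdeal B0 u B)
    { toFun := fun z => f z
      map_add' := by
        rintro ⟨z, b, hb, hz⟩ ⟨z', b', hb', hz'⟩
        obtain ⟨c, hc, hcb, hcb'⟩ := exists_dvd_both B hb hb'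
        obtain ⟨r, hr⟩ := h1 c hc
        have h3 : Wit B0 u c (z + z') := fun x hx => by
          rw [add_mul]
          exact B0.add_mem (hz.of_dvd hcb x hx) (hz'.of_dvd hcb' x hx)
        show f (z + z') = f z + f z'
        rw [hf _ c hc r h3 hr, hf _ c hc r (hz.of_dvd hcb) hr, hf _ c hc r (hz'.of_dvd hcb') hr,
          add_mul, add_smul]
      map_smul' := by
        rintro k ⟨z, b, hb, hz⟩
        obtain ⟨r, hr⟩ := h1 b hb
        have h3 : Wit B0 u b (k * z) := fun x hx => by
          rw [mul_assoc]; exact B0.mul_mem_left _ (hz x hx)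
        show f (k * z) = k • f z
        rw [hf _ b hb r h3 hr, hf _ b hb r hz hr, mul_assoc, mul_smul] }
  refine ⟨e2, fun z b hb r hw hr => ?_⟩
  rw [← he2 ⟨z, b, hb, hw⟩]
  exact hf z b hb r hw hr

theorem exists_mul_notMem_of_mem_shp {p q : R} (hq : q ∉ B0) (hp : p ∈ shp B0) :
    ∃ z : R, z * q ∉ B0 ∧ z * (p * q) ∈ B0 := by
  obtain ⟨y, hy, hpy⟩ := hp
  rcases dvd_or q y with ⟨c, rfl⟩ | ⟨c, rfl⟩
  · exact ⟨c, by rwa [mul_comm], by rwa [show c * (p * q) = p * (q * c) by ring]⟩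
  · exact ⟨1, by rwa [one_mul], by
      rw [one_mul, ← mul_assoc]; exact B0.mul_mem_right c hpy⟩

variable {L : Set R}

theorem exists_next_approx (hL : (1 : R) ∉ L) (h1 : ∀ b ∈ B, ∃ r : R, b • (e - r • u) = 0)
    (h2 : ∀ g : R, ∃ b ∈ B, ∀ t ∉ L, (t * b) • (e - g • u) ≠ 0)
    {b1 r1 q : R} (hr1 : b1 • (e - r1 • u) = 0) (hq : ∀ t ∉ L, (t * (b1 * q)) • u ≠ 0) :
    ∃ p ∈ L, ∃ b3 ∈ B, ∃ r3 : R, b3 • (e - r3 • u) = 0 ∧ r1 - r3 = p * q ∧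
      ∀ x : R, (x * b3) • u = 0 → p * q ∣ x := by
  obtain ⟨b3, hb3, ht⟩ := h2 r1
  obtain ⟨r3, hr3⟩ := h1 b3 hb3
  have hb3r1 : b3 • (e - r1 • u) ≠ 0 := by simpa using ht 1 hL
  have hd : b3 ∣ b1 := (dvd_or b1 b3).resolve_left fun h => hb3r1 (smul_eq_zero_of_dvd h hr1)
  have key : ∀ c : R, c • (e - r3 • u) = 0 → ((r1 - r3) * c) • u = - (c • (e - r1 • u)) := by
    intro c hc
    have : ((r1 - r3) * c) • u = c • (e - r3 • u) - c • (e - r1 • u) := by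
      simp only [smul_sub, sub_mul, sub_smul, ← mul_smul, mul_comm c]; abel
    rw [this, hc, zero_sub]
  have h3 : ((r1 - r3) * b1) • u = 0 := by
    rw [key _ (smul_eq_zero_of_dvd hd hr3), hr1, neg_zero]
  have hqd : q ∣ r1 - r3 := by
    refine (dvd_or q (r1 - r3)).resolve_right fun h => hq 1 hL ?_
    rw [one_mul, mul_comm]
    exact smul_eq_zero_of_dvd (mul_dvd_mul_right h b1) h3
  obtain ⟨p, hp⟩ := hqd
  rw [mul_comm] at hp
  refine ⟨p, ?_, b3, hb3, r3, hr3, hp, fun x hx => ?_⟩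
  · by_contra hpL
    apply hq p hpL
    rw [show p * (b1 * q) = (p * q) * b1 by ring, ← hp, h3]
  · rw [← hp]
    refine (dvd_or (r1 - r3) x).resolve_right fun h => hb3r1 ?_
    have := smul_eq_zero_of_dvd (mul_dvd_mul_right h b3) hx
    rwa [key _ hr3, neg_eq_zero] at this

theorem nse_of_transfer {α : Type u} [LinearOrder α] {i : α} (hBL : shp B = L)
    (h1 : ∀ b ∈ B, ∃ r : R, b • (e - r • u) = 0)
    (h2 : ∀ g : R, ∃ b ∈ B, ∀ t ∉ L, (t * b) • (e - g • u) ≠ 0)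
    (hB0L : shp B0 = L) (hB0u : ∀ x ∈ B0, x • u = 0) (hfam : Fam i B)
    {E : Type u} [AddCommGroup E] [Module R E] {U : Submodule R E} (hU : Good U) {d : E}
    (hdU : d ∈ U) (hd : ∀ x : R, x • d = 0 ↔ x ∈ B0) : NSE U L i := by
  have hL : (1 : R) ∉ L := hBL ▸ one_notMem_shp
  obtain ⟨e2, he2⟩ := exists_wit_map hU.inj h1 (fun x hx => (hd x).2 hx)
  set B' := witIdeal B0 u B with hB'
  have hKC : ∀ g : R, ∃ z, ∃ b ∈ B, ∃ r, Wit B0 u b z ∧ b • (e - r • u) = 0 ∧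
      z * (g - r) ∉ B0 := by
    intro g
    obtain ⟨b1, hb1, ht⟩ := h2 g
    obtain ⟨r1, hr1⟩ := h1 b1 hb1
    have hq : ∀ t ∉ L, (t * (b1 * (g - r1))) • u ≠ 0 := by
      intro t htL h0
      apply ht t htL
      have : (t * b1) • (e - g • u) = t • b1 • (e - r1 • u) - (t * (b1 * (g - r1))) • u := by
        simp only [smul_sub, mul_sub, sub_smul, ← mul_smul, mul_assoc]; abel
      rw [this, hr1, h0, smul_zero, sub_zero]
    obtain ⟨p, hp, b3, hb3, r3, hr3, hpq, hx⟩ := exists_next_approx hL h1 h2 hr1 hq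
    have hqB : g - r1 ∉ B0 := by
      intro h
      apply hq 1 hL
      rw [one_mul, mul_smul, hB0u _ h, smul_zero]
    obtain ⟨z, hz, hzp⟩ := exists_mul_notMem_of_mem_shp hqB (hB0L.symm ▸ hp)
    refine ⟨z, b3, hb3, r3, fun x hx' => ?_, hr3, fun hmem => hz ?_⟩
    · obtain ⟨k, rfl⟩ := hx x hx'
      rw [← mul_assoc]
      exact B0.mul_mem_right k hzp
    · have h4 : z * (g - r3) = z * (g - r1) + z * (p * (g - r1)) := by rw [← hpq]; ring
      rw [h4] at hmem
      exact (B0.add_mem_iff_left hzp).1 hmem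
  have hB0t : ∀ t ∉ L, ∀ x, t * x ∈ B0 → x ∈ B0 := fun t ht => notMem_shp.1 (hB0L.symm ▸ ht)
  have hcase : ∀ g : R, ¬ ∀ z ∈ B', ∃ t ∉ L, (t * z) • (e2 - g • d) = 0 := by
    intro g hall
    obtain ⟨z, b, hb, r, hw, hr, hz⟩ := hKC g
    obtain ⟨t, ht, h0⟩ := hall z ⟨b, hb, hw⟩
    apply hz
    apply hB0t t ht
    rw [← hd]
    have : (t * (z * (g - r))) • d = - ((t * z) • (e2 - g • d)) := by
      rw [smul_sub, mul_smul t z e2, he2 z b hb r hw hr]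
      simp only [mul_sub, sub_smul, mul_smul]; abel
    rw [this, h0, neg_zero]
  have hstar : ∀ v ∈ U, ¬ ∀ z ∈ B', ∃ t ∉ L, (t * z) • (e2 - v) = 0 := by
    intro v hv hall
    rcases hU.ser v hv d hdU with ⟨g, rfl⟩ | ⟨g, hg⟩
    · exact hcase g hall
    · by_cases hgu : IsUnit g
      · obtain ⟨w, rfl⟩ := hgu
        apply hcase (↑w⁻¹ : R)
        have : (↑w⁻¹ : R) • d = v := by rw [hg, ← mul_smul]; simp
        rwa [this]
      · obtain ⟨z, b, hb, r, hw, hr, hz⟩ := hKC 0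
        obtain ⟨t, ht, h0⟩ := hall z ⟨b, hb, hw⟩
        have hu : IsUnit (1 - r * g) :=
          (IsLocalRing.isUnit_or_isUnit_one_sub_self (r * g)).resolve_left
            fun h => hgu (isUnit_of_mul_isUnit_right h)
        have h3 : (1 - r * g) • (t * z) • v = 0 := by
          have : (1 - r * g) • (t * z) • v = - ((t * z) • (e2 - v)) := by
            rw [smul_sub, mul_smul t z e2, he2 z b hb r hw hr]
            rw [hg]
            module
          rw [this, h0, neg_zero]
        rw [hu.smul_eq_zero] at h3
        have h4 : z ∈ B0 := by
          apply hB0t t ht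
          rw [← hd, hg, smul_comm, h3, smul_zero]
        exact hz (B0.mul_mem_right _ h4)
  have hcol : col U e2 = B' := by
    ext z
    rw [mem_col]
    constructor
    · intro hz
      by_contra hzB
      obtain ⟨v, hv, hzv⟩ := hU.pure.approx hz
      apply hstar v hv
      intro z' hz'
      refine ⟨1, hL, ?_⟩
      rw [one_mul]
      exact smul_eq_zero_of_dvd (dvd_of_mem_notMem hzB hz') hzv
    · rintro ⟨b, hb, hw⟩
      obtain ⟨r, hr⟩ := h1 b hb
      rw [he2 z b hb r hw hr]
      exact U.smul_mem _ hdU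
  have h1B' : (1 : R) ∉ B' := by
    rw [← hcol, mem_col, one_smul]
    intro h
    exact hstar e2 h fun z _ => ⟨1, hL, by simp⟩
  have hQ : ∀ b1 ∈ B, ∃ x, (x * b1) • u = 0 ∧ x ∉ B0 ∧ ∃ p ∈ L, ∃ b3 ∈ B,
      ∀ x', (x' * b3) • u = 0 → p * x ∣ x' := by
    intro b1 hb1
    obtain ⟨r1, hr1⟩ := h1 b1 hb1
    obtain ⟨b2, hb2, ht⟩ := h2 r1
    obtain ⟨r2, hr2⟩ := h1 b2 hb2
    have hd : b2 ∣ b1 := (dvd_or b1 b2).resolve_left fun h =>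
      ht 1 hL (by rw [one_mul]; exact smul_eq_zero_of_dvd h hr1)
    have hq : ∀ t ∉ L, (t * (b2 * (r1 - r2))) • u ≠ 0 := by
      intro t htL h0
      apply ht t htL
      have : (t * b2) • (e - r1 • u) = t • b2 • (e - r2 • u) - (t * (b2 * (r1 - r2))) • u := by
        simp only [smul_sub, mul_sub, sub_smul, ← mul_smul, mul_assoc]; abel
      rw [this, hr2, h0, smul_zero, sub_zero]
    obtain ⟨p, hp, b3, hb3, r3, -, -, hx⟩ := exists_next_approx hL h1 h2 hr2 hq
    refine ⟨r1 - r2, ?_, ?_, p, hp, b3, hb3, hx⟩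
    · have : ((r1 - r2) * b1) • u = b1 • (e - r2 • u) - b1 • (e - r1 • u) := by
        simp only [smul_sub, sub_mul, sub_smul, ← mul_smul, mul_comm b1]; abel
      rw [this, hr1, smul_eq_zero_of_dvd hd hr2, sub_zero]
    · intro h
      apply hq 1 hL
      rw [one_mul, mul_smul, hB0u _ h, smul_zero]
  have hsh : shp B' = L := by
    apply Set.Subset.antisymm
    · intro t ht
      by_contra htL
      obtain ⟨z, hz, b, hb, hw⟩ := ht
      exact hz ⟨b, hb, fun x hx => hB0t t htL _ (by rw [← mul_assoc]; exact hw x hx)⟩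
    · intro r hr
      have hBne : ∃ b ∈ B, b ≠ 0 := by
        obtain ⟨b, hb, ht⟩ := h2 0
        refine ⟨b, hb, ?_⟩
        rintro rfl
        exact ht 1 hL (by simp)
      obtain ⟨b1, hb1, hdiv⟩ := exists_dvd_mul_of_mem_shp hBne (hBL.symm ▸ hr)
      obtain ⟨x, hx0, hxB, p, hp, b3, hb3, hdvd⟩ := hQ b1 hb1
      by_cases hrx : r * x ∈ B0
      · refine mem_shp_of_mem h1B' ⟨b3, hb3, fun x' hx' => ?_⟩
        obtain ⟨k, rfl⟩ := hdvd x' hx'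
        rw [show r * (p * x * k) = p * k * (r * x) by ring]
        exact B0.mul_mem_left _ hrx
      · obtain ⟨z, hz, hzp⟩ := exists_mul_notMem_of_mem_shp hrx (hB0L.symm ▸ hp)
        refine ⟨z, ?_, b3, hb3, fun x' hx' => ?_⟩
        · rintro ⟨b, hb, hw⟩
          apply hz
          rw [mul_comm r x]
          have h5 : (x * r * b) • u = 0 := by
            rw [mul_assoc]
            exact smul_eq_zero_of_dvd (mul_dvd_mul_left x (hdiv b hb)) hx0
          exact hw _ h5
        · obtain ⟨k, rfl⟩ := hdvd x' hx'
          rw [show r * z * (p * x * k) = k * (z * (p * (r * x))) by ring]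
          exact B0.mul_mem_left _ hzp
  refine ⟨e2, by rw [hcol, hsh], fun v hv => ?_, ?_⟩
  · rw [hcol, hsh]
    have := hstar v hv
    push Not at this
    exact this
  · rw [hcol]
    obtain ⟨z, hz, hc⟩ := hfam
    have hex : ∀ j, ∃ z', j < i → z' ∈ B' ∧ ∃ x, (x * z j) • u = 0 ∧ z' * x ∉ B0 := by
      intro j
      by_cases hj : j < i
      · obtain ⟨x, hx0, hxB, p, hp, b3, hb3, hdvd⟩ := hQ (z j) (hz j hj)
        obtain ⟨z', hz', hzp⟩ := exists_mul_notMem_of_mem_shp hxB (hB0L.symm ▸ hp)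
        refine ⟨z', fun _ => ⟨⟨b3, hb3, fun x' hx' => ?_⟩, x, hx0, hz'⟩⟩
        obtain ⟨k, rfl⟩ := hdvd x' hx'
        rw [← mul_assoc]
        exact B0.mul_mem_right k hzp
      · exact ⟨0, fun h => absurd h hj⟩
    choose z' hz' using hex
    refine ⟨z', fun j hj => (hz' j hj).1, ?_⟩
    rintro y ⟨b, hb, hw⟩
    obtain ⟨j, hj, hjb⟩ := hc b hb
    obtain ⟨-, x, hx0, hxB⟩ := hz' j hj
    refine ⟨j, hj, (dvd_or (z' j) y).resolve_right fun hd' => hxB ?_⟩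
    have h5 := hw x (smul_eq_zero_of_dvd (mul_dvd_mul_left x hjb) hx0)
    obtain ⟨k, hk⟩ := hd'
    rw [hk, mul_right_comm]
    exact B0.mul_mem_right k h5

end Transfer

end ChainRing

namespace ChainRing

section Extension

variable {R : Type u} [CommRing R] [PreValuationRing R] [IsLocalRing R]
variable {α : Type u} [LinearOrder α] [WellFoundedLT α]
variable {E : Type u} [AddCommGroup E] [Module R E] {U : Submodule R E}

/-- The nonzero elements of `J` are the nonzero multiples of the `z j`, `j ∈ T`. -/
def GenBy (z : α → R) (T : Set α) (J : Ideal R) : Prop := ∀ x, x ∈ J ↔ x = 0 ∨ ∃ j ∈ T, z j ∣ x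

/-- Each `z k` with `k < j` is, up to scalars outside `L`, not a divisor of `z j`. -/
def Jumps (L : Set R) (z : α → R) (T : Set α) : Prop :=
  ∀ j ∈ T, ∀ k < j, ∀ t ∉ L, ¬ z k ∣ t * z j

/-- An obstruction to approximating over an initial part of `I` is a nonspecial element of smaller
index. -/
theorem exists_approx_of_jumps {L : Set R} (hL : (1 : R) ∉ L)
    {z : α → R} {T : Set α} {i : α}
    (hT : Jumps L z T) (hTi : ∀ j ∈ T, j < i) (hNS : ¬ NSE U L i) (hU : RDPure U)
    {r : R} (hr : ∀ m : E ⧸ U, m ≠ 0 → shp (col ⊥ m) ⊆ L → L ⊆ shp (col ⊥ m) ∨ r ∉ shp (col ⊥ m))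
    {z₀ : R} (hz₀ : ∀ j ∈ T, z j ∣ z₀) {y : R} (hry : z₀ ∣ r * y) {J : Ideal R} (hyJ : y ∉ J)
    (hJ : GenBy z T J) {e : E} (he : ∀ s ∈ J, s • e ∈ U) :
    ∃ v ∈ U, ∀ s ∈ J, s • (e - v) = 0 := by
  by_contra! hcon
  have hcol : col U e = J := by
    ext s
    refine ⟨fun hs => ?_, he s⟩
    by_contra hsJ
    obtain ⟨v, hv, hsv⟩ := hU.approx hs
    obtain ⟨s', hs', hne⟩ := hcon v hv
    exact hne (smul_eq_zero_of_dvd (dvd_of_mem_notMem hsJ hs') hsv)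
  have hT0 : ∃ j, j ∈ T := by
    obtain ⟨s, hs, hne⟩ := hcon 0 U.zero_mem
    rcases (hJ s).1 hs with rfl | ⟨j, hj, -⟩
    · simp at hne
    · exact ⟨j, hj⟩
  have hzJ : ∀ j ∈ T, z j ∈ J := fun j hj => (hJ _).2 (Or.inr ⟨j, hj, dvd_rfl⟩)
  have hgen : ∀ s ∈ J, ∃ j ∈ T, z j ∣ s := by
    intro s hs
    rcases (hJ s).1 hs with rfl | h
    · obtain ⟨j, hj⟩ := hT0
      exact ⟨j, hj, dvd_zero _⟩
    · exact h
  have hnomax : ∀ j ∈ T, ∃ j' ∈ T, j < j' := by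
    intro j hj
    by_contra! hmax
    obtain ⟨v, hv, hjv⟩ := hU.approx (he _ (hzJ j hj))
    obtain ⟨s, hs, hne⟩ := hcon v hv
    apply hne
    obtain ⟨k, hk, hks⟩ := hgen s hs
    rcases (hmax k hk).lt_or_eq with hlt | rfl
    · have : z j ∣ z k := by
        refine (dvd_or _ _).resolve_right fun h => hT j hj k hlt 1 hL ?_
        simpa using h
      exact smul_eq_zero_of_dvd (this.trans hks) hjv
    · exact smul_eq_zero_of_dvd hks hjv
  have hjump : ∀ s ∈ J, ∃ s' ∈ J, ∀ t ∉ L, ¬ s ∣ t * s' := by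
    intro s hs
    obtain ⟨j, hj, hjs⟩ := hgen s hs
    obtain ⟨j', hj', hlt⟩ := hnomax j hj
    exact ⟨z j', hzJ j' hj', fun t ht hd => hT j' hj' j hlt t ht (hjs.trans hd)⟩
  have hsub : shp J ⊆ L := by
    intro t ht
    by_contra htL
    obtain ⟨x, hx, htx⟩ := ht
    obtain ⟨j, hj, hjx⟩ := hgen _ htx
    obtain ⟨j', hj', hlt⟩ := hnomax j hj
    exact hT j' hj' j hlt t htL
      (hjx.trans (mul_dvd_mul_left t (dvd_of_mem_notMem hx (hzJ j' hj'))))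
  have hcolq : col (⊥ : Submodule R (E ⧸ U)) (U.mkQ e) = J := by
    rw [← hcol]; ext s
    rw [mem_col, mem_col, Submodule.mem_bot, ← map_smul, Submodule.mkQ_apply,
      Submodule.Quotient.mk_eq_zero]
  have heU : e ∉ U := by
    intro h
    apply hyJ
    rw [← hcol, mem_col]
    exact U.smul_mem _ h
  have hrJ : r ∈ shp J := by
    obtain ⟨j, hj⟩ := hT0
    exact ⟨y, hyJ, (hJ _).2 (Or.inr ⟨j, hj, (hz₀ j hj).trans hry⟩)⟩
  have hsh : shp J = L := by
    refine hsub.antisymm ?_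
    have := hr (U.mkQ e) (by simpa using heU) (by rwa [hcolq])
    rw [hcolq] at this
    exact this.resolve_right (not_not.2 hrJ)
  refine hNS ⟨e, by rw [hcol, hsh], fun u hu => ?_, ?_⟩
  · rw [hcol, hsh]
    obtain ⟨s, hs, hne⟩ := hcon u hu
    obtain ⟨s', hs', ht⟩ := hjump s hs
    refine ⟨s', hs', fun t htL h0 => hne ?_⟩
    exact smul_eq_zero_of_dvd ((dvd_or _ _).resolve_left (ht t htL)) h0
  · classical
    rw [hcol]
    refine ⟨fun j => if j ∈ T then z j else 0, fun j _ => ?_, fun x hx => ?_⟩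
    · dsimp only
      split_ifs with h
      · exact hzJ j h
      · exact J.zero_mem
    · obtain ⟨j, hj, hjx⟩ := hgen x hx
      exact ⟨j, hTi j hj, by simpa [hj] using hjx⟩

/-- A generating family of `I` refines to one with jumps. -/
theorem exists_jumps {L : Set R} {i₀ : α} {I : Ideal R} (hI : GoodI L i₀ I)
    {z₀ : R} (hz₀ : z₀ ∈ I) :
    ∃ (z : α → R) (T : Set α), Jumps L z T ∧ (∀ j ∈ T, j < i₀ ∧ z j ∈ I ∧ ¬ z₀ ∣ z j) ∧
      ∀ s ∈ I, ∃ j ∈ T, z j ∣ s := by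
  obtain ⟨z, hz, hc⟩ := hI.fam
  refine ⟨z, {j | j < i₀ ∧ (∀ k < j, ∀ t ∉ L, ¬ z k ∣ t * z j) ∧ ¬ z₀ ∣ z j},
    fun j hj => hj.2.1, fun j hj => ⟨hj.1, hz j hj.1, hj.2.2⟩, fun s hs => ?_⟩
  obtain ⟨s1, hs1, h1, h2⟩ := exists_dvd_both I hs hz₀
  obtain ⟨s', hs', ht⟩ := hI.lim s1 hs1
  have hex : ∃ j, j < i₀ ∧ ∀ t ∉ L, ¬ s1 ∣ t * z j := by
    obtain ⟨j, hj, hd⟩ := hc s' hs'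
    exact ⟨j, hj, fun t htL h => ht t htL (h.trans (mul_dvd_mul_left t hd))⟩
  obtain ⟨j, ⟨hj, hjt⟩, hmin⟩ := WellFounded.has_min (wellFounded_lt (α := α))
    {j | j < i₀ ∧ ∀ t ∉ L, ¬ s1 ∣ t * z j} hex
  have hj1 : ¬ s1 ∣ z j := by simpa using hjt 1 hI.one_notMem
  refine ⟨j, ⟨hj, fun k hk t htL hd => ?_, fun hd => hj1 (h2.trans hd)⟩,
    ((dvd_or _ _).resolve_left hj1).trans h1⟩
  obtain ⟨t', ht', hd'⟩ : ∃ t' ∉ L, s1 ∣ t' * z k := by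
    by_contra! hcon
    exact hmin k ⟨hk.trans hj, hcon⟩ hk
  apply hjt (t' * t) _ ((hd'.trans (mul_dvd_mul_left t' hd)).trans (by rw [mul_assoc]))
  rw [← hI.shp_eq] at ht' htL ⊢
  exact notMem_shp_mul ht' htL

theorem exists_eq_smul_mkQ {L : Set R} {i₀ : α} (hmin : ∀ i < i₀, ¬ NSE U L i) (hU : Good U)
    {I : Ideal R} (hI : GoodI L i₀ I) (ψ : I →ₗ[R] E ⧸ U)
    (hψ : ∀ z : I, (z : R) ≠ 0 → ∃ c : R, c * z ≠ 0 ∧ c • ψ z = 0) :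
    ∃ m : E ⧸ U, ∀ z : I, ψ z = (z : R) • m := by
  have h1I : (1 : R) ∉ I := by
    intro h
    obtain ⟨s', -, ht⟩ := hI.lim 1 h
    exact ht 1 hI.one_notMem (one_dvd _)
  obtain ⟨n, hn⟩ := hU.rank
  obtain ⟨r, hrL, hr⟩ := exists_mem_forall_notMem_shp
    (hn.of_surjective U.mkQ U.mkQ_surjective)
    (show L.Nonempty from ⟨0, by rw [← hI.shp_eq]; exact mem_shp_of_mem h1I I.zero_mem⟩)
  obtain ⟨z₀, hz₀, hz₀r⟩ := exists_dvd_mul_of_mem_shp hI.exists_ne_zero (hI.shp_eq.symm ▸ hrL)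
  obtain ⟨z, T0, hT0, hT0I, hcov⟩ := exists_jumps hI hz₀
  let S : Set (R →ₗ.[R] E) := {φ | (∃ T ⊆ T0, (∀ j ∈ T, ∀ k ∈ T0, k < j → k ∈ T) ∧
    GenBy z T φ.domain) ∧ ∀ (x : φ.domain) (hx : (x : R) ∈ I), U.mkQ (φ x) = ψ ⟨x, hx⟩}
  have hbot : (⊥ : R →ₗ.[R] E) ∈ S := by
    refine ⟨⟨∅, Set.empty_subset _, by simp, fun x => ?_⟩, ?_⟩
    · show x ∈ (⊥ : Ideal R) ↔ _
      simp
    · rintro ⟨x, hx⟩ hxI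
      have hx0 : x = 0 := (Submodule.mem_bot R).1 hx
      subst hx0
      show U.mkQ ((⊥ : R →ₗ.[R] E) 0) = ψ 0
      rw [map_zero, LinearPMap.map_zero, map_zero]
  obtain ⟨φ, -, hφ⟩ := zorn_le_nonempty₀ S (by
    intro c hcS hc φ₁ hφ₁
    have hdir : DirectedOn (· ≤ ·) c := hc.directedOn
    have hne : c.Nonempty := ⟨φ₁, hφ₁⟩
    refine ⟨LinearPMap.sSup c hdir, ⟨?_, ?_⟩, fun φ hφ => LinearPMap.le_sSup hdir hφ⟩
    · have h1 : ∀ φ : R →ₗ.[R] E, ∃ T : Set α, φ ∈ c → T ⊆ T0 ∧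
          (∀ j ∈ T, ∀ k ∈ T0, k < j → k ∈ T) ∧ GenBy z T φ.domain := by
        intro φ
        by_cases hφ : φ ∈ c
        · obtain ⟨T, h⟩ := (hcS hφ).1
          exact ⟨T, fun _ => h⟩
        · exact ⟨∅, fun h => absurd h hφ⟩
      choose T hT using h1
      refine ⟨⋃ φ ∈ c, T φ, Set.iUnion₂_subset fun φ hφ => (hT φ hφ).1, ?_, fun x => ?_⟩
      · intro j hj k hk hkj
        simp only [Set.mem_iUnion] at hj ⊢
        obtain ⟨φ, hφ, hj⟩ := hj
        exact ⟨φ, hφ, (hT φ hφ).2.1 j hj k hk hkj⟩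
      · rw [LinearPMap.mem_domain_sSup_iff hne hdir]
        constructor
        · rintro ⟨φ, hφ, hx⟩
          refine ((hT φ hφ).2.2 x).1 hx |>.imp_right ?_
          rintro ⟨j, hj, hd⟩
          exact ⟨j, by simp only [Set.mem_iUnion]; exact ⟨φ, hφ, hj⟩, hd⟩
        · rintro (rfl | ⟨j, hj, hd⟩)
          · exact ⟨φ₁, hφ₁, Submodule.zero_mem _⟩
          · simp only [Set.mem_iUnion] at hj
            obtain ⟨φ, hφ, hj⟩ := hj
            exact ⟨φ, hφ, ((hT φ hφ).2.2 x).2 (Or.inr ⟨j, hj, hd⟩)⟩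
    · rintro ⟨x, hx⟩ hxI
      obtain ⟨φ, hφ, hxφ⟩ := (LinearPMap.mem_domain_sSup_iff hne hdir).1 hx
      have := LinearPMap.sSup_apply hdir hφ ⟨x, hxφ⟩
      have h2 := (hcS hφ).2 ⟨x, hxφ⟩ hxI
      rw [← h2, ← this]) ⊥ hbot
  obtain ⟨⟨T, hTT0, hTlow, hgen⟩, hφψ⟩ := hφ.prop
  obtain ⟨x, hx⟩ := exists_eq_smul hU.inj φ.domain φ.toFun
  replace hx : ∀ s : φ.domain, φ s = (s : R) • x := hx
  by_cases hall : T0 ⊆ T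
  · refine ⟨U.mkQ x, fun s => ?_⟩
    obtain ⟨j, hj, hd⟩ := hcov s s.2
    have hs : (s : R) ∈ φ.domain := (hgen _).2 (Or.inr ⟨j, hall hj, hd⟩)
    rw [← map_smul, ← hx ⟨s, hs⟩, hφψ _ s.2]
  · exfalso
    obtain ⟨i, ⟨hiT0, hiT⟩, himin⟩ := WellFounded.has_min (wellFounded_lt (α := α))
      (T0 \ T) (Set.not_subset.1 hall)
    have hTi : ∀ j ∈ T, j < i := by
      intro j hj
      rcases lt_trichotomy j i with h | rfl | h
      · exact h
      · exact absurd hj hiT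
      · exact absurd (hTlow j hj i hiT0 h) hiT
    obtain ⟨hii₀, hziI, hziz₀⟩ := hT0I i hiT0
    have hzi0 : z i ≠ 0 := fun h => hziz₀ (h ▸ dvd_zero _)
    have hdiv : ∀ j ∈ T, z i ∣ z j := by
      intro j hj
      refine (dvd_or _ _).resolve_right fun h => hT0 i hiT0 j (hTi j hj) 1 hI.one_notMem ?_
      simpa using h
    have hzidom : z i ∉ φ.domain := by
      intro h
      rcases (hgen _).1 h with h | ⟨j, hj, h⟩
      · exact hzi0 h
      · exact hT0 i hiT0 j (hTi j hj) 1 hI.one_notMem (by simpa using h)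
    have hdomdvd : ∀ s ∈ φ.domain, z i ∣ s := fun s hs => dvd_of_mem_notMem hzidom hs
    obtain ⟨c, hc, hcψ⟩ := hψ ⟨z i, hziI⟩ hzi0
    obtain ⟨e0, he0⟩ := U.mkQ_surjective (ψ ⟨z i, hziI⟩)
    obtain ⟨w, hw⟩ := exists_sub_smul_mem hU.inj hU.pure hc (e := e0) (by
      rw [← Submodule.Quotient.mk_eq_zero, ← Submodule.mkQ_apply, map_smul, he0, hcψ])
    have hw' : U.mkQ (z i • w) = ψ ⟨z i, hziI⟩ := by
      rw [← he0, eq_comm, ← sub_eq_zero, ← map_sub, Submodule.mkQ_apply,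
        Submodule.Quotient.mk_eq_zero]
      exact hw
    have hψk : ∀ (k : R) (hk : z i * k ∈ I), ψ ⟨z i * k, hk⟩ = k • ψ ⟨z i, hziI⟩ := by
      intro k hk
      rw [← map_smul]
      congr 1
      exact Subtype.ext (mul_comm _ _)
    obtain ⟨v, hv, hvs⟩ := exists_approx_of_jumps (U := U) (e := x - w) (J := φ.domain) (y := z i)
      hI.one_notMem (fun j hj => hT0 j (hTT0 hj)) hTi (hmin i hii₀) hU.pure hr
      (z₀ := z₀) (fun j hj => (dvd_or _ _).resolve_right (hT0I j (hTT0 hj)).2.2)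
      (hz₀r _ hziI) hzidom hgen (by
        intro s hs
        obtain ⟨k, rfl⟩ := hdomdvd s hs
        have hkI : z i * k ∈ I := I.mul_mem_right k hziI
        rw [smul_sub, ← hx ⟨_, hs⟩, ← Submodule.Quotient.mk_eq_zero, ← Submodule.mkQ_apply,
          map_sub, hφψ _ hkI, sub_eq_zero]
        have h2 : U.mkQ ((z i * k) • w) = k • ψ ⟨z i, hziI⟩ := by
          rw [mul_comm, mul_smul, map_smul, hw']
        exact (hψk k hkI).trans h2.symm)
    let φ' : R →ₗ.[R] E :=
      { domain := Ideal.span {z i}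
        toFun := ((LinearMap.toSpanSingleton R E (w + v)).comp (Submodule.subtype _)) }
    have hφ' : φ' ∈ S := by
      refine ⟨⟨insert i T, Set.insert_subset hiT0 hTT0, ?_, fun s => ?_⟩, ?_⟩
      · intro j hj k hk hkj
        have hki : k < i := by
          rcases hj with rfl | hj
          · exact hkj
          · exact hkj.trans (hTi j hj)
        right
        by_contra hkT
        exact himin k ⟨hk, hkT⟩ hki
      · show s ∈ Ideal.span {z i} ↔ _
        rw [Ideal.mem_span_singleton]
        constructor
        · exact fun h => Or.inr ⟨i, Or.inl rfl, h⟩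
        · rintro (rfl | ⟨j, rfl | hj, hd⟩)
          · exact dvd_zero _
          · exact hd
          · exact (hdiv j hj).trans hd
      · rintro ⟨s, hs⟩ hsI
        obtain ⟨k, rfl⟩ := Ideal.mem_span_singleton.1 hs
        show U.mkQ ((z i * k) • (w + v)) = _
        rw [hψk k hsI, ← hw', ← map_smul, ← sub_eq_zero, ← map_sub, Submodule.mkQ_apply,
          Submodule.Quotient.mk_eq_zero]
        have : (z i * k) • (w + v) - k • z i • w = (z i * k) • v := by module
        rw [this]
        exact U.smul_mem _ hv
    have hle : φ ≤ φ' := by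
      refine ⟨fun s hs => Ideal.mem_span_singleton.2 (hdomdvd s hs), ?_⟩
      rintro ⟨s, hs⟩ ⟨s', hs'⟩ (rfl : s = s')
      show _ = s • (w + v)
      rw [hx ⟨s, hs⟩, ← sub_eq_zero, ← smul_sub, ← hvs s hs]
      congr 1; abel
    exact hzidom ((hφ.le_of_ge hφ' hle).1 (Ideal.mem_span_singleton_self (z i)))

end Extension

end ChainRing

namespace ChainRing

section Tower

variable {R : Type u} [CommRing R] [PreValuationRing R] [IsLocalRing R]
variable {α : Type u} [LinearOrder α]
variable {E : Type u} [AddCommGroup E] [Module R E] {U : Submodule R E}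

theorem exists_shift (hHX : HX R) {L : Set R} {i₀ : α} (hU : Good U) (h : NSE U L i₀) :
    ∃ f : E, f ∉ U ∧ GoodI L i₀ (col U f) ∧
      ∃ (E' : Type u) (_ : AddCommGroup E') (_ : Module R E') (U' : Submodule R E'),
        Good U' ∧ NSE U' L i₀ ∧ ∃ d ∈ U', ∀ x : R, x • d = 0 ↔ x ∈ col U f := by
  obtain ⟨e, rfl, hns, hfam⟩ := h
  have hlim := hns.lim hU.pure
  have heU := hns.notMem
  obtain ⟨a0, ha0, ha0t⟩ := hlim.exists_forall_ne_zero
  obtain ⟨w1, hw1, ha0w⟩ := hU.pure.approx ha0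
  obtain ⟨a1, ha1, ha1t⟩ := hns w1 hw1
  have h01 : ¬ a0 ∣ a1 := fun hd => by
    simpa [smul_eq_zero_of_dvd hd ha0w] using ha1t 1 one_notMem_shp
  obtain ⟨l, rfl⟩ := (dvd_or a0 a1).resolve_left h01
  have hl : l ∈ shp (col U e) := by
    by_contra hl
    exact ha1t l hl (by rw [mul_comm]; exact ha0w)
  obtain ⟨w, hw, ha1w⟩ := hU.pure.approx ha1
  obtain ⟨f, hf⟩ := exists_smul_eq hU.inj l (e - w) (by
    intro r hr
    rcases dvd_or a1 r with hd | ⟨k, rfl⟩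
    · exact smul_eq_zero_of_dvd hd ha1w
    · exact absurd (by linear_combination k * hr) (ha0t 1 one_notMem_shp))
  have hmem : ∀ x : R, x ∈ col U e ↔ x ∈ col (col U f) l := by
    intro x
    have : (x * l) • f = x • e - x • w := by rw [mul_smul, hf, smul_sub]
    rw [mem_col, mem_col, smul_eq_mul, mem_col, this, sub_mem_comm_iff]
    constructor
    · intro h; exact U.sub_mem (U.smul_mem _ hw) h
    · intro h
      have := U.sub_mem (U.smul_mem x hw) h
      simpa using this
  have hcol : col (col U f) l = col U e := (Ideal.ext hmem).symm
  have hlf : l ∉ col U f := by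
    intro h
    apply heU
    have : (1 : R) ∈ col U e := (hmem 1).2 (by simpa using h)
    simpa using this
  have hgood : GoodI (shp (col U e)) i₀ (col U f) := by
    apply GoodI.of_col hlf
    · rw [hcol]
      exact ⟨rfl, hfam, hlim⟩
    · exact ⟨a1 * l, by simpa using (hmem a1).1 ha1, by simpa using ha0t 1 one_notMem_shp⟩
  have hfU : f ∉ U := fun h => hlf (U.smul_mem l h)
  refine ⟨f, hfU, hgood, ?_⟩
  obtain ⟨y, hy, hly⟩ := hgood.shp_eq.symm ▸ hl
  have hye : y ∈ col U e := (hmem y).2 (by simpa [mul_comm] using hly)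
  obtain ⟨w', hw', u, hu, hyu, h1, h2⟩ := exists_prep hU.ser one_notMem_shp
    (fun b hb => hU.pure.approx hb) hns hye
  obtain ⟨E', i1, i2, U', hU', d, hdU', hd⟩ := hHX (col U f) (by
    rw [Ideal.ne_top_iff_one]
    simpa using hfU)
  exact ⟨E', i1, i2, U', hU', nse_of_transfer rfl h1 h2 hgood.shp_eq
    (fun x hx => smul_eq_zero_of_dvd (dvd_of_mem_notMem hy hx) hyu) hfam hU' hdU' hd, d, hdU', hd⟩

structure Tower (U : Submodule R E) (L : Set R) (i₀ : α) (k : ℕ) (y : ℕ → E) : Prop where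
  mem : y 0 ∈ U
  exists_smul : ∃ b : R, b ≠ 0 ∧ b • y 0 = 0
  ann : ∀ i ≤ k, ∀ z : R, z • y 0 = 0 → z • y i = 0
  good : ∀ i, 1 ≤ i → i ≤ k → GoodI L i₀ (col (Submodule.span R (y '' Set.Iio i)) (y i))
  rel : ∀ a : ℕ → R, ∑ i ∈ Finset.range (k + 1), a i • y i = 0 → ∀ i ≤ k, ¬ IsUnit (a i)

theorem exists_tower_zero {L : Set R} {i₀ : α} (hU : Good U) (h : NSE U L i₀) :
    ∃ y : ℕ → E, Tower U L i₀ 0 y := by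
  obtain ⟨e, rfl, hns, hfam⟩ := h
  obtain ⟨b, hb, hbt⟩ := (hns.lim hU.pure).exists_forall_ne_zero
  obtain ⟨v, hv, hbv⟩ := hU.pure.approx hb
  have hne : e - v ≠ 0 := fun h => hns.notMem (by rwa [sub_eq_zero.1 h])
  obtain ⟨u, hu, hann⟩ := hU.exists_ann_eq hne
  refine ⟨fun _ => u, hu, ⟨b, by simpa using hbt 1 one_notMem_shp, (hann b).2 hbv⟩,
    fun _ _ _ h => h, fun i h1 h2 => absurd h1 (by omega), ?_⟩
  intro a ha i hi hunit
  obtain rfl : i = 0 := by omega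
  simp only [zero_add, Finset.sum_range_one] at ha
  have hu0 := (hunit.smul_eq_zero).1 ha
  exact hne (by simpa using (hann 1).1 (by simpa using hu0))

theorem Tower.ne_zero {L : Set R} {i₀ : α} {k : ℕ} {y : ℕ → E} (h : Tower U L i₀ k y) :
    y 0 ≠ 0 := by
  intro h0
  refine h.rel (Pi.single 0 1) ?_ 0 (Nat.zero_le _) (by simp)
  apply Finset.sum_eq_zero
  intro i _
  rcases Nat.eq_zero_or_pos i with rfl | hi
  · simp [h0]
  · simp [Pi.single_eq_of_ne hi.ne']

variable [WellFoundedLT α]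
variable {E' : Type u} [AddCommGroup E'] [Module R E'] {U' : Submodule R E'}

theorem Tower.exists_pmap {L : Set R} {i₀ : α} {k : ℕ} {y : ℕ → E'} (h : Tower U' L i₀ k y)
    (hmin : ∀ i < i₀, ¬ NSE U L i) (hU : Good U) {m0 : E ⧸ U}
    (hm0 : ∀ z : R, z • y 0 = 0 → z • m0 = 0) : ∀ j ≤ k,
    ∃ f : E' →ₗ.[R] E ⧸ U, f.domain = Submodule.span R (y '' Set.Iio (j + 1)) ∧
      ∀ h : y 0 ∈ f.domain, f ⟨y 0, h⟩ = m0 := by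
  intro j
  induction j with
  | zero =>
    intro _
    refine ⟨LinearPMap.mkSpanSingleton' (σ := RingHom.id R) (y 0) m0 hm0, ?_, fun h => ?_⟩
    · rw [LinearPMap.domain_mkSpanSingleton]
      congr 1
      ext x
      simp
    · have := LinearPMap.mkSpanSingleton'_apply (σ := RingHom.id R) (y 0) m0 hm0 1
        (by simp)
      simpa using this
  | succ j ih =>
    intro hj
    obtain ⟨f, hfd, hf0⟩ := ih (by omega)
    obtain ⟨b, hb, hb0⟩ := h.exists_smul
    have hgood := h.good (j + 1) (by omega) hj
    rw [← hfd] at hgood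
    let g : col f.domain (y (j + 1)) →ₗ[R] f.domain :=
      ((LinearMap.toSpanSingleton R E' (y (j + 1))).comp (Submodule.subtype _)).codRestrict
        f.domain (fun z => z.2)
    obtain ⟨m, hm⟩ := exists_eq_smul_mkQ hmin hU hgood (f.toFun.comp g) (by
      intro z hz
      rcases dvd_or (z : R) b with ⟨c, hc⟩ | hd
      · refine ⟨c, by rwa [mul_comm, ← hc], ?_⟩
        rw [← map_smul]
        have : g (c • z) = 0 := by
          apply Subtype.ext
          show (c * (z : R)) • y (j + 1) = 0
          rw [mul_comm, ← hc]
          exact h.ann _ hj _ hb0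
        rw [LinearMap.comp_apply, this, map_zero]
      · refine ⟨1, by simpa using hz, ?_⟩
        have : g z = 0 := by
          apply Subtype.ext
          show (z : R) • y (j + 1) = 0
          exact smul_eq_zero_of_dvd hd (h.ann _ hj _ hb0)
        rw [LinearMap.comp_apply, this, map_zero, smul_zero])
    have hm' : ∀ (z : R) (hz : z • y (j + 1) ∈ f.domain), f ⟨z • y (j + 1), hz⟩ = z • m :=
      fun z hz => hm ⟨z, hz⟩
    have hz0 : ∀ z : R, z • y (j + 1) = 0 → z • m = 0 := by
      intro z hz
      have h0 : z • y (j + 1) ∈ f.domain := by rw [hz]; exact f.domain.zero_mem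
      rw [← hm' z h0]
      have : (⟨z • y (j + 1), h0⟩ : f.domain) = 0 := Subtype.ext hz
      rw [this, LinearPMap.map_zero]
    have hagree : ∀ (x : f.domain)
        (x' : (LinearPMap.mkSpanSingleton' (σ := RingHom.id R) (y (j + 1)) m hz0).domain),
        (x : E') = x' → f x = LinearPMap.mkSpanSingleton' (σ := RingHom.id R) (y (j + 1)) m hz0 x' := by
      rintro ⟨x, hx⟩ ⟨x', hx'⟩ (rfl : x = x')
      obtain ⟨z, rfl⟩ := Submodule.mem_span_singleton.1 hx'
      rw [hm' z hx]
      exact (LinearPMap.mkSpanSingleton'_apply (σ := RingHom.id R) (y (j + 1)) m hz0 z hx').symm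
    refine ⟨f.sup _ hagree, ?_, fun h0 => ?_⟩
    · rw [LinearPMap.domain_sup, hfd, LinearPMap.domain_mkSpanSingleton, ← Submodule.span_union]
      congr 1
      rw [← Set.image_singleton, ← Set.image_union]
      congr 1
      ext x
      simp only [Set.mem_union, Set.mem_Iio, Set.mem_singleton_iff]
      omega
    · have hd0 : y 0 ∈ f.domain := by
        rw [hfd]
        exact Submodule.subset_span ⟨0, Set.mem_Iio.2 (by omega), rfl⟩
      rw [← hf0 hd0]
      exact ((LinearPMap.left_le_sup f _ hagree).2 (x := ⟨y 0, hd0⟩) (y := ⟨y 0, h0⟩) rfl).symm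

end Tower

end ChainRing

namespace ChainRing

section TowerStep

variable {R : Type u} [CommRing R] [PreValuationRing R] [IsLocalRing R]
variable {α : Type u} [LinearOrder α]
variable {E : Type u} [AddCommGroup E] [Module R E] {U : Submodule R E}
variable {E' : Type u} [AddCommGroup E'] [Module R E'] {U' : Submodule R E'}

theorem Tower.exists_start {L : Set R} {i₀ : α} {k : ℕ} {y : ℕ → E'} (h : Tower U' L i₀ k y)
    (hU' : Good U') (hU : Good U) {f : E} (hf : f ∉ U) (hgood : GoodI L i₀ (col U f)) {d : E'}
    (hd : d ∈ U') (hdf : ∀ x : R, x • d = 0 ↔ x ∈ col U f) :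
    ∃ m0 : E ⧸ U, (∀ z : R, z • m0 = 0 ↔ z • y 0 = 0) ∧ GoodI L i₀ (col ⊥ (y 0)) := by
  have hy0 := h.ne_zero
  have hbot : col ⊥ d = col U f := Ideal.ext fun x => by
    rw [mem_col, Submodule.mem_bot]; exact hdf x
  have hmk : ∀ x : R, x • U.mkQ f = 0 ↔ x • d = 0 := by
    intro x
    rw [hdf, ← map_smul, Submodule.mkQ_apply, Submodule.Quotient.mk_eq_zero]; rfl
  have hd0 : d ≠ 0 := by
    intro h0
    apply hf
    have := (hdf 1).1 (by simp [h0])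
    simpa using this
  rcases hU'.ser _ h.mem _ hd with ⟨r, hr⟩ | ⟨r, hr⟩
  · refine ⟨r • U.mkQ f, fun z => ?_, ?_⟩
    · rw [hr, smul_smul, smul_smul, hmk]
    · rw [hr, col_smul, hbot]
      refine GoodI.colon ?_ hgood
      rw [← hbot, mem_col, Submodule.mem_bot, ← hr]
      exact hy0
  · obtain ⟨b, hb, hb0⟩ := h.exists_smul
    obtain ⟨c, rfl⟩ : r ∣ b := by
      refine (dvd_or r b).resolve_right fun hd => hd0 ?_
      rw [hr, smul_eq_zero_of_dvd hd hb0]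
    have hcd : c • d = 0 := by rw [hr, smul_smul, mul_comm]; exact hb0
    obtain ⟨w, hw⟩ := exists_sub_smul_mem hU.inj hU.pure (e := f) (r := r) (c := c)
      (by rwa [mul_comm]) ((hdf c).1 hcd)
    have hw' : r • U.mkQ w = U.mkQ f := by
      rw [← map_smul, eq_comm, ← sub_eq_zero, ← map_sub, Submodule.mkQ_apply,
        Submodule.Quotient.mk_eq_zero]
      exact hw
    have hf0 : U.mkQ f ≠ 0 := fun h0 => hd0 (by simpa using (hmk 1).1 (by simpa using h0))
    refine ⟨U.mkQ w, fun z => ?_, ?_⟩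
    · rcases dvd_or r z with ⟨s, rfl⟩ | hzr
      · rw [mul_comm, mul_smul, mul_smul, hw', hmk, hr]
      · constructor
        · intro h0
          exact absurd (hw' ▸ smul_eq_zero_of_dvd hzr h0) hf0
        · intro h0
          exact absurd (hr ▸ smul_eq_zero_of_dvd hzr h0) hd0
    · refine GoodI.of_col (r := r) ?_ ?_ ⟨_, hb0, hb⟩
      · rw [mem_col, Submodule.mem_bot, ← hr]
        exact hd0
      · rw [← col_smul, ← hr, hbot]
        exact hgood

theorem LinearPMap.injective_of_good {Q : Type u} [AddCommGroup Q] [Module R Q] (hU' : Good U')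
    (f : E' →ₗ.[R] Q)
    {x : E'} (hx0 : x ≠ 0) (hx : x ∈ f.domain) (h : ∀ z : R, z • f ⟨x, hx⟩ = 0 → z • x = 0)
    (y : f.domain) (hy : f y = 0) : y = 0 := by
  by_contra hne
  obtain ⟨c, d, hcd, hc⟩ := hU'.uniform (x := (y : E')) (y := x) (fun h => hne (Subtype.ext h)) hx0
  rw [hcd] at hc
  apply hc
  apply h
  rw [← LinearPMap.map_smul]
  have : d • (⟨x, hx⟩ : f.domain) = c • y := Subtype.ext hcd.symm
  rw [this, LinearPMap.map_smul, hy, smul_zero]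

variable [WellFoundedLT α]

theorem Tower.step {L : Set R} {i₀ : α} {k : ℕ} {y : ℕ → E'} (h : Tower U' L i₀ k y)
    (hmin : ∀ i < i₀, ¬ NSE U L i) (hU' : Good U') (hU : Good U) {f : E} (hf : f ∉ U)
    (hgood : GoodI L i₀ (col U f)) {d : E'}
    (hd : d ∈ U') (hdf : ∀ x : R, x • d = 0 ↔ x ∈ col U f) :
    ∃ y' : ℕ → E, Tower U L i₀ (k + 1) y' := by
  obtain ⟨m0, hm0, hgood0⟩ := h.exists_start hU' hU hf hgood hd hdf
  obtain ⟨θ, hθd, hθ0⟩ := h.exists_pmap hmin hU (fun z => (hm0 z).2) k le_rfl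
  have hyd : ∀ i ≤ k, y i ∈ θ.domain := by
    intro i hi
    rw [hθd]
    exact Submodule.subset_span ⟨i, Set.mem_Iio.2 (by omega), rfl⟩
  have hinj := LinearPMap.injective_of_good hU' θ h.ne_zero (hyd 0 (Nat.zero_le _))
    (fun z hz => by rw [hθ0] at hz; exact (hm0 z).1 hz)
  obtain ⟨b, hb, hb0⟩ := h.exists_smul
  have hex : ∀ i, ∃ c : E, b • c = 0 ∧ ∀ hi : i ≤ k, U.mkQ c = θ ⟨y i, hyd i hi⟩ := by
    intro i
    by_cases hi : i ≤ k
    · obtain ⟨e, he⟩ := U.mkQ_surjective (θ ⟨y i, hyd i hi⟩)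
      have hbe : b • e ∈ U := by
        rw [← Submodule.Quotient.mk_eq_zero, ← Submodule.mkQ_apply, map_smul, he,
          ← LinearPMap.map_smul]
        have : b • (⟨y i, hyd i hi⟩ : θ.domain) = 0 := Subtype.ext (h.ann i hi b hb0)
        rw [this, LinearPMap.map_zero]
      obtain ⟨v, hv, hbv⟩ := hU.pure.approx hbe
      refine ⟨e - v, hbv, fun _ => ?_⟩
      rw [map_sub, he, Submodule.mkQ_apply, (Submodule.Quotient.mk_eq_zero _).2 hv, sub_zero]
    · exact ⟨0, smul_zero _, fun h => absurd h hi⟩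
  choose c hbc hc using hex
  have hc0 : c 0 ≠ 0 := by
    intro h0
    have h1 := hc 0 (Nat.zero_le _)
    rw [h0, map_zero] at h1
    exact h.ne_zero (congrArg Subtype.val (hinj _ h1.symm))
  obtain ⟨u, hu, hann⟩ := hU.exists_ann_eq hc0
  obtain ⟨a, u0, hu0, hau0, hbu0, hv⟩ := hU.exists_common_approx (b := b) hu
    (fun h0 => hc0 (by simpa using (hann 1).1 (by simpa using h0))) ((hann b).2 (hbc 0)) c (k + 1)
    (fun i _ => hbc i)
  have hv' : ∀ i, ∃ g : E, a • g = 0 ∧ ∀ hi : i ≤ k, U.mkQ g = θ ⟨y i, hyd i hi⟩ := by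
    intro i
    by_cases hi : i ≤ k
    · obtain ⟨v, hv, hav⟩ := hv i (by omega)
      refine ⟨c i - v, hav, fun hi => ?_⟩
      rw [map_sub, hc i hi, Submodule.mkQ_apply U v, (Submodule.Quotient.mk_eq_zero _).2 hv, sub_zero]
    · exact ⟨0, smul_zero _, fun h => absurd h hi⟩
  choose g hag hg using hv'
  let y' : ℕ → E := fun i => Nat.casesOn i u0 g
  have hQu0 : U.mkQ u0 = 0 := (Submodule.Quotient.mk_eq_zero _).2 hu0
  have hu00 : u0 ≠ 0 := fun h0 => hau0 (by rw [h0, smul_zero])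
  -- transport of spans
  have hspan1 : ∀ i ≤ k, ∀ x ∈ Submodule.span R (y' '' Set.Iio (i + 1)),
      ∃ s : θ.domain, (s : E') ∈ Submodule.span R (y '' Set.Iio i) ∧ θ s = U.mkQ x := by
    intro i hi x hx
    induction hx using Submodule.span_induction with
    | mem x hx =>
      obtain ⟨j, hj, rfl⟩ := hx
      cases j with
      | zero => exact ⟨0, Submodule.zero_mem _, by rw [LinearPMap.map_zero]; exact hQu0.symm⟩
      | succ j =>
        have hj' : j < i := by simpa using hj
        exact ⟨⟨y j, hyd j (by omega)⟩, Submodule.subset_span ⟨j, hj', rfl⟩, (hg j (by omega)).symm⟩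
    | zero => exact ⟨0, Submodule.zero_mem _, by rw [LinearPMap.map_zero, map_zero]⟩
    | add x x' _ _ hx hx' =>
      obtain ⟨s, hs, h1⟩ := hx
      obtain ⟨s', hs', h1'⟩ := hx'
      exact ⟨s + s', Submodule.add_mem _ hs hs', by rw [LinearPMap.map_add, h1, h1', map_add]⟩
    | smul r x _ hx =>
      obtain ⟨s, hs, h1⟩ := hx
      exact ⟨r • s, Submodule.smul_mem _ _ hs, by rw [LinearPMap.map_smul, h1, map_smul]⟩
  have hspan2 : ∀ i ≤ k, ∀ x ∈ Submodule.span R (y '' Set.Iio i), ∀ hx : x ∈ θ.domain,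
      ∃ s ∈ Submodule.span R (y' '' Set.Iio (i + 1)), a • s = 0 ∧ U.mkQ s = θ ⟨x, hx⟩ := by
    intro i hi x hx
    induction hx using Submodule.span_induction with
    | mem x hx =>
      obtain ⟨j, hj, rfl⟩ := hx
      have hj' : j < i := hj
      intro _
      exact ⟨g j, Submodule.subset_span ⟨j + 1, by simpa using hj', rfl⟩, hag j, hg j (by omega)⟩
    | zero =>
      intro h0
      refine ⟨0, Submodule.zero_mem _, smul_zero _, ?_⟩
      rw [map_zero, ← LinearPMap.map_zero θ]; rfl
    | add x x' hx0 hx0' hx hx' =>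
      intro h0
      have hle : Submodule.span R (y '' Set.Iio i) ≤ θ.domain := by
        rw [hθd]
        exact Submodule.span_mono (Set.image_mono (Set.Iio_subset_Iio (by omega)))
      obtain ⟨s, hs, h1, h2⟩ := hx (hle hx0)
      obtain ⟨s', hs', h1', h2'⟩ := hx' (hle hx0')
      refine ⟨s + s', Submodule.add_mem _ hs hs', by rw [smul_add, h1, h1', add_zero], ?_⟩
      rw [map_add, h2, h2', ← LinearPMap.map_add]; rfl
    | smul r x hx0 hx =>
      intro h0
      have hle : Submodule.span R (y '' Set.Iio i) ≤ θ.domain := by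
        rw [hθd]
        exact Submodule.span_mono (Set.image_mono (Set.Iio_subset_Iio (by omega)))
      obtain ⟨s, hs, h1, h2⟩ := hx (hle hx0)
      refine ⟨r • s, Submodule.smul_mem _ _ hs, by rw [smul_comm, h1, smul_zero], ?_⟩
      rw [map_smul, h2, ← LinearPMap.map_smul]; rfl
  have hcol : ∀ i ≤ k, col (Submodule.span R (y' '' Set.Iio (i + 1))) (g i) =
      col (Submodule.span R (y '' Set.Iio i)) (y i) := by
    intro i hi
    ext z
    rw [mem_col, mem_col]
    have hz : θ ⟨z • y i, θ.domain.smul_mem z (hyd i hi)⟩ = U.mkQ (z • g i) := by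
      rw [map_smul, hg i hi, ← LinearPMap.map_smul]; rfl
    constructor
    · intro hz'
      obtain ⟨s, hs, h1⟩ := hspan1 i hi _ hz'
      have h2 := hinj (⟨z • y i, θ.domain.smul_mem z (hyd i hi)⟩ - s) (by
        rw [LinearPMap.map_sub, hz, h1, sub_self])
      have h3 : z • y i = s := congrArg Subtype.val (sub_eq_zero.1 h2)
      rw [h3]; exact hs
    · intro hz'
      obtain ⟨s, hs, has, h1⟩ := hspan2 i hi _ hz' (θ.domain.smul_mem z (hyd i hi))
      rw [hz, eq_comm, ← sub_eq_zero, ← map_sub, Submodule.mkQ_apply,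
        Submodule.Quotient.mk_eq_zero] at h1
      obtain ⟨r, hr⟩ := hU.ser.eq_smul h1 hu0 (a := a)
        (by rw [smul_sub, smul_comm, hag, smul_zero, has, sub_zero]) hau0
      rw [sub_eq_iff_eq_add] at hr
      rw [hr]
      exact Submodule.add_mem _ (Submodule.smul_mem _ _
        (Submodule.subset_span ⟨0, by simp, rfl⟩)) hs
  refine ⟨y', hu0, ⟨b, hb, hbu0⟩, ?_, ?_, ?_⟩
  · intro i hi z hz
    cases i with
    | zero => exact hz
    | succ i =>
      have had : a ∣ z := (dvd_or a z).resolve_right fun hd => hau0 (smul_eq_zero_of_dvd hd hz)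
      exact smul_eq_zero_of_dvd had (hag i)
  · intro i h1 hi
    obtain ⟨i, rfl⟩ : ∃ j, i = j + 1 := ⟨i - 1, by omega⟩
    show GoodI L i₀ (col _ (g i))
    rw [hcol i (by omega)]
    rcases Nat.eq_zero_or_pos i with rfl | h0
    · have : y '' Set.Iio 0 = ∅ := by
        rw [Set.image_eq_empty]; ext; simp
      rw [this, Submodule.span_empty]
      exact hgood0
    · exact h.good i h0 (by omega)
  · intro r hr
    rw [Finset.sum_range_succ'] at hr
    have hsum : ∑ i ∈ Finset.range (k + 1), r (i + 1) • y i = 0 := by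
      have hmem : ∑ i ∈ Finset.range (k + 1), r (i + 1) • y i ∈ θ.domain :=
        Submodule.sum_mem _ fun i hi =>
          θ.domain.smul_mem _ (hyd i (by simpa [Nat.lt_succ_iff] using hi))
      have h1 : θ ⟨_, hmem⟩ = 0 := by
        have h2 : (⟨_, hmem⟩ : θ.domain) = ∑ i : Fin (k + 1),
            r (i + 1) • (⟨y i, hyd i (by omega)⟩ : θ.domain) := by
          apply Subtype.ext
          simp [Finset.sum_range]
        rw [h2]
        show θ.toFun _ = 0
        have h3 := congrArg U.mkQ hr
        have h4 : U.mkQ (y' 0) = 0 := hQu0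
        rw [map_add, map_smul, h4, smul_zero, add_zero, map_zero, map_sum, Finset.sum_range] at h3
        rw [map_sum, ← h3]
        refine Finset.sum_congr rfl fun i _ => ?_
        rw [map_smul, map_smul]
        congr 1
        exact (hg i (by omega)).symm
      exact congrArg Subtype.val (hinj _ h1)
    intro i hi hunit
    cases i with
    | zero =>
      apply hau0
      have h1 := congrArg (a • ·) hr
      simp only [smul_add, smul_zero, Finset.smul_sum] at h1
      rw [Finset.sum_eq_zero, zero_add, smul_comm] at h1
      · exact (hunit.smul_eq_zero).1 h1
      · intro i _
        show a • r (i + 1) • g i = 0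
        rw [smul_comm, hag, smul_zero]
    | succ i => exact h.rel (fun i => r (i + 1)) hsum i (by omega) hunit

theorem exists_tower (hHX : HX R) {L : Set R} {i₀ : α} (hmin : ∀ i < i₀, ¬ NS (R := R) L i)
    (k : ℕ) : ∀ (E : Type u) [AddCommGroup E] [Module R E] (U : Submodule R E), Good U →
      NSE U L i₀ → ∃ y : ℕ → E, Tower U L i₀ k y := by
  induction k with
  | zero => exact fun E _ _ U hU h => exists_tower_zero hU h
  | succ k ih =>
    intro E _ _ U hU h
    obtain ⟨f, hf, hgood, E', i1, i2, U', hU', hns, d, hd, hdf⟩ := exists_shift hHX hU h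
    obtain ⟨y, hy⟩ := ih E' U' hU' hns
    exact hy.step (fun i hi hn => hmin i hi ⟨E, _, _, U, hU, hn⟩) hU' hU hf hgood hd hdf

theorem not_ns (hHX : HX R) (L : Set R) (i : α) : ¬ NS (R := R) L i := by
  induction i using WellFoundedLT.induction with
  | ind i ih =>
    rintro ⟨E, i1, i2, U, hU, h⟩
    obtain ⟨n, hn⟩ := hU.rank
    obtain ⟨y, hy⟩ := exists_tower hHX ih n E U hU h
    obtain ⟨a, ha, i, hi, hunit⟩ := hn y
    exact hy.rel a ha i hi hunit

end TowerStep

theorem exists_wellOrder_fam (R : Type u) [CommRing R] :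
    ∃ (α : Type u) (_ : LinearOrder α) (_ : WellFoundedLT α) (i : α),
      ∀ I : Ideal R, Fam i I := by
  classical
  let _ : LinearOrder R := linearOrderOfSTO (WellOrderingRel (α := R))
  have _ : WellFoundedLT R := ⟨(IsWellFounded.wf : WellFounded (WellOrderingRel (α := R)))⟩
  refine ⟨WithTop R, inferInstance, inferInstance, ⊤, fun I =>
    ⟨fun j => WithTop.recTopCoe 0 (fun x => if x ∈ I then x else 0) j, ?_, ?_⟩⟩
  · intro j hj
    induction j with
    | top => exact absurd hj (lt_irrefl _)
    | coe x =>
      show (if x ∈ I then x else 0) ∈ I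
      split_ifs with h
      · exact h
      · exact zero_mem _
  · intro x hx
    refine ⟨(x : WithTop R), WithTop.coe_lt_top x, ?_⟩
    show (if x ∈ I then x else 0) ∣ x
    rw [if_pos hx]

theorem not_nonsp {R : Type u} [CommRing R] [PreValuationRing R] [IsLocalRing R]
    (hHX : HX R) {E : Type u} [AddCommGroup E] [Module R E] {U : Submodule R E} (hU : Good U)
    (e : E) : ¬ Nonsp U e := by
  intro h
  obtain ⟨α, _, _, i, hi⟩ := exists_wellOrder_fam R
  exact not_ns hHX (shp (col U e)) i ⟨E, _, _, U, hU, e, rfl, h, hi _⟩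

end ChainRing

namespace ChainRing

section Special

variable {R : Type u} [CommRing R]
variable {E : Type u} [AddCommGroup E] [Module R E]

/-- Elementwise uniseriality of `V' / V`. -/
def USerQ (V V' : Submodule R E) : Prop :=
  ∀ x ∈ V', ∀ y ∈ V', (∃ c : R, x - c • y ∈ V) ∨ ∃ c : R, y - c • x ∈ V

/-- Every element has a special approximation in `V`. -/
def Sp (V : Submodule R E) : Prop := ∀ e : E, ¬ Nonsp V e

theorem Sp.exists_approx {V : Submodule R E} (h : Sp V) (e : E) :
    ∃ v ∈ V, ∀ b ∈ col V e, ∃ t ∉ shp (col V e), (t * b) • (e - v) = 0 := by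
  have := h e
  unfold Nonsp at this
  push Not at this
  exact this

variable [PreValuationRing R]

/-- The multiples of `a` up to the complement of `shp B`. -/
def saturation (B : Ideal R) (a : R) : Ideal R where
  carrier := {x | ∃ t ∉ shp B, a ∣ t * x}
  zero_mem' := ⟨1, one_notMem_shp, by simp⟩
  add_mem' := by
    rintro x y ⟨t, ht, hx⟩ ⟨s, hs, hy⟩
    refine ⟨t * s, notMem_shp_mul ht hs, ?_⟩
    rw [mul_add, mul_right_comm, mul_assoc t s y]
    exact dvd_add (hx.mul_right s) (hy.mul_left t)
  smul_mem' := by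
    rintro c x ⟨t, ht, hx⟩
    exact ⟨t, ht, by rw [smul_eq_mul, mul_left_comm]; exact hx.mul_left c⟩

theorem shp_saturation [IsLocalRing R] {B : Ideal R} {a : R} (hB : (1 : R) ∉ B) (ha : a ∈ B)
    (ht : ∀ t ∉ shp B, t * a ≠ 0) : shp (saturation B a) = shp B := by
  have h1 : (1 : R) ∉ saturation B a := by
    rintro ⟨t, ht, k, hk⟩
    rw [mul_one] at hk
    exact ht (hk ▸ shp_mul_right (mem_shp_of_mem hB ha) k)
  ext r
  constructor
  · rintro ⟨y, hy, t, ht, hd⟩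
    by_contra hr
    exact hy ⟨t * r, notMem_shp_mul ht hr, by rwa [mul_assoc]⟩
  · intro hr
    rcases dvd_or r a with ⟨y, rfl⟩ | hd
    · refine ⟨y, ?_, 1, one_notMem_shp, by simp⟩
      rintro ⟨t, htB, k, hk⟩
      refine ht _ (notMem_shp_sub htB hr k) ?_
      linear_combination r * hk
    · exact ⟨1, h1, 1, one_notMem_shp, by simpa using hd⟩

theorem Sp.step [IsLocalRing R] (hHX : HX R) {V V' : Submodule R E}
    (hVV' : V ≤ V') (hV' : RDPure V') (hser : USerQ V V') (hSp : Sp V) : Sp V' := by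
  intro e he
  have hB1 : (1 : R) ∉ col V' e := by simpa using he.notMem
  have hlim := he.lim hV'
  obtain ⟨a0, ha0, ha0t⟩ := hlim.exists_forall_ne_zero
  obtain ⟨a1, ha1, ha1t⟩ := hlim a0 ha0
  have hB0 := shp_saturation hB1 ha0 ha0t
  have hmk : ∀ x : E, V.mkQ x = 0 ↔ x ∈ V := fun x => Submodule.Quotient.mk_eq_zero V
  have hser' : USer (V'.map V.mkQ) := by
    rintro _ ⟨x, hx, rfl⟩ _ ⟨y, hy, rfl⟩
    refine (hser x hx y hy).imp ?_ ?_ <;>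
    · rintro ⟨c, hc⟩
      exact ⟨c, by rw [← map_smul, ← sub_eq_zero, ← map_sub, hmk]; exact hc⟩
  obtain ⟨w, -, u, -, hau, h1, h2⟩ := exists_prep (e := V.mkQ e) (B := col V' e)
    (L := shp (col V' e)) hser' one_notMem_shp (by
      intro b hb
      obtain ⟨v, hv, hbv⟩ := hV'.approx hb
      change b • (e - v) = 0 at hbv
      exact ⟨V.mkQ v, ⟨v, hv, rfl⟩, by rw [← map_sub, ← map_smul, hbv, map_zero]⟩) (by
      rintro _ ⟨v', hv', rfl⟩
      by_contra! hcon
      have hcon' : ∀ b ∈ col V' e, ∃ t ∉ shp (col V' e), (t * b) • (e - v') ∈ V := by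
        intro b hb
        obtain ⟨t, ht, h⟩ := hcon b hb
        exact ⟨t, ht, by rwa [← map_sub, ← map_smul, hmk] at h⟩
      obtain ⟨v, hv, hs⟩ := hSp.exists_approx (e - v')
      obtain ⟨b, hb, hbt⟩ := he (v' + v) (V'.add_mem hv' (hVV' hv))
      obtain ⟨t, ht, htb⟩ := hcon' b hb
      obtain ⟨s, hs, h0⟩ := hs _ htb
      have hle : ∀ x ∈ col V (e - v'), x ∈ col V' e := by
        intro x hx
        have := V'.add_mem (hVV' (mem_col.1 hx)) (V'.smul_mem x hv')
        rw [← smul_add, sub_add_cancel] at this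
        exact this
      have hsL : s ∉ shp (col V' e) := by
        rintro ⟨y, hy, hsy⟩
        obtain ⟨t', ht', h'⟩ := hcon' _ hsy
        refine hs ⟨t' * y, fun h => notMem_shp.not.2 ?_ ht', ?_⟩
        · push Not
          exact ⟨y, hle _ h, hy⟩
        · rw [mem_col, mul_left_comm]; exact h'
      refine hbt _ (notMem_shp_mul hsL ht) ?_
      rw [mul_assoc, ← sub_sub]
      exact h0) ha1
  have h1B0 : saturation (col V' e) a0 ≠ ⊤ := by
    rw [Ideal.ne_top_iff_one]
    rintro ⟨t, ht, k, hk⟩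
    rw [mul_one] at hk
    exact ht (hk ▸ shp_mul_right (mem_shp_of_mem hB1 ha0) k)
  obtain ⟨E', _, _, U', hU', d, hdU', hd⟩ := hHX _ h1B0
  obtain ⟨α, _, _, i, hi⟩ := exists_wellOrder_fam R
  have hnse := nse_of_transfer rfl h1 h2 hB0 (by
    rintro x ⟨t, ht, hx⟩
    refine smul_eq_zero_of_dvd ((dvd_or a1 x).resolve_right fun hd => ha1t t ht ?_) hau
    exact hx.trans (mul_dvd_mul_left t hd)) (hi _) hU' hdU' hd
  exact not_ns hHX _ i ⟨E', _, _, U', hU', hnse⟩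

end Special

end ChainRing

namespace ChainRing

section Next

variable {R : Type u} [CommRing R] [PreValuationRing R]
variable {E : Type u} [AddCommGroup E] [Module R E]

/-- The preimage in `E` of the localization of the image of `U` under `s` in `E ⧸ V`. -/
def overSub (U V : Submodule R E) (s : E →ₗ[R] E) (B : Ideal R) : Submodule R E where
  carrier := {e | ∃ r ∉ shp B, ∃ u ∈ U, r • e - s u ∈ V}
  zero_mem' := ⟨1, one_notMem_shp, 0, U.zero_mem, by simp⟩
  add_mem' := by
    rintro e e' ⟨r, hr, u, hu, h⟩ ⟨r', hr', u', hu', h'⟩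
    refine ⟨r * r', notMem_shp_mul hr hr', r' • u + r • u',
      U.add_mem (U.smul_mem _ hu) (U.smul_mem _ hu'), ?_⟩
    have := V.add_mem (V.smul_mem r' h) (V.smul_mem r h')
    convert this using 1
    rw [map_add, map_smul, map_smul]
    module
  smul_mem' := by
    rintro c e ⟨r, hr, u, hu, h⟩
    refine ⟨r, hr, c • u, U.smul_mem _ hu, ?_⟩
    have := V.smul_mem c h
    convert this using 1
    rw [map_smul]
    module

variable {U V : Submodule R E} {s : E →ₗ[R] E} {B : Ideal R}

theorem le_overSub : V ≤ overSub U V s B :=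
  fun v hv => ⟨1, one_notMem_shp, 0, U.zero_mem, by simpa using hv⟩

theorem map_mem_overSub {u : E} (hu : u ∈ U) : s u ∈ overSub U V s B :=
  ⟨1, one_notMem_shp, u, hu, by simp⟩

theorem mem_overSub_of_smul_mem {r : R} (hr : r ∉ shp B) {e : E} (h : r • e ∈ overSub U V s B) :
    e ∈ overSub U V s B := by
  obtain ⟨r', hr', u, hu, h⟩ := h
  exact ⟨r' * r, notMem_shp_mul hr' hr, u, hu, by rwa [mul_smul]⟩

theorem userQ_overSub (hU : USer U) (hinj : ∀ r ∉ shp B, ∀ e : E, r • e ∈ V → e ∈ V) :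
    USerQ V (overSub U V s B) := by
  have key : ∀ x y : E, ∀ r ∉ shp B, ∀ r' ∉ shp B, ∀ (u : E) (c : R), r • x - s (c • u) ∈ V →
      r' • y - s u ∈ V → (∃ k : R, x - k • y ∈ V) ∨ ∃ k : R, y - k • x ∈ V := by
    intro x y r hr r' hr' u c h h'
    have h2 : r • x - (c * r') • y ∈ V := by
      have := V.sub_mem h (V.smul_mem c h')
      convert this using 1
      rw [map_smul]
      module
    rcases dvd_or r (c * r') with ⟨k, hk⟩ | ⟨k, hk⟩
    · refine Or.inl ⟨k, hinj r hr _ ?_⟩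
      rwa [smul_sub, smul_smul, ← hk]
    · refine Or.inr ⟨k, hinj (c * r') (fun h => hr (hk ▸ shp_mul_right h k)) _ ?_⟩
      rw [← neg_mem_iff, smul_sub, smul_smul, ← hk, neg_sub]
      exact h2
  rintro x ⟨r, hr, u, hu, h⟩ y ⟨r', hr', u', hu', h'⟩
  rcases hU u hu u' hu' with ⟨c, rfl⟩ | ⟨c, rfl⟩
  · exact key x y r hr r' hr' u' c h h'
  · exact (key y x r' hr' r hr u c h' h).symm

theorem exists_sub_smul_mem_of_notMem_shp (hU : Good U) (hUV : U ≤ V) (hV : RDPure V)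
    (hinj : ∀ r ∉ shp B, ∀ e : E, r • e ∈ V → e ∈ V) {r : R} (hr : r ∉ shp B) (e : E) :
    ∃ e' : E, e - r • e' ∈ V := by
  by_cases he : e ∈ V
  · exact ⟨0, by simpa using he⟩
  obtain ⟨x, hx, hx0⟩ := hU.ess e (fun h => he (h ▸ V.zero_mem))
  rcases dvd_or x r with hd | ⟨c, rfl⟩
  · exact absurd (hinj r hr e (smul_mem_of_dvd hd (hUV hx))) he
  · refine exists_sub_smul_mem hU.inj hV (c := c) (fun h => hx0 ?_) (hinj r hr _ ?_)
    · rw [mul_comm, h, zero_smul]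
    · rw [← mul_smul]; exact hUV hx

theorem rdPure_overSub (hU : Good U) (hUV : U ≤ V) (hV : RDPure V)
    (hinj : ∀ r ∉ shp B, ∀ e : E, r • e ∈ V → e ∈ V)
    (hs : ∀ u ∈ U, s u ∉ V → ∀ x : R, x • s u ∈ V → ∃ t ∉ shp B, (t * x) • u = 0) :
    RDPure (overSub U V s B) := by
  intro t e he
  suffices h : ∃ e' ∈ overSub U V s B, t • (e - e') ∈ V by
    obtain ⟨e', he', h⟩ := h
    obtain ⟨v, hv, h⟩ := hV _ _ h
    refine ⟨e' + v, Submodule.add_mem _ he' (le_overSub hv), ?_⟩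
    rw [smul_add, ← h]
    module
  obtain ⟨r, hr, u, hu, h⟩ := he
  by_cases hsu : s u ∈ V
  · refine ⟨0, Submodule.zero_mem _, ?_⟩
    rw [sub_zero]
    exact hinj r hr _ (by simpa using V.add_mem h hsu)
  have htre : t • r • e ∉ V := by
    intro h'
    apply hsu
    rw [smul_comm] at h
    simpa using V.sub_mem h' h
  obtain ⟨x, hx, hx0⟩ := hU.ess (r • e) (fun h => htre (by rw [h, smul_zero]; exact V.zero_mem))
  obtain ⟨y, rfl⟩ := (dvd_or t x).resolve_right fun hd => htre (smul_mem_of_dvd hd (hUV hx))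
  have hy : y • s u ∈ V := by
    have := V.sub_mem (hUV hx) (V.smul_mem y h)
    convert this using 1
    module
  obtain ⟨t', ht', h0⟩ := hs u hu hsu y hy
  obtain ⟨e1, he1⟩ := exists_smul_eq hU.inj t (t' • u) (by
    intro z hz
    have hd : y ∣ z := by
      refine (dvd_or y z).resolve_right ?_
      rintro ⟨k, rfl⟩
      apply hx0
      rw [show t * (z * k) = k * (z * t) by ring, hz, mul_zero, zero_smul]
    rw [smul_smul, mul_comm]
    exact smul_eq_zero_of_dvd (mul_dvd_mul_left t' hd) h0)
  obtain ⟨u', hu', htu⟩ := hU.pure t e1 (by rw [he1]; exact U.smul_mem _ hu)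
  obtain ⟨e', he'⟩ := exists_sub_smul_mem_of_notMem_shp hU hUV hV hinj
    (notMem_shp_mul hr ht') (s u')
  refine ⟨e', ⟨r * t', notMem_shp_mul hr ht', u', hu', ?_⟩,
    hinj _ (notMem_shp_mul hr ht') _ ?_⟩
  · rw [← neg_mem_iff, neg_sub]; exact he'
  · have h1 : t' • s u = t • s u' := by rw [← map_smul, ← map_smul, ← htu, he1]
    have := V.add_mem (V.smul_mem t' h) (V.smul_mem t he')
    rw [smul_sub, h1, smul_sub] at this
    convert this using 1
    module

theorem exists_dvd_all (p : ℕ → R) (n : ℕ) : ∃ j ≤ n, ∀ i ≤ n, p j ∣ p i := by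
  induction n with
  | zero => exact ⟨0, le_rfl, fun i hi => by rw [Nat.le_zero.1 hi]⟩
  | succ n ih =>
    obtain ⟨j, hj, h⟩ := ih
    rcases dvd_or (p j) (p (n + 1)) with hd | hd
    · refine ⟨j, by omega, fun i hi => ?_⟩
      rcases Nat.of_le_succ hi with hi | rfl
      · exact h i hi
      · exact hd
    · refine ⟨n + 1, le_rfl, fun i hi => ?_⟩
      rcases Nat.of_le_succ hi with hi | rfl
      · exact hd.trans (h i hi)
      · exact dvd_rfl

theorem relRankLE_overSub [IsLocalRing R] {n : ℕ} (hU : Good U) (hUV : U ≤ V)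
    (hV' : RDPure (overSub U V s B))
    (hinj : ∀ r ∉ shp B, ∀ e : E, r • e ∈ V → e ∈ V)
    (hs : ∀ u ∈ U, s u ∉ V → ∀ x : R, x • s u ∈ V → ∃ t ∉ shp B, (t * x) • u = 0)
    {u : E} (hu : u ∈ U) (hsu : s u ∉ V) (hrank : RelRankLE R (E ⧸ V) (n + 1)) :
    RelRankLE R (E ⧸ overSub U V s B) n := by
  set V' := overSub U V s B with hV'def
  intro m
  choose e he using fun i => V'.mkQ_surjective (m i)
  have hrel : ∀ (w : E) (e : ℕ → E), ∃ (a0 : R) (a : ℕ → R),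
      a0 • w + ∑ i ∈ Finset.range (n + 1), a i • e i ∈ V ∧
      (IsUnit a0 ∨ ∃ i ≤ n, IsUnit (a i)) := by
    intro w e
    obtain ⟨a, ha, i, hi, hunit⟩ := hrank (fun i => Nat.casesOn i (V.mkQ w) fun i => V.mkQ (e i))
    refine ⟨a 0, fun i => a (i + 1), ?_, ?_⟩
    · rw [Finset.sum_range_succ'] at ha
      rw [← Submodule.Quotient.mk_eq_zero, ← Submodule.mkQ_apply, map_add, map_sum, ← ha, add_comm]
      simp
    · cases i with
      | zero => exact Or.inl hunit
      | succ i => exact Or.inr ⟨i, by omega, hunit⟩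
  have hgoal : ∀ a : ℕ → R, ∑ i ∈ Finset.range (n + 1), a i • e i ∈ V' →
      ∑ i ∈ Finset.range (n + 1), a i • m i = 0 := by
    intro a h
    rw [← Submodule.Quotient.mk_eq_zero, ← Submodule.mkQ_apply, map_sum] at h
    simpa [he] using h
  by_cases hA : ∃ u0 ∈ U, s u0 ∉ V ∧ ∀ u' ∈ U, ∃ r ∉ shp B, ∃ c : R, r • u' = c • u0
  · obtain ⟨u0, hu0, hsu0, hA⟩ := hA
    obtain ⟨a0, a, ha, hunit⟩ := hrel (s u0) e
    have hw : s u0 ∈ V' := map_mem_overSub hu0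
    have hsum : ∑ i ∈ Finset.range (n + 1), a i • e i ∈ V' := by
      have := V'.sub_mem (le_overSub ha) (V'.smul_mem a0 hw)
      simpa using this
    by_cases hex : ∃ i ≤ n, IsUnit (a i)
    · exact ⟨a, hgoal a hsum, hex⟩
    have ha0 := hunit.resolve_right hex
    obtain ⟨j, hj, hdvd⟩ := exists_dvd_all a n
    have hq : ∀ i, ∃ q : R, (i ≤ n → a i = a j * q) ∧ (i = j → q = 1) := by
      intro i
      by_cases hij : i = j
      · exact ⟨1, fun _ => by rw [hij, mul_one], fun _ => rfl⟩
      · by_cases hi : i ≤ n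
        · obtain ⟨q, hq⟩ := hdvd i hi
          exact ⟨q, fun _ => hq, fun h => absurd h hij⟩
        · exact ⟨0, fun h => absurd h hi, fun h => absurd h hij⟩
    choose q hq hqj using hq
    have hfac : ∑ i ∈ Finset.range (n + 1), a i • e i =
        a j • ∑ i ∈ Finset.range (n + 1), q i • e i := by
      rw [Finset.smul_sum]
      refine Finset.sum_congr rfl fun i hi => ?_
      rw [smul_smul, ← hq i (by simpa [Nat.lt_succ_iff] using hi)]
    by_cases hajL : a j ∈ shp B
    · exfalso
      rw [hfac] at hsum ha
      obtain ⟨x, hx, hax⟩ := hV' _ _ hsum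
      rw [hax] at ha
      obtain ⟨r', hr', u', hu', hx⟩ := hx
      obtain ⟨r, hr, c, hrc⟩ := hA u' hu'
      obtain ⟨v, rfl⟩ := ha0
      have hfin : r * r' - (-(↑v⁻¹ : R) * c) * a j ∉ shp B :=
        notMem_shp_sub (notMem_shp_mul hr hr') hajL _
      apply hsu0
      refine hinj _ hfin _ ?_
      have e1 : r • s u' = c • s u0 := by rw [← map_smul, hrc, map_smul]
      have h1 := V.smul_mem ((↑v⁻¹ : R) * (r * r')) ha
      have h2 := V.smul_mem ((↑v⁻¹ : R) * a j * r) hx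
      have h3 := V.sub_mem h1 h2
      convert h3 using 1
      have e2 : (↑v⁻¹ : R) * (v : R) = 1 := by simp
      have e3 : ((↑v⁻¹ : R) * a j * r) • (r' • x - s u') =
          ((↑v⁻¹ : R) * a j * r * r') • x - ((↑v⁻¹ : R) * a j * c) • s u0 := by
        rw [smul_sub, mul_smul _ r (s u'), e1]
        module
      have e4 : ((↑v⁻¹ : R) * (r * r')) • ((v : R) • s u0 + a j • x) =
          (r * r') • s u0 + ((↑v⁻¹ : R) * a j * r * r') • x := by
        rw [smul_add, smul_smul, smul_smul]
        congr 1
        · congr 1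
          linear_combination (r * r') * e2
        · congr 1
          ring
      rw [e3, e4]
      module
    · refine ⟨q, hgoal q (mem_overSub_of_smul_mem hajL (hfac ▸ hsum)), j, hj, ?_⟩
      rw [hqj j rfl]
      exact isUnit_one
  · push Not at hA
    obtain ⟨a, u0, hu0, hau0, -, hv⟩ := hU.exists_common_approx (b := 0) hu
      (fun h => hsu (by rw [h, map_zero]; exact V.zero_mem)) (zero_smul _ _) e (n + 1)
      (fun i _ => zero_smul _ _)
    obtain ⟨u1, hu1, hau1, hsu1⟩ : ∃ u1 ∈ U, a • u1 ≠ 0 ∧ s u1 ∉ V := by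
      by_cases h0 : s u0 ∈ V
      · refine ⟨u, hu, fun h => ?_, hsu⟩
        rcases hU.ser u hu u0 hu0 with ⟨c, hc⟩ | ⟨c, hc⟩
        · exact hsu (by rw [hc, map_smul]; exact V.smul_mem c h0)
        · exact hau0 (by rw [hc, smul_comm, h, smul_zero])
      · exact ⟨u0, hu0, hau0, h0⟩
    obtain ⟨u', hu', hA⟩ := hA u1 hu1 hsu1
    obtain ⟨c, hc⟩ : ∃ c : R, u1 = c • u' := by
      refine (hU.ser u1 hu1 u' hu').resolve_right ?_
      rintro ⟨c, hc⟩
      exact hA 1 one_notMem_shp c (by rw [one_smul, hc])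
    have hcL : c ∈ shp B := by
      by_contra h
      exact hA c h 1 (by rw [one_smul, hc])
    have hasu : a • s u' ∉ V := by
      intro h
      obtain ⟨t, ht, h0⟩ := hs u' hu'
        (fun h' => hsu1 (by rw [hc, map_smul]; exact V.smul_mem c h')) a h
      rcases dvd_or t c with ⟨k, rfl⟩ | ⟨k, rfl⟩
      · apply hau1
        rw [hc, smul_smul, show a * (t * k) = k * (t * a) by ring, mul_smul, h0, smul_zero]
      · exact ht (shp_mul_right hcL k)
    have hg : ∀ i, ∃ g : E, i ≤ n → e i - g ∈ U ∧ a • g = 0 := by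
      intro i
      by_cases hi : i ≤ n
      · obtain ⟨v, hv, h⟩ := hv i (by omega)
        exact ⟨e i - v, fun _ => ⟨by simpa using hv, h⟩⟩
      · exact ⟨0, fun h => absurd h hi⟩
    choose g hg using hg
    obtain ⟨a0, r, hr, hunit⟩ := hrel (s u') g
    have hag : a • ∑ i ∈ Finset.range (n + 1), r i • g i = 0 := by
      rw [Finset.smul_sum]
      refine Finset.sum_eq_zero fun i hi => ?_
      rw [smul_comm, (hg i (by simpa [Nat.lt_succ_iff] using hi)).2, smul_zero]
    refine ⟨r, hgoal r ?_, hunit.resolve_left ?_⟩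
    · have h1 : ∑ i ∈ Finset.range (n + 1), r i • g i ∈ V' := by
        have := V'.sub_mem (le_overSub hr) (V'.smul_mem a0 (map_mem_overSub hu'))
        simpa using this
      have h2 : ∑ i ∈ Finset.range (n + 1), r i • (e i - g i) ∈ V' :=
        V'.sum_mem fun i hi => V'.smul_mem _ (le_overSub (hUV
          (hg i (by simpa [Nat.lt_succ_iff] using hi)).1))
      have := V'.add_mem h1 h2
      rw [← Finset.sum_add_distrib] at this
      convert this using 1
      refine Finset.sum_congr rfl fun i _ => ?_
      module
    · intro h0
      apply hasu
      have := V.smul_mem a hr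
      rw [smul_add, hag, add_zero, smul_comm] at this
      obtain ⟨v, rfl⟩ := h0
      simpa [smul_smul] using V.smul_mem (↑v⁻¹ : R) this

theorem exists_next [IsLocalRing R] (hHX : HX R) {n : ℕ} (hU : Good U) (hUV : U ≤ V)
    (hV : RDPure V) (hSp : Sp V) (hne : V ≠ ⊤) (hrank : RelRankLE R (E ⧸ V) (n + 1)) :
    ∃ V' : Submodule R E, V < V' ∧ RDPure V' ∧ USerQ V V' ∧ Sp V' ∧ RelRankLE R (E ⧸ V') n := by
  have hmk : ∀ x : E, V.mkQ x = 0 ↔ x ∈ V := fun x => Submodule.Quotient.mk_eq_zero V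
  let L : Set R := {r | ∃ e : E, e ∉ V ∧ r • e ∈ V}
  have hL : ∀ e : E, shp (col V e) ⊆ L := by
    rintro e r ⟨y, hy, hr⟩
    exact ⟨y • e, hy, by rw [← mul_smul]; exact hr⟩
  obtain ⟨e0, he0⟩ : ∃ e, e ∉ V := by
    by_contra! h
    exact hne (eq_top_iff.2 fun x _ => h x)
  obtain ⟨r, ⟨e, he, hre⟩, hr⟩ := exists_mem_forall_notMem_shp hrank
    (show L.Nonempty from ⟨0, e0, he0, by simp⟩)
  have hcol : col ⊥ (V.mkQ e) = col V e := by
    ext x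
    rw [mem_col, Submodule.mem_bot, ← map_smul, hmk, mem_col]
  have hshp : shp (col V e) = L := by
    have := hr (V.mkQ e) (by rwa [Ne, hmk]) (by rw [hcol]; exact hL e)
    rw [hcol] at this
    exact (hL e).antisymm (this.resolve_right (not_not.2 ⟨1, by simpa using he, by simpa using hre⟩))
  have hinj : ∀ r ∉ shp (col V e), ∀ x : E, r • x ∈ V → x ∈ V := by
    intro r hr x hx
    by_contra h
    exact hr (hshp ▸ ⟨x, h, hx⟩)
  obtain ⟨v, hv, hspec⟩ := hSp.exists_approx e
  have hev : e - v ∉ V := fun h => he (by simpa using V.add_mem h hv)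
  have hspec' : ∀ b : R, b • (e - v) ∈ V → ∃ t ∉ shp (col V e), (t * b) • (e - v) = 0 := by
    intro b hb
    refine hspec b ?_
    rw [mem_col]
    have := V.add_mem hb (V.smul_mem b hv)
    rwa [← smul_add, sub_add_cancel] at this
  obtain ⟨u, hu, hann⟩ := hU.exists_ann_eq (x := e - v) (fun h => hev (h ▸ V.zero_mem))
  obtain ⟨s, hsu⟩ := exists_map_eq hU.inj u (e - v) (fun r => (hann r).1)
  have hs : ∀ u' ∈ U, s u' ∉ V → ∀ x : R, x • s u' ∈ V →
      ∃ t ∉ shp (col V e), (t * x) • u' = 0 := by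
    intro u' hu' hsu' x hx
    rcases hU.ser u' hu' u hu with ⟨r, rfl⟩ | ⟨r, hr⟩
    · rw [map_smul, hsu, smul_smul] at hx
      obtain ⟨t, ht, h⟩ := hspec' _ hx
      exact ⟨t, ht, by rw [smul_smul, mul_assoc, hann]; exact h⟩
    · have hev' : e - v = r • s u' := by rw [← hsu, hr, map_smul]
      obtain ⟨k, rfl⟩ := (dvd_or r x).resolve_right fun hd =>
        hev (hev' ▸ smul_mem_of_dvd hd hx)
      rw [mul_comm, mul_smul, ← hev'] at hx
      obtain ⟨t, ht, h⟩ := hspec' _ hx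
      refine ⟨t, ht, ?_⟩
      rw [show t * (r * k) = t * k * r by ring, mul_smul, ← hr, hann]
      exact h
  have hpure := rdPure_overSub hU hUV hV hinj hs
  have hser := userQ_overSub (s := s) hU.ser hinj
  have hsu' : s u ∉ V := by rwa [hsu]
  exact ⟨_, lt_of_le_of_ne le_overSub fun h => hsu' (h ▸ map_mem_overSub hu), hpure, hser,
    hSp.step hHX le_overSub hpure hser, relRankLE_overSub hU hUV hpure hinj hs hu hsu' hrank⟩

end Next

end ChainRing

namespace ChainRing

section Purity

open TensorProduct

variable {R : Type u} [CommRing R] {M : Type v} [AddCommGroup M] [Module R M]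

theorem exists_mem_dvd_all [PreValuationRing R] {ι : Type*} (s : Finset ι) (hs : s.Nonempty)
    (p : ι → R) : ∃ i ∈ s, ∀ j ∈ s, p i ∣ p j := by
  induction hs using Finset.Nonempty.cons_induction with
  | singleton a => exact ⟨a, by simp, by simp⟩
  | cons a s ha hs ih =>
    obtain ⟨i, hi, h⟩ := ih
    rcases dvd_or (p a) (p i) with hd | hd
    · refine ⟨a, by simp, fun j hj => ?_⟩
      rcases Finset.mem_cons.1 hj with rfl | hj
      · exact dvd_rfl
      · exact hd.trans (h j hj)
    · refine ⟨i, by simp [hi], fun j hj => ?_⟩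
      rcases Finset.mem_cons.1 hj with rfl | hj
      · exact hd
      · exact h j hj

/-- Over a chain ring, finite linear systems with right-hand side in a relatively divisible
submodule are solvable there as soon as they are solvable in the whole module. -/
theorem RDPure.exists_solution [PreValuationRing R] {A : Submodule R M} (hA : RDPure A)
    {ι κ : Type*} [DecidableEq κ] (t : Finset ι) :
    ∀ (n : ℕ) (s : Finset κ), s.card = n → ∀ (α : ι → κ → R) (y : κ → M),
      (∀ i ∈ t, ∑ j ∈ s, α i j • y j ∈ A) →
      ∃ y' : κ → A, ∀ i ∈ t, ∑ j ∈ s, α i j • (y' j : M) = ∑ j ∈ s, α i j • y j := by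
  intro n
  induction n with
  | zero =>
    intro s hs α y _
    obtain rfl := Finset.card_eq_zero.1 hs
    exact ⟨fun _ => 0, by simp⟩
  | succ n ih =>
    intro s hs α y h
    rcases t.eq_empty_or_nonempty with rfl | ht
    · exact ⟨fun _ => 0, by simp⟩
    have hsn : s.Nonempty := Finset.card_pos.1 (by omega)
    obtain ⟨⟨i₀, j₀⟩, hm, hd⟩ := exists_mem_dvd_all (t ×ˢ s) (ht.product hsn)
      (fun q : ι × κ => α q.1 q.2)
    obtain ⟨hi₀, hj₀⟩ := Finset.mem_product.1 hm
    have hd' : ∀ i j, ∃ b, i ∈ t → j ∈ s → α i j = α i₀ j₀ * b := by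
      intro i j
      by_cases hij : i ∈ t ∧ j ∈ s
      · obtain ⟨b, hb⟩ := hd (i, j) (Finset.mem_product.2 hij)
        exact ⟨b, fun _ _ => hb⟩
      · exact ⟨0, fun h1 h2 => absurd ⟨h1, h2⟩ hij⟩
    choose β hβ using hd'
    have hsplit : ∀ f : κ → M, ∑ j ∈ s, f j = f j₀ + ∑ j ∈ s.erase j₀, f j := fun f =>
      (Finset.add_sum_erase s f hj₀).symm
    have hrow : ∀ i ∈ t, ∀ f : κ → M, ∑ j ∈ s, α i j • f j =
        β i j₀ • ∑ j ∈ s, α i₀ j • f j +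
          ∑ j ∈ s.erase j₀, (α i j - β i j₀ * α i₀ j) • f j := by
      intro i hi f
      rw [hsplit, hsplit (fun j => α i₀ j • f j), smul_add, Finset.smul_sum, add_assoc,
        ← Finset.sum_add_distrib]
      congr 1
      · rw [hβ i j₀ hi hj₀, ← mul_smul, mul_comm]
      · refine Finset.sum_congr rfl fun j _ => ?_
        rw [← mul_smul, ← add_smul]
        congr 1; ring
    obtain ⟨y', hy'⟩ := ih (s.erase j₀) (by rw [Finset.card_erase_of_mem hj₀, hs]; rfl)
      (fun i j => α i j - β i j₀ * α i₀ j) y (by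
        intro i hi
        have h1 := h i hi
        rw [hrow i hi] at h1
        exact (A.add_mem_iff_right (A.smul_mem _ (h i₀ hi₀))).1 h1)
    have hpiv : ∑ j ∈ s, α i₀ j • y j =
        α i₀ j₀ • (y j₀ + ∑ j ∈ s.erase j₀, β i₀ j • y j) := by
      rw [hsplit, smul_add, Finset.smul_sum]
      congr 1
      refine Finset.sum_congr rfl fun j hj => ?_
      rw [hβ i₀ j hi₀ (Finset.mem_of_mem_erase hj), mul_smul]
    obtain ⟨z, hz, hzz⟩ := hA _ _ (hpiv ▸ h i₀ hi₀)
    let y'' : κ → A := Function.update y' j₀ (⟨z, hz⟩ - ∑ j ∈ s.erase j₀, β i₀ j • y' j)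
    have hy''0 : (y'' j₀ : M) = z - ∑ j ∈ s.erase j₀, β i₀ j • (y' j : M) := by
      simp [y'']
    have hy'' : ∀ j ∈ s.erase j₀, y'' j = y' j := fun j hj => by
      simp [y'', Finset.ne_of_mem_erase hj]
    have h0 : ∑ j ∈ s, α i₀ j • (y'' j : M) = ∑ j ∈ s, α i₀ j • y j := by
      rw [hpiv, hzz, hsplit, hy''0, smul_sub, Finset.smul_sum, sub_add,
        sub_eq_self, sub_eq_zero]
      refine Finset.sum_congr rfl fun j hj => ?_
      rw [hy'' j hj, ← mul_smul, ← hβ i₀ j hi₀ (Finset.mem_of_mem_erase hj)]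
    refine ⟨y'', fun i hi => ?_⟩
    rw [hrow i hi, hrow i hi, h0, ← hy' i hi]
    congr 1
    exact Finset.sum_congr rfl fun j hj => by rw [hy'' j hj]

theorem RDPure.rTensor_injective [PreValuationRing R] {A : Submodule R M} (hA : RDPure A)
    (C : Type*) [AddCommGroup C] [Module R C] :
    Function.Injective (LinearMap.rTensor C A.subtype) := by
  classical
  rw [injective_iff_map_eq_zero]
  intro t ht
  let G : (C →₀ R) →ₗ[R] C := Finsupp.linearCombination R id
  have hG : Function.Surjective G := Finsupp.linearCombination_id_surjective R C
  obtain ⟨t₀, rfl⟩ := LinearMap.lTensor_surjective A hG t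
  have hker : LinearMap.lTensor M G (LinearMap.rTensor (C →₀ R) A.subtype t₀) = 0 := by
    rw [← ht, ← LinearMap.comp_apply, ← LinearMap.comp_apply, LinearMap.lTensor_comp_rTensor,
      LinearMap.rTensor_comp_lTensor]
  have hex : Function.Exact (LinearMap.ker G).subtype G := G.exact_subtype_ker_map
  obtain ⟨w, hw⟩ := (lTensor_exact (M := LinearMap.ker G) M hex hG _).1 hker
  obtain ⟨k, m, n, rfl⟩ := exists_sum_tmul_eq w
  set f := finsuppScalarRight R R A C t₀ with hf
  have hcoe : ∀ c, finsuppScalarRight R R M C (LinearMap.rTensor (C →₀ R) A.subtype t₀) c =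
      (f c : M) := by
    intro c
    rw [hf]
    clear ht hker hw hf f
    induction t₀ with
    | zero => simp
    | tmul x y => simp [finsuppScalarRight_apply_tmul_apply]
    | add x y hx hy => simp [hx, hy]
  have hrow : ∀ c, ∑ j, (n j : C →₀ R) c • m j = (f c : M) := by
    intro c
    rw [← hcoe, ← hw]
    simp [finsuppScalarRight_apply_tmul_apply]
  let S : Finset C := f.support ∪ Finset.univ.biUnion fun j => (n j : C →₀ R).support
  obtain ⟨y, hy⟩ := hA.exists_solution S _ Finset.univ rfl (fun c j => (n j : C →₀ R) c) m
    (fun c _ => by rw [hrow]; exact (f c).2)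
  have hrow' : ∀ c, ∑ j, (n j : C →₀ R) c • y j = f c := by
    intro c
    by_cases hc : c ∈ S
    · apply Subtype.ext
      rw [← hrow, ← hy c hc]
      simp
    · simp only [S, Finset.mem_union, Finset.mem_biUnion, Finset.mem_univ, true_and, not_or,
        not_exists, Finsupp.notMem_support_iff] at hc
      rw [hc.1]
      exact Finset.sum_eq_zero fun j _ => by rw [hc.2 j, zero_smul]
  have ht₀ : t₀ = LinearMap.lTensor A (LinearMap.ker G).subtype (∑ j, y j ⊗ₜ[R] n j) := by
    apply (finsuppScalarRight R R A C).injective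
    ext c
    rw [← hf, ← hrow' c]
    simp [finsuppScalarRight_apply_tmul_apply]
  rw [ht₀]
  exact (lTensor_exact (M := LinearMap.ker G) A hex hG).apply_apply_eq_zero _

theorem isPureSubmodule_of_rdPure [PreValuationRing R] {A : Submodule R M} (hA : RDPure A) :
    IsPureSubmodule R A := fun C _ _ => hA.rTensor_injective C

theorem rdPure_of_isPureSubmodule {E : Type u} [AddCommGroup E] [Module R E] {A : Submodule R E}
    (hA : IsPureSubmodule R A) : RDPure A := by
  intro r e h
  have h0 : (⟨r • e, h⟩ : A) ⊗ₜ[R] (Ideal.Quotient.mk (Ideal.span {r}) 1) = 0 := by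
    apply hA (R ⧸ Ideal.span {r})
    rw [map_zero, LinearMap.rTensor_tmul, Submodule.subtype_apply, smul_tmul,
      ← Ideal.Quotient.mk_eq_mk, ← Submodule.Quotient.mk_smul,
      (Submodule.Quotient.mk_eq_zero _).2 (Ideal.mem_span_singleton'.2 ⟨1, by simp⟩), tmul_zero]
  have h1 := congrArg (tensorQuotEquivQuotSMul A (Ideal.span {r})) h0
  rw [tensorQuotEquivQuotSMul_tmul_mk, map_zero, one_smul, Submodule.Quotient.mk_eq_zero,
    Submodule.ideal_span_singleton_smul, Submodule.mem_smul_pointwise_iff_exists] at h1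
  obtain ⟨v, -, hv⟩ := h1
  exact ⟨v, v.2, by rw [← Submodule.coe_smul, hv]⟩

end Purity

end ChainRing

namespace ChainRing

section Series

variable {R : Type u} [CommRing R] [PreValuationRing R] [IsLocalRing R]
variable {E : Type u} [AddCommGroup E] [Module R E]

theorem eq_top_of_relRankLE_zero {V : Submodule R E} (h : RelRankLE R (E ⧸ V) 0) : V = ⊤ := by
  rw [eq_top_iff]
  intro x _
  obtain ⟨a, ha, i, hi, hu⟩ := h (fun _ => V.mkQ x)
  obtain rfl : i = 0 := by omega
  rw [zero_add, Finset.sum_range_one] at ha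
  rw [← Submodule.Quotient.mk_eq_zero V]
  exact hu.smul_eq_zero.1 ha

theorem exists_chain (hHX : HX R) {U : Submodule R E} (hU : Good U) (n : ℕ) :
    ∀ V : Submodule R E, U ≤ V → RDPure V → Sp V → RelRankLE R (E ⧸ V) n →
      ∃ (k : ℕ) (F : Fin (k + 1) → Submodule R E), F 0 = V ∧ F (Fin.last k) = ⊤ ∧
        (∀ i : Fin k, F i.castSucc < F i.succ ∧ USerQ (F i.castSucc) (F i.succ)) ∧
        ∀ i, RDPure (F i) := by
  induction n with
  | zero =>
    intro V _ hV _ hr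
    exact ⟨0, fun _ => V, rfl, eq_top_of_relRankLE_zero hr, fun i => i.elim0, fun _ => hV⟩
  | succ n ih =>
    intro V hUV hV hSp hr
    by_cases hne : V = ⊤
    · exact ⟨0, fun _ => V, rfl, hne, fun i => i.elim0, fun _ => hV⟩
    obtain ⟨V', hlt, hp, hq, hs, hr'⟩ := exists_next hHX hU hUV hV hSp hne hr
    obtain ⟨k, F, h0, hl, hF, hpu⟩ := ih V' (hUV.trans hlt.le) hp hs hr'
    refine ⟨k + 1, Fin.cons V F, rfl, ?_, fun i => ?_, fun i => ?_⟩
    · rw [← Fin.succ_last, Fin.cons_succ, hl]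
    · refine Fin.cases ?_ (fun i => ?_) i
      · simp only [Fin.castSucc_zero, Fin.cons_zero, Fin.cons_succ, h0]
        exact ⟨hlt, hq⟩
      · rw [Fin.castSucc_succ, Fin.cons_succ, Fin.cons_succ]
        exact hF i
    · refine Fin.cases ?_ (fun i => ?_) i
      · exact hV
      · exact hpu i

theorem USerQ.isUniserialModule {V V' : Submodule R E} (h : USerQ V V') :
    IsUniserialModule R (V' ⧸ V.comap V'.subtype) := by
  have key : ∀ x y : V' ⧸ V.comap V'.subtype, (∃ c : R, x = c • y) ∨ ∃ c : R, y = c • x := by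
    intro x y
    obtain ⟨x, rfl⟩ := Submodule.mkQ_surjective _ x
    obtain ⟨y, rfl⟩ := Submodule.mkQ_surjective _ y
    rcases h x x.2 y y.2 with ⟨c, hc⟩ | ⟨c, hc⟩
    · exact .inl ⟨c, by
        rw [← map_smul, ← sub_eq_zero, ← map_sub, Submodule.mkQ_apply,
          Submodule.Quotient.mk_eq_zero]
        exact hc⟩
    · exact .inr ⟨c, by
        rw [← map_smul, ← sub_eq_zero, ← map_sub, Submodule.mkQ_apply,
          Submodule.Quotient.mk_eq_zero]
        exact hc⟩
  intro A B
  by_contra! hcon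
  obtain ⟨x, hxA, hxB⟩ := Set.not_subset.1 hcon.1
  obtain ⟨y, hyB, hyA⟩ := Set.not_subset.1 hcon.2
  rcases key x y with ⟨c, rfl⟩ | ⟨c, rfl⟩
  · exact hxB (B.smul_mem c hyB)
  · exact hyA (A.smul_mem c hxA)

theorem Good.isPolyserial (hHX : HX R) {U : Submodule R E} (hU : Good U) : IsPolyserial R E := by
  obtain ⟨n, hn⟩ := hU.rank
  obtain ⟨k, F, h0, hl, hF, hp⟩ := exists_chain hHX hU n U le_rfl hU.pure
    (fun e => not_nonsp hHX hU e) (hn.of_surjective U.mkQ U.mkQ_surjective)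
  have hbot : RDPure (⊥ : Submodule R E) := fun r e h =>
    ⟨0, Submodule.zero_mem _, by rw [smul_zero]; exact (Submodule.mem_bot R).1 h⟩
  have hUbot : ⊥ < U := by
    obtain ⟨u, hu, hu0⟩ := hU.ne
    exact bot_lt_iff_ne_bot.2 fun h => hu0 ((Submodule.mem_bot R).1 (h ▸ hu))
  have hstep : ∀ i : Fin (k + 1), (Fin.cons ⊥ F : Fin (k + 2) → Submodule R E) i.castSucc <
      (Fin.cons ⊥ F : Fin (k + 2) → Submodule R E) i.succ ∧
      USerQ ((Fin.cons ⊥ F : Fin (k + 2) → Submodule R E) i.castSucc)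
        ((Fin.cons ⊥ F : Fin (k + 2) → Submodule R E) i.succ) := by
    intro i
    refine Fin.cases ?_ (fun i => ?_) i
    · simp only [Fin.castSucc_zero, Fin.cons_zero, Fin.cons_succ, h0]
      refine ⟨hUbot, fun x hx y hy => ?_⟩
      rcases hU.ser x hx y hy with ⟨c, hc⟩ | ⟨c, hc⟩
      · exact .inl ⟨c, by simp [hc]⟩
      · exact .inr ⟨c, by simp [hc]⟩
    · rw [Fin.castSucc_succ, Fin.cons_succ, Fin.cons_succ]
      exact hF i
  refine ⟨k + 1, Fin.cons ⊥ F, rfl, ?_, Fin.strictMono_iff_lt_succ.2 fun i => (hstep i).1,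
    fun i => ?_, fun i => (hstep i).2.isUniserialModule⟩
  · rw [← Fin.succ_last, Fin.cons_succ, hl]
  · refine Fin.cases ?_ (fun i => ?_) i
    · exact isPureSubmodule_of_rdPure hbot
    · exact isPureSubmodule_of_rdPure (hp i)

end Series

section Rank

variable {R : Type u} [CommRing R] {M : Type v} [AddCommGroup M] [Module R M]

theorem isPolyserial_malcevRankLE (h : IsPolyserial R M) : ∃ n, MalcevRankLE R M n := by
  classical
  obtain ⟨n, F, h0, hl, hmono, -, hser⟩ := h
  have key : ∀ i : Fin (n + 1), ∀ X : Submodule R M, X.FG → X ≤ F i →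
      ∃ s : Finset M, (s : Set M) ⊆ X ∧ s.card ≤ i ∧ Submodule.span R (s : Set M) = X := by
    intro i
    induction i using Fin.induction with
    | zero =>
      intro X _ hX
      rw [h0, le_bot_iff] at hX
      exact ⟨∅, by simp, by simp, by simp [hX]⟩
    | succ i ih =>
      intro X hX hXF
      obtain ⟨t, rfl⟩ := hX
      let Q := F i.succ ⧸ (F i.castSucc).comap (F i.succ).subtype
      -- some generator dominates all the others modulo the previous term
      have hdom : ∀ s : Finset M, (s : Set M) ⊆ F i.succ →
          s = ∅ ∨ ∃ x ∈ s, ∀ y ∈ s, ∃ c : R, y - c • x ∈ F i.castSucc := by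
        intro s
        induction s using Finset.induction with
        | empty => exact fun _ => .inl rfl
        | insert a s ha ihs =>
          intro hs
          rw [Finset.coe_insert, Set.insert_subset_iff] at hs
          right
          rcases ihs hs.2 with rfl | ⟨x, hx, hxs⟩
          · exact ⟨a, by simp, fun y hy => ⟨1, by
              obtain rfl : y = a := by simpa using hy
              simp⟩⟩
          have hcmp : ∀ p q : F i.succ,
              Submodule.span R {Submodule.Quotient.mk (p := (F i.castSucc).comap (F i.succ).subtype) p} ≤
                Submodule.span R {Submodule.Quotient.mk q} → ∃ c : R, (p : M) - c • q ∈ F i.castSucc := by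
            intro p q hpq
            obtain ⟨c, hc⟩ := Submodule.mem_span_singleton.1
              (hpq (Submodule.mem_span_singleton_self _))
            refine ⟨c, ?_⟩
            rw [← Submodule.Quotient.mk_smul, eq_comm, Submodule.Quotient.eq] at hc
            exact hc
          rcases hser i (Submodule.span R {Submodule.Quotient.mk ⟨a, hs.1⟩})
            (Submodule.span R {Submodule.Quotient.mk ⟨x, hs.2 hx⟩}) with hle | hle
          · refine ⟨x, by simp [hx], fun y hy => ?_⟩
            rcases Finset.mem_insert.1 hy with rfl | hy
            · exact hcmp _ _ hle
            · exact hxs y hy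
          · obtain ⟨d, hd⟩ := hcmp _ _ hle
            refine ⟨a, by simp, fun y hy => ?_⟩
            rcases Finset.mem_insert.1 hy with rfl | hy
            · exact ⟨1, by simp⟩
            · obtain ⟨c, hc⟩ := hxs y hy
              refine ⟨c * d, ?_⟩
              have := (F i.castSucc).add_mem hc ((F i.castSucc).smul_mem c hd)
              convert this using 1
              rw [mul_smul]; simp only [smul_sub]; abel
      have hts : (t : Set M) ⊆ F i.succ := fun x hx => hXF (Submodule.subset_span hx)
      rcases hdom t hts with rfl | ⟨x, hx, hxt⟩
      · exact ⟨∅, by simp, by simp, by simp⟩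
      choose! c hc using hxt
      set Y := Submodule.span R ((t.image fun y => y - c y • x : Finset M) : Set M) with hY
      have hxX : x ∈ Submodule.span R (t : Set M) := Submodule.subset_span hx
      have hYX : Y ≤ Submodule.span R (t : Set M) := by
        rw [hY, Submodule.span_le]
        intro z hz
        obtain ⟨y, hy, rfl⟩ := Finset.mem_image.1 hz
        exact Submodule.sub_mem _ (Submodule.subset_span hy) (Submodule.smul_mem _ _ hxX)
      obtain ⟨s, hsY, hcard, hspan⟩ := ih Y ⟨_, rfl⟩ (by
        rw [hY, Submodule.span_le]
        intro z hz
        obtain ⟨y, hy, rfl⟩ := Finset.mem_image.1 hz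
        exact hc y hy)
      have hsub : ((insert x s : Finset M) : Set M) ⊆ Submodule.span R (t : Set M) := by
        rw [Finset.coe_insert, Set.insert_subset_iff]
        exact ⟨hxX, fun z hz => hYX (hsY hz)⟩
      refine ⟨insert x s, hsub, ?_, le_antisymm (Submodule.span_le.2 hsub) ?_⟩
      · have := Finset.card_insert_le x s
        simp only [Fin.val_castSucc, Fin.val_succ] at *
        omega
      · rw [Submodule.span_le]
        intro y hy
        have hxm : x ∈ Submodule.span R ((insert x s : Finset M) : Set M) :=
          Submodule.subset_span (by simp)
        have hle : Y ≤ Submodule.span R ((insert x s : Finset M) : Set M) := by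
          rw [← hspan]; exact Submodule.span_mono (by simp)
        have h1 : y - c y • x ∈ Y := Submodule.subset_span (Finset.mem_image_of_mem _ hy)
        have := Submodule.add_mem _ (hle h1) (Submodule.smul_mem _ (c y) hxm)
        rwa [sub_add_cancel] at this
  exact ⟨n, fun X hX => by simpa using key (Fin.last n) X hX (by rw [hl]; exact le_top)⟩

theorem MalcevRankLE.relRankLE [IsLocalRing R] {n : ℕ} (h : MalcevRankLE R M n) :
    RelRankLE R M n := by
  intro y
  let y' : Fin (n + 1) → M := fun i => y i
  obtain ⟨s, hsX, hcard, hspan⟩ := h (Submodule.span R (Set.range y'))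
    (Submodule.fg_span (Set.finite_range y'))
  have hD : ∀ z ∈ s, ∃ D : Fin (n + 1) → R, ∑ k, D k • y' k = z := fun z hz =>
    (Submodule.mem_span_range_iff_exists_fun R).1 (hsX hz)
  have hC : ∀ i, ∃ C : M → R, ∑ z ∈ s, C z • z = y' i := by
    intro i
    have hi : y' i ∈ Submodule.span R (s : Set M) := by
      rw [hspan]; exact Submodule.subset_span ⟨i, rfl⟩
    obtain ⟨f, -, hf⟩ := Submodule.mem_span_finset.1 hi
    exact ⟨f, hf⟩
  choose! D hD using hD
  choose C hC using hC
  let k := IsLocalRing.ResidueField R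
  let L : (Fin (n + 1) → k) →ₗ[k] (s → k) :=
    Matrix.vecMulLinear (fun i (z : s) => IsLocalRing.residue R (C i z))
  have hker : LinearMap.ker L ≠ ⊥ := by
    apply LinearMap.ker_ne_bot_of_finrank_lt
    simp only [Module.finrank_fintype_fun_eq_card, Fintype.card_coe, Fintype.card_fin]
    omega
  obtain ⟨b, hb, hb0⟩ := Submodule.exists_mem_ne_zero_of_ne_bot hker
  choose a ha using fun i => IsLocalRing.residue_surjective (b i)
  have hm : ∀ z ∈ s, ∑ i, a i * C i z ∈ IsLocalRing.maximalIdeal R := by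
    intro z hz
    rw [← IsLocalRing.residue_eq_zero_iff, map_sum]
    have : ∑ i, b i * IsLocalRing.residue R (C i z) = 0 :=
      congrFun (LinearMap.mem_ker.1 hb) ⟨z, hz⟩
    simpa only [map_mul, ha] using this
  let d : Fin (n + 1) → R := fun l => a l - ∑ z ∈ s, (∑ i, a i * C i z) * D z l
  have hd : ∑ l, d l • y' l = 0 := by
    simp only [d, sub_smul, Finset.sum_sub_distrib, Finset.sum_smul, sub_eq_zero]
    rw [Finset.sum_comm]
    calc ∑ l, a l • y' l = ∑ l, ∑ z ∈ s, (a l * C l z) • z :=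
          Finset.sum_congr rfl fun l _ => by
            rw [← hC l, Finset.smul_sum]
            simp only [mul_smul]
      _ = ∑ z ∈ s, (∑ i, a i * C i z) • z := by
          rw [Finset.sum_comm]
          simp only [Finset.sum_smul]
      _ = _ := Finset.sum_congr rfl fun z hz => by
          rw [← congrArg ((∑ i, a i * C i z) • ·) (hD z hz)]
          simp only [Finset.smul_sum, mul_smul]
  obtain ⟨i, hi⟩ := Function.ne_iff.1 hb0
  have hunit : IsUnit (d i) := by
    by_contra hn
    have h1 : d i ∈ IsLocalRing.maximalIdeal R := hn
    have h2 : a i ∈ IsLocalRing.maximalIdeal R :=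
      ((IsLocalRing.maximalIdeal R).sub_mem_iff_left
        (sum_mem fun z hz => Ideal.mul_mem_right _ _ (hm z hz))).1 h1
    rw [← IsLocalRing.residue_eq_zero_iff, ha] at h2
    exact hi h2
  refine ⟨fun j => if hj : j < n + 1 then d ⟨j, hj⟩ else 0, ?_, i, by omega, ?_⟩
  · rw [Finset.sum_range]
    simpa only [Fin.is_lt, dif_pos] using hd
  · simpa only [Fin.is_lt, dif_pos] using hunit

end Rank

end ChainRing

namespace ChainRing

section Hull

variable {R : Type u} [CommRing R] {Q : Type u} [AddCommGroup Q] [Module R Q]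

/-- Every nonzero element of `E` has a nonzero multiple in `A`. -/
def EssIn (A E : Submodule R Q) : Prop := ∀ x ∈ E, x ≠ 0 → ∃ c : R, c • x ∈ A ∧ c • x ≠ 0

theorem injective_of_retraction (hQ : Module.Injective R Q) (E : Submodule R Q)
    (g : Q →ₗ[R] E) (hg : ∀ e : E, g e = e) : Module.Injective R E where
  out X Y _ _ _ _ f hf h := by
    obtain ⟨k, hk⟩ := hQ.out f hf (E.subtype ∘ₗ h)
    exact ⟨g ∘ₗ k, fun x => by simp [hk, hg]⟩

theorem exists_hull (hQ : Module.Injective R Q) (A : Submodule R Q) :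
    ∃ E : Submodule R Q, A ≤ E ∧ EssIn A E ∧ Module.Injective R E ∧ ∃ K, IsCompl E K := by
  obtain ⟨E, -, hE⟩ := zorn_le_nonempty₀ {E : Submodule R Q | A ≤ E ∧ EssIn A E} (by
    intro c hc hchain y hy
    refine ⟨sSup c, ⟨(hc hy).1.trans (le_sSup hy), ?_⟩, fun z hz => le_sSup hz⟩
    intro x hx hx0
    obtain ⟨E, hE, hxE⟩ := (Submodule.mem_sSup_of_directed ⟨y, hy⟩ hchain.directedOn).1 hx
    exact (hc hE).2 x hxE hx0) A ⟨le_rfl, fun x hx hx0 => ⟨1, by simpa using hx, by simpa using hx0⟩⟩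
  obtain ⟨K, -, hK⟩ := zorn_le_nonempty₀ {K : Submodule R Q | Disjoint E K} (by
    intro c hc hchain y hy
    refine ⟨sSup c, ?_, fun z hz => le_sSup hz⟩
    exact hchain.directedOn.disjoint_sSup_right.2 hc) ⊥ disjoint_bot_right
  have hEK : Disjoint E K := hK.prop
  obtain ⟨hAE, hess⟩ := hE.prop
  obtain ⟨h, hh⟩ := hQ.out (K.mkQ ∘ₗ E.subtype) (by
    rw [← LinearMap.ker_eq_bot, LinearMap.ker_comp, Submodule.ker_mkQ, eq_bot_iff]
    exact fun e he => Subtype.ext (Submodule.disjoint_def.1 hEK _ e.2 he)) E.subtype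
  let g : Q →ₗ[R] Q := h ∘ₗ K.mkQ
  have hgE : ∀ e ∈ E, g e = e := fun e he => hh ⟨e, he⟩
  have hgK : ∀ k ∈ K, g k = 0 := fun k hk => by
    simp [g, (Submodule.Quotient.mk_eq_zero K).2 hk]
  have hrange : LinearMap.range g ≤ E := by
    refine hE.le_of_ge ⟨hAE.trans fun a ha => ⟨a, hgE a ha⟩, ?_⟩ fun e he => ⟨e, hgE e he⟩
    rintro _ ⟨x, rfl⟩ hx0
    have hxK : x ∉ K := fun hxK => hx0 (hgK x hxK)
    have hnd : ¬ Disjoint E (K ⊔ Submodule.span R {x}) := fun hd =>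
      hxK (hK.le_of_ge hd le_sup_left
        (Submodule.mem_sup_right (Submodule.mem_span_singleton_self x)))
    rw [Submodule.disjoint_def] at hnd
    push Not at hnd
    obtain ⟨e, heE, hes, he0⟩ := hnd
    obtain ⟨k, hk, z, hz, rfl⟩ := Submodule.mem_sup.1 hes
    obtain ⟨c, rfl⟩ := Submodule.mem_span_singleton.1 hz
    have hc : c • g x = k + c • x := by
      rw [← hgE _ heE, map_add, hgK k hk, zero_add, map_smul]
    obtain ⟨d, hd, hd0⟩ := hess _ heE he0
    exact ⟨d * c, by rw [mul_smul, hc]; exact hd, by rw [mul_smul, hc]; exact hd0⟩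
  let p : Q →ₗ[R] E := g.codRestrict E fun x => hrange ⟨x, rfl⟩
  have hp : ∀ e : E, p e = e := fun e => Subtype.ext (hgE e e.2)
  exact ⟨E, hAE, hess, injective_of_retraction hQ E p hp, _, LinearMap.isCompl_of_proj hp⟩

theorem essIn_top_of_isIndecomposable (hQ : Module.Injective R Q) (hind : IsIndecomposable R Q)
    {A : Submodule R Q} (hA : A ≠ ⊥) : EssIn A ⊤ := by
  obtain ⟨E, hAE, hess, -, K, hK⟩ := exists_hull hQ A
  have hE : E ≠ ⊥ := fun h => hA (le_bot_iff.1 (h ▸ hAE))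
  have hKbot : K = ⊥ := by
    by_contra hne
    exact hind.2 ⟨E, K, hE, hne, hK⟩
  rw [hKbot] at hK
  have hEtop : E = ⊤ := by simpa using hK.sup_eq_top
  rwa [hEtop] at hess

theorem good_of_isIndecomposable (hQ : Module.Injective R Q) (hind : IsIndecomposable R Q)
    (hrank : ∃ n, RelRankLE R Q n) {U : Submodule R Q} (hU : U ≠ ⊥) (hp : IsPureSubmodule R U)
    (hser : ∀ A B : Submodule R Q, A ≤ U → B ≤ U → A ≤ B ∨ B ≤ A) : Good U where
  inj := hQ
  ne := Submodule.exists_mem_ne_zero_of_ne_bot hU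
  ess x hx := essIn_top_of_isIndecomposable hQ hind hU x trivial hx
  pure := rdPure_of_isPureSubmodule hp
  ser x hx y hy := by
    simpa only [Submodule.span_singleton_le_iff_mem, Submodule.mem_span_singleton, eq_comm] using
      hser (Submodule.span R {x}) (Submodule.span R {y}) (by simpa) (by simpa)
  rank := hrank

theorem exists_injective_embedding (M : Type u) [AddCommGroup M] [Module R M] :
    ∃ (Q : Type u) (_ : AddCommGroup Q) (_ : Module R Q) (f : M →ₗ[R] Q),
      Module.Injective R Q ∧ Function.Injective f := by
  let J := CategoryTheory.Injective.under (ModuleCat.of R M)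
  refine ⟨J, inferInstance, inferInstance,
    (CategoryTheory.Injective.ι (ModuleCat.of R M)).hom, ?_, ?_⟩
  · have hJ : CategoryTheory.Injective (ModuleCat.of R J) :=
      inferInstanceAs (CategoryTheory.Injective J)
    exact Module.injective_module_of_injective_object R J
  · exact (ModuleCat.mono_iff_injective _).1 inferInstance

/-- A nontrivial cyclic module over a chain ring embeds into an indecomposable injective module. -/
theorem exists_indecomposable_hull [PreValuationRing R] {I : Ideal R} (hI : I ≠ ⊤) :
    ∃ (E : Type u) (_ : AddCommGroup E) (_ : Module R E) (w : E),
      Module.Injective R E ∧ IsIndecomposable R E ∧ w ≠ 0 ∧ ∀ r : R, r • w = 0 ↔ r ∈ I := by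
  obtain ⟨Q, _, _, f, hQ, hf⟩ := exists_injective_embedding (R := R) (R ⧸ I)
  obtain ⟨E, hAE, hess, hE, -⟩ := exists_hull hQ (LinearMap.range f)
  let w : E := ⟨f (Ideal.Quotient.mk I 1), hAE ⟨_, rfl⟩⟩
  have hw : ∀ r : R, r • w = 0 ↔ r ∈ I := by
    intro r
    rw [← Ideal.Quotient.eq_zero_iff_mem, ← map_eq_zero_iff f hf, Subtype.ext_iff]
    have : Ideal.Quotient.mk I r = r • Ideal.Quotient.mk I 1 := by
      rw [← Ideal.Quotient.mk_eq_mk, ← Ideal.Quotient.mk_eq_mk, ← Submodule.Quotient.mk_smul,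
        smul_eq_mul, mul_one]
    rw [this, map_smul]
    rfl
  have hw0 : w ≠ 0 := fun h => hI ((Ideal.eq_top_iff_one I).2 ((hw 1).1 (by simpa using h)))
  have hmul : ∀ x : E, x ≠ 0 → ∃ c r : R, c • x = r • w ∧ c • x ≠ 0 := by
    intro x hx
    obtain ⟨c, ⟨m, hm⟩, hc0⟩ := hess x x.2 (by simpa using hx)
    obtain ⟨r, rfl⟩ := Ideal.Quotient.mk_surjective m
    refine ⟨c, r, Subtype.ext ?_, fun h => hc0 (congrArg Subtype.val h)⟩
    have : Ideal.Quotient.mk I r = r • Ideal.Quotient.mk I 1 := by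
      rw [← Ideal.Quotient.mk_eq_mk, ← Ideal.Quotient.mk_eq_mk, ← Submodule.Quotient.mk_smul,
        smul_eq_mul, mul_one]
    rw [this, map_smul] at hm
    exact hm.symm
  refine ⟨E, inferInstance, inferInstance, w, hE, ⟨⟨w, hw0⟩, ?_⟩, hw0, hw⟩
  rintro ⟨A, B, hA, hB, hAB⟩
  obtain ⟨a, haA, ha0⟩ := Submodule.exists_mem_ne_zero_of_ne_bot hA
  obtain ⟨b, hbB, hb0⟩ := Submodule.exists_mem_ne_zero_of_ne_bot hB
  obtain ⟨c, r, hcr, hc0⟩ := hmul a ha0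
  obtain ⟨d, s, hds, hd0⟩ := hmul b hb0
  rcases dvd_or r s with ⟨t, rfl⟩ | ⟨t, rfl⟩
  · refine hd0 (Submodule.disjoint_def.1 hAB.disjoint _ ?_ (B.smul_mem d hbB))
    rw [hds, mul_comm, mul_smul, ← hcr]
    exact A.smul_mem _ (A.smul_mem _ haA)
  · refine hc0 (Submodule.disjoint_def.1 hAB.disjoint _ (A.smul_mem c haA) ?_)
    rw [hcr, mul_comm, mul_smul, ← hds]
    exact B.smul_mem _ (B.smul_mem _ hbB)

end Hull

end ChainRing

/-- over a chain ring in which every indecomposable injective module contains a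
nonzero pure uniserial submodule, all indecomposable injective modules have finite Malcev rank
iff all indecomposable injective modules are polyserial. -/
theorem stmt9 (R : Type u) [CommRing R] [IsLocalRing R]
    (hchain : ∀ I J : Ideal R, I ≤ J ∨ J ≤ I)
    (hpu : ∀ (E : Type u) [AddCommGroup E] [Module R E],
      Module.Injective R E → IsIndecomposable R E →
      ∃ U : Submodule R E, U ≠ ⊥ ∧ IsPureSubmodule R U ∧
        ∀ A B : Submodule R E, A ≤ U → B ≤ U → A ≤ B ∨ B ≤ A) :
    (∀ (E : Type u) [AddCommGroup E] [Module R E],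
      Module.Injective R E → IsIndecomposable R E → ∃ k : ℕ, MalcevRankLE R E k) ↔
    (∀ (E : Type u) [AddCommGroup E] [Module R E],
      Module.Injective R E → IsIndecomposable R E → IsPolyserial R E) := by
  have hval : PreValuationRing R := PreValuationRing.iff_ideal_total.2 ⟨hchain⟩
  refine ⟨fun hM => ?_, fun hP E _ _ hE hind => ChainRing.isPolyserial_malcevRankLE (hP E hE hind)⟩
  have hgood : ∀ (E : Type u) [AddCommGroup E] [Module R E], Module.Injective R E →
      IsIndecomposable R E → ∃ U : Submodule R E, ChainRing.Good U := by
    intro E _ _ hE hind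
    obtain ⟨U, hU, hp, hser⟩ := hpu E hE hind
    obtain ⟨n, hn⟩ := hM E hE hind
    exact ⟨U, ChainRing.good_of_isIndecomposable hE hind ⟨n, ChainRing.MalcevRankLE.relRankLE hn⟩ hU hp hser⟩
  have hHX : ChainRing.HX R := by
    intro I hI
    obtain ⟨E, _, _, w, hE, hind, hw0, hw⟩ := ChainRing.exists_indecomposable_hull hI
    obtain ⟨U, hU⟩ := hgood E hE hind
    obtain ⟨d, hd, hdw⟩ := hU.exists_ann_eq hw0
    exact ⟨E, inferInstance, inferInstance, U, hU, d, hd, fun r => (hdw r).trans (hw r)⟩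
  intro E _ _ hE hind
  obtain ⟨U, hU⟩ := hgood E hE hind
  exact hU.isPolyserial hHX
end

section
/- Let R be an Archimedean chain ring with maximal ideal P. If there exists a nonzero injective R-module E with E_♯ = P and finite Malcev rank, then R is almost maximal. -/
open DirectSum


universe u v

namespace ArchimedeanChainRing

open IsLocalRing

section ChainRing

variable {R : Type u} [CommRing R]

theorem dvd_total_of_chain (hchain : ∀ I J : Ideal R, I ≤ J ∨ J ≤ I) (a b : R) :
    a ∣ b ∨ b ∣ a := by
  rcases hchain (Ideal.span {b}) (Ideal.span {a}) with h | h
  · exact Or.inl (Ideal.span_singleton_le_span_singleton.1 h)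
  · exact Or.inr (Ideal.span_singleton_le_span_singleton.1 h)

theorem dvd_of_mem_of_notMem (hdvd : ∀ a b : R, a ∣ b ∨ b ∣ a) {I : Ideal R} {x y : R}
    (hx : x ∉ I) (hy : y ∈ I) : x ∣ y :=
  (hdvd x y).resolve_right fun h => hx (I.mem_of_dvd h hy)

/-- In a chain ring every element of a product of two ideals is a product. -/
theorem exists_eq_mul_of_mem_mul (hdvd : ∀ a b : R, a ∣ b ∨ b ∣ a) {I J : Ideal R} {c : R}
    (hc : c ∈ I * J) : ∃ x ∈ I, ∃ y ∈ J, c = x * y := by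
  induction hc using Submodule.mul_induction_on' with
  | mem_mul_mem x hx y hy => exact ⟨x, hx, y, hy, rfl⟩
  | add a _ b _ iha ihb =>
    rcases hdvd a b with ⟨w, rfl⟩ | ⟨w, rfl⟩
    · obtain ⟨x, hx, y, hy, rfl⟩ := iha
      exact ⟨x, hx, y * (1 + w), J.mul_mem_right _ hy, by ring⟩
    · obtain ⟨x, hx, y, hy, rfl⟩ := ihb
      exact ⟨x, hx, y * (1 + w), J.mul_mem_right _ hy, by ring⟩

/-- Nested sequences of congruences modulo ideals containing `b` are solvable. -/
def NestedSolvable (b : R) : Prop :=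
  ∀ (a : ℕ → R) (A : ℕ → Ideal R), Antitone A → (∀ n, b ∈ A n) →
    (∀ n, a (n + 1) - a n ∈ A n) → ∃ x, ∀ n, x - a n ∈ A n

theorem sub_mem_of_le {a : ℕ → R} {A : ℕ → Ideal R} (hA : Antitone A)
    (ha : ∀ n, a (n + 1) - a n ∈ A n) {m n : ℕ} (hmn : m ≤ n) : a n - a m ∈ A m := by
  induction n, hmn using Nat.le_induction with
  | base => simp
  | succ n hmn ih =>
    have := (A m).add_mem (hA hmn (ha n)) ih
    simpa using this

theorem NestedSolvable.of_dvd {b c : R} (hb : NestedSolvable b) (hcb : c ∣ b) :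
    NestedSolvable c := fun a A hA hc ha =>
  hb a A hA (fun n => (A n).mem_of_dvd hcb (hc n)) ha

theorem NestedSolvable.mul (hdvd : ∀ a b : R, a ∣ b ∨ b ∣ a) {b c : R} (hb : NestedSolvable b)
    (hc : NestedSolvable c) : NestedSolvable (b * c) := by
  intro a A hA hbc ha
  obtain ⟨x, hx⟩ := hb a (fun n => A n ⊔ Ideal.span {b}) (fun m n h => sup_le_sup_right (hA h) _)
    (fun n => Ideal.mem_sup_right (Ideal.mem_span_singleton_self b))
    (fun n => Ideal.mem_sup_left (ha n))
  by_cases hall : ∀ n, b ∈ A n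
  · refine ⟨x, fun n => ?_⟩
    have h := hx n
    rwa [sup_eq_left.2 ((Ideal.span_singleton_le_iff_mem _).2 (hall n))] at h
  push Not at hall
  obtain ⟨N, hN⟩ := hall
  have hd : ∀ n, ∃ d, x - a (N + n) = b * d := by
    intro n
    have hle : A (N + n) ≤ Ideal.span {b} := fun y hy => Ideal.mem_span_singleton.2
      (dvd_of_mem_of_notMem hdvd hN (hA (Nat.le_add_right N n) hy))
    have h := hx (N + n)
    rw [sup_eq_right.2 hle] at h
    exact Ideal.mem_span_singleton.1 h
  choose d hd using hd
  obtain ⟨e, he⟩ := hc d (fun n => Submodule.comap (LinearMap.mulLeft R b) (A (N + n)))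
    (fun m n h y hy => hA (Nat.add_le_add_left h N) hy)
    (fun n => hbc (N + n))
    (fun n => by
      have h := (A (N + n)).neg_mem (ha (N + n))
      have h2 : -(a (N + n + 1) - a (N + n)) = b * (d (n + 1) - d n) := by
        rw [mul_sub, ← hd, ← hd, add_assoc]; ring
      rw [h2] at h
      exact h)
  have hlarge : ∀ n, x - b * e - a (N + n) ∈ A (N + n) := by
    intro n
    have h := (A (N + n)).neg_mem (show b * (e - d n) ∈ A (N + n) from he n)
    have h2 : -(b * (e - d n)) = x - b * e - a (N + n) := by
      rw [mul_sub, ← hd]; ring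
    rwa [h2] at h
  refine ⟨x - b * e, fun n => ?_⟩
  have h := (A n).add_mem (hA (Nat.le_add_left n N) (hlarge n))
    (sub_mem_of_le hA ha (Nat.le_add_left n N))
  simpa using h

theorem NestedSolvable.pow (hdvd : ∀ a b : R, a ∣ b ∨ b ∣ a) {b : R} (hb : NestedSolvable b)
    (n : ℕ) : NestedSolvable (b ^ n) := by
  induction n with
  | zero =>
    intro a A hA h1 ha
    refine ⟨0, fun n => ?_⟩
    have htop : A n = ⊤ := (Ideal.eq_top_iff_one _).2 (by simpa using h1 n)
    exact htop ▸ Submodule.mem_top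
  | succ n ih => rw [pow_succ]; exact ih.mul hdvd hb
variable [IsLocalRing R]

theorem exists_mem_maximalIdeal_eq_mul (hdvd : ∀ a b : R, a ∣ b ∨ b ∣ a) {I : Ideal R} {x y : R}
    (hx : x ∉ I) (hy : y ∈ I) : ∃ u ∈ maximalIdeal R, y = x * u := by
  obtain ⟨u, rfl⟩ := dvd_of_mem_of_notMem hdvd hx hy
  refine ⟨u, ?_, rfl⟩
  rw [mem_maximalIdeal, mem_nonunits_iff]
  exact fun hu => hx ((I.mul_unit_mem_iff_mem hu).1 hy)

theorem eq_zero_of_eq_mul {c u : R} (hu : u ∈ maximalIdeal R) (h : c = c * u) : c = 0 := by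
  have h1 : IsUnit (1 - u) := isUnit_one_sub_self_of_mem_nonunits u hu
  have h2 : c * (1 - u) = 0 := by rw [mul_sub, mul_one, ← h, sub_self]
  exact h1.mul_left_eq_zero.1 h2

theorem exists_dvd_pow (harch : ∀ L : Ideal R, L.IsPrime → L ≠ ⊥ → L = maximalIdeal R)
    {b c : R} (hb : b ∈ maximalIdeal R) (hc : c ≠ 0) : ∃ m : ℕ, c ∣ b ^ m := by
  have h : b ∈ (Ideal.span {c}).radical := by
    rw [Ideal.radical_eq_sInf, Submodule.mem_sInf]
    rintro L ⟨hL, hLp⟩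
    rw [harch L hLp fun h0 => hc (by simpa [h0] using hL)]
    exact hb
  obtain ⟨m, hm⟩ := h
  exact ⟨m, Ideal.mem_span_singleton.1 hm⟩

theorem exists_not_pow_dvd (harch : ∀ L : Ideal R, L.IsPrime → L ≠ ⊥ → L = maximalIdeal R)
    {p c : R} (hp : p ∈ maximalIdeal R) (hc : c ≠ 0) : ∃ n : ℕ, ¬ p ^ n ∣ c := by
  obtain ⟨m, w, hw⟩ := exists_dvd_pow harch hp hc
  refine ⟨m + 1, ?_⟩
  rintro ⟨z, hz⟩
  refine hc (eq_zero_of_eq_mul (u := p * (w * z)) (Ideal.mul_mem_right _ _ hp) ?_)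
  calc c = p ^ (m + 1) * z := hz
    _ = p ^ m * p * z := by ring
    _ = c * (p * (w * z)) := by rw [hw]; ring

/-- A form of Nakayama's lemma for arbitrary nonzero ideals: `p J ≠ J`. -/
theorem exists_mem_forall_dvd_mul (hdvd : ∀ a b : R, a ∣ b ∨ b ∣ a)
    (harch : ∀ L : Ideal R, L.IsPrime → L ≠ ⊥ → L = maximalIdeal R)
    {J : Ideal R} (hJ : J ≠ ⊥) {p : R} (hp : p ∈ maximalIdeal R) :
    ∃ j ∈ J, ∀ x ∈ J, j ∣ p * x := by
  by_contra! hcon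
  have key : ∀ n : ℕ, ∀ j ∈ J, p ^ n ∣ j := by
    intro n
    induction n with
    | zero => intro j _; simp
    | succ n ih =>
      intro j hj
      obtain ⟨x, hx, hjx⟩ := hcon j hj
      have h1 : p * x ∣ j := (hdvd j (p * x)).resolve_left hjx
      rw [pow_succ']
      exact (mul_dvd_mul_left p (ih x hx)).trans h1
  obtain ⟨x, hx, hx0⟩ := J.ne_bot_iff.1 hJ
  obtain ⟨n, hn⟩ := exists_not_pow_dvd harch hp hx0
  exact hn (key n x hx)

theorem exists_pow_dvd_of_idempotent (hdvd : ∀ a b : R, a ∣ b ∨ b ∣ a)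
    (hP : maximalIdeal R * maximalIdeal R = maximalIdeal R) {c : R} (hc : c ∈ maximalIdeal R)
    (n : ℕ) : ∃ t ∈ maximalIdeal R, t ^ (n + 1) ∣ c := by
  induction n generalizing c with
  | zero => exact ⟨c, hc, by simp⟩
  | succ n ih =>
    rw [← hP] at hc
    obtain ⟨x, hx, y, hy, rfl⟩ := exists_eq_mul_of_mem_mul hdvd hc
    obtain ⟨t, ht, htx⟩ := ih hx
    rcases hdvd t y with h | h
    · exact ⟨t, ht, by rw [pow_succ]; exact mul_dvd_mul htx h⟩
    · refine ⟨y, hy, ?_⟩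
      rw [pow_succ]
      exact mul_dvd_mul ((pow_dvd_pow_of_dvd h _).trans htx) dvd_rfl

theorem maximalIdeal_eq_span_of_notMem (hdvd : ∀ a b : R, a ∣ b ∨ b ∣ a) {p : R}
    (hp2 : p ∉ maximalIdeal R * maximalIdeal R) {x : R} (hx : x ∈ maximalIdeal R) : p ∣ x := by
  rcases hdvd p x with h | ⟨w, rfl⟩
  · exact h
  · by_cases hw : w ∈ maximalIdeal R
    · exact absurd (Ideal.mul_mem_mul hx hw) hp2
    · rw [mem_maximalIdeal, mem_nonunits_iff, not_not] at hw
      exact hw.mul_right_dvd.2 dvd_rfl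

theorem exists_seq_generating_maximalIdeal (hdvd : ∀ a b : R, a ∣ b ∨ b ∣ a)
    (harch : maximalIdeal R ≠ ⊥ ∧
      ∀ L : Ideal R, L.IsPrime → L ≠ ⊥ → L = maximalIdeal R) :
    ∃ t : ℕ → R, (∀ n, t n ∈ maximalIdeal R) ∧ ∀ p ∈ maximalIdeal R, ∃ n, t n ∣ p := by
  by_cases hP : maximalIdeal R * maximalIdeal R = maximalIdeal R
  · obtain ⟨c, hc, hc0⟩ := (maximalIdeal R).ne_bot_iff.1 harch.1
    choose t ht htc using exists_pow_dvd_of_idempotent hdvd hP hc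
    refine ⟨t, ht, fun p hp => ?_⟩
    obtain ⟨n, hn⟩ := exists_not_pow_dvd harch.2 hp hc0
    refine ⟨n, (hdvd _ _).resolve_right fun h => hn ?_⟩
    exact (pow_dvd_pow p n.le_succ).trans ((pow_dvd_pow_of_dvd h _).trans (htc n))
  · obtain ⟨p, hp, hp2⟩ := SetLike.exists_of_lt (lt_of_le_of_ne Ideal.mul_le_left hP)
    exact ⟨fun _ => p, fun _ => hp, fun x hx => ⟨0, maximalIdeal_eq_span_of_notMem hdvd hp2 hx⟩⟩

theorem NestedSolvable.of_mem_maximalIdeal (hdvd : ∀ a b : R, a ∣ b ∨ b ∣ a)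
    (harch : ∀ L : Ideal R, L.IsPrime → L ≠ ⊥ → L = maximalIdeal R)
    {b c : R} (hbP : b ∈ maximalIdeal R) (hb : NestedSolvable b) (hc : c ≠ 0) :
    NestedSolvable c := by
  obtain ⟨m, hm⟩ := exists_dvd_pow harch hbP hc
  exact (hb.pow hdvd m).of_dvd hm

theorem exists_mul_notMem_of_lt_of_lt (hdvd : ∀ a b : R, a ∣ b ∨ b ∣ a) {I J K : Ideal R}
    (hIJ : I < J) (hJK : J < K) : ∃ p ∈ maximalIdeal R, ∃ d ∈ K, p * d ∉ I := by
  obtain ⟨x, hxK, hxJ⟩ := SetLike.exists_of_lt hJK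
  obtain ⟨y, hyJ, hyI⟩ := SetLike.exists_of_lt hIJ
  obtain ⟨u, hu, rfl⟩ := exists_mem_maximalIdeal_eq_mul hdvd hxJ hyJ
  exact ⟨u, hu, x, hxK, by rwa [mul_comm]⟩

/-- To solve nested sequences of congruences it is enough to treat those in which the ideals
drop by a definite amount at each step. -/
theorem nestedSolvable_of_strict (hdvd : ∀ a b : R, a ∣ b ∨ b ∣ a) {b : R}
    (h : ∀ (a : ℕ → R) (A : ℕ → Ideal R), Antitone A → (∀ n, b ∈ A n) →
      (∀ n, a (n + 1) - a n ∈ A n) →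
      (∀ n, ∃ p ∈ maximalIdeal R, ∃ d ∈ A n, p * d ∉ A (n + 1)) → ∃ x, ∀ n, x - a n ∈ A n) :
    NestedSolvable b := by
  intro a A hA hb ha
  by_cases hstat : ∃ N, ∀ n, N ≤ n → A N ≤ A n
  · obtain ⟨N, hN⟩ := hstat
    refine ⟨a N, fun n => ?_⟩
    rcases le_total n N with hn | hn
    · exact sub_mem_of_le hA ha hn
    · rw [← neg_sub]
      exact (A n).neg_mem (hN n hn (sub_mem_of_le hA ha hn))
  push Not at hstat
  have hlt : ∀ N, ∃ n, N ≤ n ∧ A n < A N := fun N => by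
    obtain ⟨n, hn, hn'⟩ := hstat N
    exact ⟨n, hn, lt_of_le_not_ge (hA hn) hn'⟩
  have hstep : ∀ N, ∃ n, N < n ∧ ∃ p ∈ maximalIdeal R, ∃ d ∈ A N, p * d ∉ A n := fun N => by
    obtain ⟨n₁, hn₁, h₁⟩ := hlt N
    obtain ⟨n₂, hn₂, h₂⟩ := hlt n₁
    refine ⟨n₂, lt_of_le_of_ne (hn₁.trans hn₂) ?_, exists_mul_notMem_of_lt_of_lt hdvd h₂ h₁⟩
    rintro rfl
    exact lt_asymm h₁ h₂
  choose g hg hgA using hstep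
  let φ : ℕ → ℕ := fun n => g^[n] 0
  have hφs : ∀ n, φ (n + 1) = g (φ n) := fun n => Function.iterate_succ_apply' g n 0
  have hφ : StrictMono φ := strictMono_nat_of_lt_succ fun n => by rw [hφs]; exact hg _
  obtain ⟨x, hx⟩ := h (a ∘ φ) (A ∘ φ) (hA.comp_monotone hφ.monotone) (fun n => hb _)
    (fun n => sub_mem_of_le hA ha (hφ n.lt_succ_self).le)
    (fun n => by simpa only [Function.comp, hφs] using hgA (φ n))
  refine ⟨x, fun n => ?_⟩
  have := (A n).add_mem (hA hφ.le_apply (hx n)) (sub_mem_of_le hA ha hφ.le_apply)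
  simpa using this

theorem isAlmostMaximal_of_nestedSolvable (hchain : ∀ I J : Ideal R, I ≤ J ∨ J ≤ I)
    (harch : maximalIdeal R ≠ ⊥ ∧
      ∀ L : Ideal R, L.IsPrime → L ≠ ⊥ → L = maximalIdeal R)
    (hsol : ∀ c : R, c ≠ 0 → NestedSolvable c) : IsAlmostMaximalCR R := by
  classical
  have hdvd := dvd_total_of_chain hchain
  intro ι a A hne hfin
  have hpair : ∀ i j, A i ≤ A j → a i - a j ∈ A j := by
    intro i j hij
    obtain ⟨x, hx⟩ := hfin {i, j}
    have h := (A j).sub_mem (hx j (by simp)) (hij (hx i (by simp)))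
    simpa using h
  by_cases hmin : ∃ i, ∀ j, A i ≤ A j
  · obtain ⟨i, hi⟩ := hmin
    exact ⟨a i, fun j => hpair i j (hi j)⟩
  push Not at hmin
  have hlt : ∀ i, ∃ j, A j < A i := fun i => by
    obtain ⟨j, hj⟩ := hmin i
    exact ⟨j, lt_of_le_not_ge ((hchain _ _).resolve_left hj) hj⟩
  by_cases hι : IsEmpty ι
  · exact ⟨0, fun i => isEmptyElim i⟩
  rw [not_isEmpty_iff] at hι
  set B : Ideal R := ⨅ i, A i with hB
  have hBle : ∀ i, B ≤ A i := fun i => iInf_le A i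
  obtain ⟨c, hcB, hc0⟩ := B.ne_bot_iff.1 hne
  have hB1 : (1 : R) ∉ B := by
    obtain ⟨j, hj⟩ := hlt (Classical.arbitrary ι)
    exact fun h1 => hj.ne_top ((Ideal.eq_top_iff_one _).2 (hBle j h1))
  obtain ⟨t, htP, ht⟩ := exists_seq_generating_maximalIdeal hdvd harch
  have hclose : ∀ n, ∃ i, ∀ x ∈ A i, t n * x ∈ B := by
    intro n
    have hex : ∃ x, t n * x ∈ B ∧ x ∉ B := by
      by_contra! hcon
      have hpow : ∀ m : ℕ, t n ^ m ∈ B → (1 : R) ∈ B := by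
        intro m
        induction m with
        | zero => simp
        | succ m ih => exact fun h => ih (hcon _ (by rwa [← pow_succ']))
      obtain ⟨m, hm⟩ := exists_dvd_pow harch.2 (htP n) hc0
      exact hB1 (hpow m (B.mem_of_dvd hm hcB))
    obtain ⟨x, htx, hx⟩ := hex
    rw [hB, Submodule.mem_iInf, not_forall] at hx
    obtain ⟨i, hi⟩ := hx
    refine ⟨i, fun y hy => ?_⟩
    exact B.mem_of_dvd (mul_dvd_mul_left _ (dvd_of_mem_of_notMem hdvd hi hy)) htx
  choose k hk using hclose
  have hcof : ∀ i, ∃ n, A (k n) ≤ A i := by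
    intro i
    by_contra! hcon
    obtain ⟨j, hj⟩ := hlt i
    obtain ⟨l, hl⟩ := hlt j
    obtain ⟨p, hp, d, hd, hpd⟩ := exists_mul_notMem_of_lt_of_lt hdvd hl hj
    obtain ⟨n, hn⟩ := ht p hp
    have hdk : d ∈ A (k n) := (hchain _ _).resolve_left (hcon n) hd
    exact hpd (hBle l (B.mem_of_dvd (mul_dvd_mul_right hn d) (hk n d hdk)))
  choose a' ha' using fun n : ℕ => hfin ((Finset.range (n + 1)).image k)
  have ha'' : ∀ n m, m ≤ n → a' n - a (k m) ∈ A (k m) := fun n m hm =>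
    ha' n _ (Finset.mem_image_of_mem _ (Finset.mem_range.2 (Nat.lt_succ_of_le hm)))
  let A' : ℕ → Ideal R := fun n => ⨅ m : Fin (n + 1), A (k m)
  have hmem : ∀ n y, y ∈ A' n ↔ ∀ m ≤ n, y ∈ A (k m) := fun n y => by
    rw [Submodule.mem_iInf]
    exact ⟨fun h m hm => h ⟨m, Nat.lt_succ_of_le hm⟩, fun h m => h m (Nat.le_of_lt_succ m.2)⟩
  obtain ⟨x, hx⟩ := hsol c hc0 a' A'
    (fun m n hmn y hy => (hmem m y).2 fun i hi => (hmem n y).1 hy i (hi.trans hmn))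
    (fun n => (hmem n c).2 fun i _ => hBle _ hcB)
    (fun n => (hmem n _).2 fun m hm => by
      have := (A (k m)).sub_mem (ha'' (n + 1) m (hm.trans n.le_succ)) (ha'' n m hm)
      simpa using this)
  refine ⟨x, fun i => ?_⟩
  obtain ⟨n, hn⟩ := hcof i
  have h1 := (A (k n)).add_mem ((hmem n _).1 (hx n) n le_rfl) (ha'' n n le_rfl)
  have h2 := (A i).add_mem (hn h1) (hpair _ i hn)
  simpa using h2

end ChainRing

section Injective

variable {R : Type u} [CommRing R] {E : Type u} [AddCommGroup E] [Module R E]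

/-- A compatible system of linear equations in one unknown is solvable in an injective module. -/
theorem exists_forall_smul_eq (hinj : Module.Injective R E) {ι : Type} (r : ι → R) (g : ι → E)
    (hcomp : ∀ c : ι →₀ R, Finsupp.linearCombination R r c = 0 →
      Finsupp.linearCombination R g c = 0) : ∃ e : E, ∀ i, r i • e = g i := by
  let h := Finsupp.linearCombination R r
  have hle : LinearMap.ker h ≤ LinearMap.ker (Finsupp.linearCombination R g) := fun c hc => hcomp c hc
  let h' := (LinearMap.ker h).liftQ h le_rfl
  have hinj' : Function.Injective h' :=
    LinearMap.ker_eq_bot.1 (Submodule.ker_liftQ_eq_bot _ _ _ le_rfl)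
  obtain ⟨F, hF⟩ := hinj.out h' hinj' ((LinearMap.ker h).liftQ _ hle)
  refine ⟨F 1, fun i => ?_⟩
  have := hF (Submodule.Quotient.mk (Finsupp.single i 1))
  simp only [h', h, Submodule.liftQ_apply, Finsupp.linearCombination_single, one_smul] at this
  rw [← map_smul, smul_eq_mul, mul_one, this]

theorem exists_smul_eq (hinj : Module.Injective R E) (hdvd : ∀ a b : R, a ∣ b ∨ b ∣ a)
    {q r : R} (hqr : q * r ≠ 0) {e : E} (he : r • e = 0) : ∃ e', q • e' = e := by
  obtain ⟨w, hw⟩ := exists_forall_smul_eq hinj (fun _ : Unit => q) (fun _ => e) fun c hc => by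
    rw [Finsupp.linearCombination_unique] at hc ⊢
    rw [smul_eq_mul] at hc
    obtain ⟨w, hw⟩ : r ∣ c default := (hdvd _ _).resolve_right fun ⟨w, hw⟩ => hqr (by
      rw [hw, ← mul_assoc, mul_comm q, hc, zero_mul])
    rw [hw, mul_comm, mul_smul, he, smul_zero]
  exact ⟨w, hw ()⟩

/-- An injective module is complete with respect to the annihilators of scalars. -/
theorem exists_forall_smul_sub_eq_zero (hinj : Module.Injective R E) (r : ℕ → R) (e : ℕ → E)
    (h : ∀ m n, m ≤ n → r m • (e n - e m) = 0) : ∃ x, ∀ n, r n • (x - e n) = 0 := by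
  obtain ⟨x, hx⟩ := exists_forall_smul_eq hinj r (fun n => r n • e n) fun c hc => by
    obtain ⟨N, hN⟩ := c.support.bddAbove
    rw [Finsupp.linearCombination_apply, Finsupp.sum] at hc ⊢
    have h1 : ∀ n ∈ c.support, c n • r n • e n = (c n • r n) • e N := fun n hn => by
      have := h n N (hN hn)
      rw [smul_sub, sub_eq_zero] at this
      rw [smul_assoc, this]
    rw [Finset.sum_congr rfl h1, ← Finset.sum_smul, hc, zero_smul]
  exact ⟨x, fun n => by rw [smul_sub, hx, sub_self]⟩

variable [IsLocalRing R]

theorem card_le_of_malcevRankLE {k : ℕ} (hk : MalcevRankLE R E k) {m : ℕ} (x : Fin m → E)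
    (hx : ∀ c : Fin m → R, ∑ i, c i • x i = 0 → ∀ i, c i ∈ maximalIdeal R) : m ≤ k := by
  classical
  obtain ⟨s, hsX, hsk, hs⟩ := hk (Submodule.span R (Set.range x))
    (Submodule.fg_span (Set.finite_range x))
  have h1 : ∀ i, ∃ C : s → R, ∑ j, C j • (j : E) = x i := fun i => by
    have : x i ∈ Submodule.span R (s : Set E) := by
      rw [hs]; exact Submodule.subset_span (Set.mem_range_self i)
    rw [← Subtype.range_coe (s := (s : Set E))] at this
    exact (Submodule.mem_span_range_iff_exists_fun R).1 this
  have h2 : ∀ j : s, ∃ D : Fin m → R, ∑ i, D i • x i = j := fun j =>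
    (Submodule.mem_span_range_iff_exists_fun R).1 (hsX j.2)
  choose C hC using h1
  choose D hD using h2
  let M : Matrix (Fin m) s (ResidueField R) := (Matrix.of C).map (residue R)
  let N : Matrix s (Fin m) (ResidueField R) := (Matrix.of D).map (residue R)
  have hMN : M * N = 1 := by
    have hent : ∀ i l, (Matrix.of C * Matrix.of D) i l - (1 : Matrix (Fin m) (Fin m) R) i l
        ∈ maximalIdeal R := fun i => hx _ (by
      simp only [sub_smul, Finset.sum_sub_distrib, Matrix.mul_apply, Matrix.of_apply,
        Matrix.one_apply, ite_smul, one_smul, zero_smul, Finset.sum_ite_eq, Finset.mem_univ,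
        if_true, Finset.sum_smul]
      rw [Finset.sum_comm, sub_eq_zero, ← hC i]
      refine Finset.sum_congr rfl fun j _ => ?_
      rw [← hD j, Finset.smul_sum]
      exact Finset.sum_congr rfl fun l _ => by rw [mul_smul])
    have h3 : M * N = (Matrix.of C * Matrix.of D).map (residue R) := (Matrix.map_mul).symm
    rw [h3]
    ext i l
    have h4 := (residue_eq_zero_iff _).2 (hent i l)
    rw [map_sub, sub_eq_zero] at h4
    rw [Matrix.map_apply, h4, Matrix.one_apply, Matrix.one_apply]
    split_ifs <;> simp
  have hrank := Matrix.rank_mul_le_left M N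
  rw [hMN, Matrix.rank_one, Fintype.card_fin] at hrank
  have := hrank.trans (Matrix.rank_le_card_width M)
  rw [Fintype.card_coe] at this
  exact this.trans hsk

theorem exists_common_dvd (hdvd : ∀ a b : R, a ∣ b ∨ b ∣ a) (hP : maximalIdeal R ≠ ⊥) {n : ℕ}
    (p : Fin n → R) (hp : ∀ i, p i ∈ maximalIdeal R) :
    ∃ s ∈ maximalIdeal R, s ≠ 0 ∧ ∀ i, s ∣ p i := by
  induction n with
  | zero =>
    obtain ⟨s, hs, hs0⟩ := (maximalIdeal R).ne_bot_iff.1 hP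
    exact ⟨s, hs, hs0, fun i => i.elim0⟩
  | succ n ih =>
    obtain ⟨s, hs, hs0, hsp⟩ := ih (Fin.tail p) fun i => hp i.succ
    rcases hdvd s (p 0) with h | h
    · exact ⟨s, hs, hs0, fun i => Fin.cases h hsp i⟩
    · exact ⟨p 0, hp 0, fun h0 => hs0 (zero_dvd_iff.1 (h0 ▸ h)),
        fun i => Fin.cases dvd_rfl (fun i => h.trans (hsp i)) i⟩

/-- In an injective module of finite Malcev rank some annihilator `E[s]` with `s ≠ 0` is contained
in a finitely generated submodule. -/
theorem exists_torsionBy_le_span (hinj : Module.Injective R E)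
    (hdvd : ∀ a b : R, a ∣ b ∨ b ∣ a) (hP0 : maximalIdeal R ≠ ⊥)
    (hP : ∀ a ∈ maximalIdeal R, ∃ x ∈ maximalIdeal R, ∃ y ∈ maximalIdeal R, a = x * y)
    (hmr : ∃ k : ℕ, MalcevRankLE R E k) :
    ∃ (n : ℕ) (y : Fin n → E), ∃ s ∈ maximalIdeal R, s ≠ 0 ∧
      Submodule.torsionBy R E s ≤ Submodule.span R (Set.range y) := by
  classical
  obtain ⟨k, hk⟩ := hmr
  let Q : ℕ → Prop := fun n => ∃ x : Fin n → E, (∀ i, ∃ p ∈ maximalIdeal R, ∃ z, x i = p • z) ∧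
    ∀ c : Fin n → R, ∑ i, c i • x i = 0 → ∀ i, c i ∈ maximalIdeal R
  have hQ0 : Q 0 := ⟨Fin.elim0, fun i => i.elim0, fun _ _ i => i.elim0⟩
  have hQk : ¬ Q (k + 1) := fun ⟨x, _, hx⟩ =>
    absurd (card_le_of_malcevRankLE hk x hx) (by omega)
  obtain ⟨n, ⟨x, hxP, hx⟩, hn⟩ : ∃ n, Q n ∧ ¬ Q (n + 1) := by
    by_contra! hcon
    exact hQk (Nat.rec hQ0 (fun n ih => hcon n ih) (k + 1))
  choose p hp z hz using hxP
  obtain ⟨s, hs, hs0, hsp⟩ := exists_common_dvd hdvd hP0 p hp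
  choose w hw using hsp
  obtain ⟨a, ha, b, hb, rfl⟩ := hP s hs
  obtain ⟨r, hr, t, ht, rfl⟩ := hP a ha
  have hrt : t * r ≠ 0 := by
    intro h
    exact hs0 (by rw [mul_comm r, h, zero_mul])
  let y : Fin n → E := fun i => b • w i • z i
  have hxy : ∀ i, x i = (r * t) • y i := fun i => by
    rw [hz, hw, mul_smul, mul_smul]
  refine ⟨n, y, r, hr, fun h => hrt (by rw [h, mul_zero]), fun e he => ?_⟩
  rw [Submodule.mem_torsionBy_iff] at he
  obtain ⟨e', he'⟩ := exists_smul_eq hinj hdvd hrt he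
  by_contra hey
  refine hn ⟨Fin.cons e y, fun i => ?_, fun c hc => ?_⟩
  · refine Fin.cases ?_ (fun i => ?_) i
    · exact ⟨t, ht, e', by simp [he']⟩
    · exact ⟨b, hb, w i • z i, by simp [y]⟩
  · rw [Fin.sum_univ_succ] at hc
    simp only [Fin.cons_zero, Fin.cons_succ] at hc
    have h1 : ∀ i : Fin n, c i.succ ∈ maximalIdeal R := hx (fun i => c i.succ) (by
      have h2 := congrArg (fun v => (r * t) • v) hc
      simp only [smul_add, smul_zero, Finset.smul_sum] at h2
      rw [smul_comm (r * t) (c 0) e, mul_comm r t, mul_smul t r e, he, smul_zero, smul_zero,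
        zero_add, mul_comm t r] at h2
      rw [← h2]
      exact Finset.sum_congr rfl fun i _ => by rw [hxy, smul_comm])
    refine fun i => Fin.cases ?_ h1 i
    by_contra hc0
    rw [mem_maximalIdeal, mem_nonunits_iff, not_not] at hc0
    refine hey ((Submodule.smul_mem_iff_of_isUnit _ hc0).1 ?_)
    rw [eq_neg_of_add_eq_zero_left hc]
    exact Submodule.neg_mem _ (Submodule.sum_mem _ fun i _ =>
      Submodule.smul_mem _ _ (Submodule.subset_span (Set.mem_range_self i)))

theorem exists_nestedSolvable (hinj : Module.Injective R E)
    (hdvd : ∀ a b : R, a ∣ b ∨ b ∣ a)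
    (harch : maximalIdeal R ≠ ⊥ ∧
      ∀ L : Ideal R, L.IsPrime → L ≠ ⊥ → L = maximalIdeal R)
    (hP : ∀ a ∈ maximalIdeal R, ∃ x ∈ maximalIdeal R, ∃ y ∈ maximalIdeal R, a = x * y)
    (htors : ∀ r ∈ maximalIdeal R, ∃ e : E, e ≠ 0 ∧ r • e = 0)
    (hmr : ∃ k : ℕ, MalcevRankLE R E k) :
    ∃ b ∈ maximalIdeal R, NestedSolvable b := by
  classical
  have hex := exists_torsionBy_le_span hinj hdvd harch.1 hP hmr
  obtain ⟨y, s, hs, hs0, hsy⟩ := Nat.find_spec hex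
  have hmin' := fun m => Nat.find_min hex (m := m)
  revert y hmin'
  generalize Nat.find hex = N
  intro y hsy hmin'
  obtain rfl | ⟨m, rfl⟩ : N = 0 ∨ ∃ m, N = m + 1 := by cases N <;> simp
  · obtain ⟨e, he0, he⟩ := htors s hs
    have := hsy ((Submodule.mem_torsionBy_iff _ _).2 he)
    rw [Set.range_eq_empty, Submodule.span_empty, Submodule.mem_bot] at this
    exact absurd this he0
  set H : Submodule R E := Submodule.span R (Set.range (Fin.tail y)) with hH
  set π := H.mkQ with hπ
  set v := π (y 0) with hv
  have hrep : ∀ e, s • e = 0 → ∃ a : R, π e = a • v := by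
    intro e he
    obtain ⟨c, hc⟩ := (Submodule.mem_span_range_iff_exists_fun R).1
      (hsy ((Submodule.mem_torsionBy_iff _ _).2 he))
    refine ⟨c 0, ?_⟩
    rw [← hc, Fin.sum_univ_succ, map_add, map_smul, add_eq_left, hπ, Submodule.mkQ_apply,
      Submodule.Quotient.mk_eq_zero]
    exact Submodule.sum_mem _ fun i _ =>
      Submodule.smul_mem _ _ (Submodule.subset_span ⟨i, rfl⟩)
  have hmin : ∀ r ∈ maximalIdeal R, r ≠ 0 → ∃ e, r • e = 0 ∧ π e ≠ 0 := by
    intro r hr hr0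
    by_contra! hcon
    refine hmin' m m.lt_succ_self ⟨Fin.tail y, r, hr, hr0, fun e he => ?_⟩
    have := hcon e ((Submodule.mem_torsionBy_iff _ _).1 he)
    rwa [hπ, Submodule.mkQ_apply, Submodule.Quotient.mk_eq_zero] at this
  clear_value v π H
  let J : Ideal R := Submodule.comap (LinearMap.toSpanSingleton R _ v)
    (Submodule.map π (Submodule.torsionBy R E s))
  have hJ : ∀ a, a ∈ J ↔ ∃ e, s • e = 0 ∧ π e = a • v := fun a => by
    simp [J, Submodule.mem_comap, Submodule.mem_map]
  obtain ⟨r₀, hr₀, b, hb, hsb⟩ := hP s hs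
  obtain ⟨j, ej, hej, hπj, hbj⟩ : ∃ (j : R) (e : E), s • e = 0 ∧ π e = j • v ∧ (b * j) • v ≠ 0 := by
    obtain ⟨e, he, he0⟩ := hmin r₀ hr₀ fun h => hs0 (by rw [hsb, h, zero_mul])
    obtain ⟨e', rfl⟩ := exists_smul_eq hinj hdvd (q := b) (by rwa [mul_comm, ← hsb]) he
    rw [← mul_smul, ← hsb] at he
    obtain ⟨j, hj⟩ := hrep e' he
    exact ⟨j, e', he, hj, by rwa [mul_smul, ← hj, ← map_smul]⟩
  have hjJ : j ∈ J := (hJ j).2 ⟨ej, hej, hπj⟩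
  have hJ0 : J ≠ ⊥ := J.ne_bot_iff.2 ⟨j, hjJ, fun h => hbj (by rw [h, mul_zero, zero_smul])⟩
  have hbdvd : ∀ x, (x * j) • v = 0 → b ∣ x := fun x hx =>
    (hdvd b x).resolve_right fun ⟨w, hw⟩ => hbj (by
      rw [hw, mul_comm x, mul_assoc, mul_smul, hx, smul_zero])
  refine ⟨b, hb, nestedSolvable_of_strict hdvd fun a A hA hbA ha hstrict => ?_⟩
  choose p hp d hd hpd using hstrict
  have hj' : ∀ n, ∃ j' ∈ J, j' ∣ j ∧ ∀ x ∈ J, j' ∣ p n * x := by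
    intro n
    obtain ⟨j₁, hj₁, h⟩ := exists_mem_forall_dvd_mul hdvd harch.2 hJ0 (hp n)
    rcases hdvd j j₁ with h' | h'
    · exact ⟨j, hjJ, dvd_rfl, fun x hx => h'.trans (h x hx)⟩
    · exact ⟨j₁, hj₁, h', h⟩
  choose j' hj'J hj'j hj'p using hj'
  choose g hg using hj'j
  choose e' he's he'π using fun n => (hJ _).1 (hj'J n)
  let q : ℕ → R := fun n => g n * (p n * d n)
  have hqj : ∀ n, q n * j' n = p n * d n * j := fun n => by
    calc g n * (p n * d n) * j' n = p n * d n * (j' n * g n) := by ring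
      _ = p n * d n * j := by rw [← hg]
  have hqJ : ∀ n, ∀ x ∈ J, ∃ z, q n * x = d n * z * j := fun n x hx => by
    obtain ⟨z, hz⟩ := hj'p n x hx
    refine ⟨z, ?_⟩
    calc g n * (p n * d n) * x = g n * d n * (p n * x) := by ring
      _ = d n * z * (j' n * g n) := by rw [hz]; ring
      _ = d n * z * j := by rw [← hg]
  have hqs : ∀ n, q n ∣ s := fun n => (hdvd _ _).resolve_right fun ⟨u, hu⟩ => by
    refine hpd n ((A (n + 1)).mem_of_dvd (hbdvd _ ?_) (hbA _))
    rw [← hqj, hu, mul_comm s, mul_assoc, mul_smul, mul_smul, ← he'π, ← map_smul, he's, map_zero,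
      smul_zero]
  choose r hr using hqs
  have hqq : ∀ n, q n ∣ q (n + 1) := fun n => (hdvd _ _).resolve_right fun ⟨w, hw⟩ => by
    obtain ⟨z, hz⟩ := hqJ (n + 1) (j' n) (hj'J n)
    have h1 : (p n * d n - d (n + 1) * (z * w)) * j = 0 := by
      rw [sub_mul, ← hqj n, hw, mul_right_comm, hz]; ring
    have h2 : p n * d n - d (n + 1) * (z * w) ∈ A (n + 1) :=
      (A (n + 1)).mem_of_dvd (hbdvd _ (by rw [h1, zero_smul])) (hbA _)
    exact hpd n (((A (n + 1)).sub_mem_iff_left (Ideal.mul_mem_right _ _ (hd (n + 1)))).1 h2)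
  have hrr : ∀ n, r (n + 1) ∣ r n := fun n => by
    rcases hdvd (r (n + 1)) (r n) with h | ⟨w, hw⟩
    · exact h
    · obtain ⟨t, ht⟩ := hqq n
      by_cases hw' : w ∈ maximalIdeal R
      · refine absurd (eq_zero_of_eq_mul (c := s) (Ideal.mul_mem_left _ t hw') ?_) hs0
        calc s = q (n + 1) * r (n + 1) := hr _
          _ = q n * r n * (t * w) := by rw [ht, hw]; ring
          _ = s * (t * w) := by rw [← hr]
      · rw [mem_maximalIdeal, mem_nonunits_iff, not_not] at hw'
        rw [hw]
        exact hw'.mul_right_dvd.2 dvd_rfl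
  have hδ : ∀ n, ∃ δ : E, r n • δ = 0 ∧ π δ = ((a (n + 2) - a (n + 1)) * j) • v := fun n => by
    obtain ⟨w, hw⟩ := dvd_of_mem_of_notMem hdvd (hpd n) (ha (n + 1))
    refine ⟨(w * q n) • e' n, ?_, ?_⟩
    · rw [← mul_smul, show r n * (w * q n) = w * (q n * r n) by ring, ← hr, mul_smul, he's,
        smul_zero]
    · rw [map_smul, he'π, ← mul_smul, mul_assoc, hqj, hw]
      congr 1
      ring
  choose δ hδr hδπ using hδ
  let e : ℕ → E := fun n => a 1 • ej + ∑ i ∈ Finset.range n, δ i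
  have heπ : ∀ n, π (e n) = (a (n + 1) * j) • v := by
    intro n
    induction n with
    | zero => simp [e, hπj, mul_smul]
    | succ n ih =>
      have h1 : e (n + 1) = e n + δ n := by simp only [e, Finset.sum_range_succ, add_assoc]
      rw [h1, map_add, ih, hδπ, ← add_smul]
      congr 1
      ring
  have hec : ∀ m n, m ≤ n → r m • (e n - e m) = 0 := by
    intro m n hmn
    have h1 : e n - e m = ∑ i ∈ Finset.Ico m n, δ i := by
      rw [Finset.sum_Ico_eq_sub _ hmn]; simp [e]
    rw [h1, Finset.smul_sum]
    refine Finset.sum_eq_zero fun i hi => ?_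
    have h2 : r i ∣ r m := by
      have := (Finset.mem_Ico.1 hi).1
      induction i, this using Nat.le_induction with
      | base => exact dvd_rfl
      | succ i hmi ih =>
        exact (hrr i).trans (ih (Finset.mem_Ico.2 ⟨hmi, by have := (Finset.mem_Ico.1 hi).2; omega⟩))
    obtain ⟨w, hw⟩ := h2
    rw [hw, mul_comm, mul_smul, hδr, smul_zero]
  obtain ⟨x, hx⟩ := exists_forall_smul_sub_eq_zero hinj r e hec
  have hstep : ∀ n, ∃ z, π x = ((a (n + 1) + d n * z) * j) • v := by
    intro n
    obtain ⟨e'', he''⟩ := exists_smul_eq hinj hdvd (by rwa [← hr n]) (hx n)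
    have hse : s • e'' = 0 := by rw [hr n, mul_comm, mul_smul, he'', hx]
    obtain ⟨c, hc⟩ := hrep e'' hse
    obtain ⟨z, hz⟩ := hqJ n c ((hJ c).2 ⟨e'', hse, hc⟩)
    refine ⟨z, ?_⟩
    have h1 : x = e n + q n • e'' := by rw [he'', add_sub_cancel]
    rw [h1, map_add, heπ, map_smul, hc, ← mul_smul, hz, ← add_smul, add_mul]
  choose z hz using hstep
  refine ⟨a 1 + d 0 * z 0, fun n => ?_⟩
  have h1 : ((a 1 + d 0 * z 0 - (a (n + 1) + d n * z n)) * j) • v = 0 := by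
    rw [sub_mul, sub_smul, ← hz n, ← hz 0, sub_self]
  have h2 := (A n).mem_of_dvd (hbdvd _ h1) (hbA n)
  have h3 := (A n).add_mem ((A n).add_mem h2 (Ideal.mul_mem_right (z n) _ (hd n))) (ha n)
  convert h3 using 1
  ring

end Injective

theorem exists_nestedSolvable_of_ne {R : Type u} [CommRing R] [IsLocalRing R]
    (hdvd : ∀ a b : R, a ∣ b ∨ b ∣ a)
    (hP : maximalIdeal R * maximalIdeal R ≠ maximalIdeal R) :
    ∃ b ∈ maximalIdeal R, NestedSolvable b := by
  obtain ⟨p, hp, hp2⟩ := SetLike.exists_of_lt (lt_of_le_of_ne Ideal.mul_le_left hP)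
  refine ⟨p, hp, nestedSolvable_of_strict hdvd fun a A _ hpA _ hstrict => ?_⟩
  obtain ⟨q, hq, d, -, hqd⟩ := hstrict 0
  refine absurd ((A 1).mem_of_dvd ?_ (hpA 1)) hqd
  exact (maximalIdeal_eq_span_of_notMem hdvd hp2 hq).mul_right d

end ArchimedeanChainRing

/-- an Archimedean chain ring admitting a nonzero injective module `E` with
`E_♯ = P` and finite Malcev rank is almost maximal. -/
theorem stmt10 (R : Type u) [CommRing R] [IsLocalRing R]
    (hchain : ∀ I J : Ideal R, I ≤ J ∨ J ≤ I)
    (harch : IsLocalRing.maximalIdeal R ≠ ⊥ ∧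
      ∀ L : Ideal R, L.IsPrime → L ≠ ⊥ → L = IsLocalRing.maximalIdeal R)
    (E : Type u) [AddCommGroup E] [Module R E]
    (hnz : ∃ x : E, x ≠ 0) (hinj : Module.Injective R E)
    (hsharp : sharpSet R E = (IsLocalRing.maximalIdeal R : Set R))
    (hmr : ∃ k : ℕ, MalcevRankLE R E k) :
    IsAlmostMaximalCR R := by
  have hdvd := ArchimedeanChainRing.dvd_total_of_chain hchain
  obtain ⟨b, hbP, hb⟩ : ∃ b ∈ IsLocalRing.maximalIdeal R,
      ArchimedeanChainRing.NestedSolvable b := by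
    by_cases hP : IsLocalRing.maximalIdeal R * IsLocalRing.maximalIdeal R
        = IsLocalRing.maximalIdeal R
    · refine ArchimedeanChainRing.exists_nestedSolvable hinj hdvd harch (fun a ha => ?_)
        (fun r hr => ?_) hmr
      · rw [← hP] at ha
        exact ArchimedeanChainRing.exists_eq_mul_of_mem_mul hdvd ha
      · exact hsharp.ge hr
    · exact ArchimedeanChainRing.exists_nestedSolvable_of_ne hdvd hP
  exact ArchimedeanChainRing.isAlmostMaximal_of_nestedSolvable hchain harch fun c hc =>
    hb.of_mem_maximalIdeal hdvd harch.2 hbP hc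
end
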